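/- arXiv:1704.08474 — 5 statements merged into one kernel-verified Lean document; each statement's English description precedes it below -/
import Mathlib

section
/- Let n ≥ 2 be an even integer and p ≥ 1 an integer with n ≤ 4p. For every vertex v ∈ V^1_0 of AT(n,p), d(v, V^0_p) = n²/4 + 2np − n. -/
open SimpleGraph

/-- Base relation for the armchair nanotube `AT(n,p)`: vertices are pairs `(i, j)` with
layer `i ∈ {0, …, p}` and position `j ∈ ℤ/2nℤ`.  `(i,j)` is related to `(i, j+1)`,
and to `(i+1, j-1)` when `j ≡ 2 (mod 4)`, and to `(i+1, j+1)` when `j ≡ 3 (mod 4)`. -/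
def ATRel (n p : ℕ) (u v : Fin (p + 1) × ZMod (2 * n)) : Prop :=
  (u.1 = v.1 ∧ v.2 = u.2 + 1) ∨
    ((u.1 : ℕ) + 1 = (v.1 : ℕ) ∧
      ((u.2.val % 4 = 2 ∧ v.2 = u.2 - 1) ∨ (u.2.val % 4 = 3 ∧ v.2 = u.2 + 1)))

/-- The armchair nanotube `AT(n,p)` as a simple graph. -/
def AT (n p : ℕ) : SimpleGraph (Fin (p + 1) × ZMod (2 * n)) :=
  SimpleGraph.fromRel (ATRel n p)

/-- `Vset n p k i` is the set `V^k_i` of vertices of type `k` in layer `i` of `AT(n,p)`: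
type `0` means `j mod 4 ∈ {0,1}`, type `1` means `j mod 4 ∈ {2,3}`. -/
def Vset (n p : ℕ) (k i : ℕ) : Set (Fin (p + 1) × ZMod (2 * n)) :=
  {v | (v.1 : ℕ) = i ∧ v.2.val % 4 / 2 = k}

/-- The set of vertices of `AT(n,p)` in layer `i` (the vertex set of the induced
cycle `C1` for `i = 0`, and of `C2` for `i = p`). -/
def layer (n p : ℕ) (i : ℕ) : Set (Fin (p + 1) × ZMod (2 * n)) :=
  {v | (v.1 : ℕ) = i}


/-- Cyclic distance from `0` modulo `n`. -/
def cyc (n : ℕ) (k : ℤ) : ℤ := min (k % n) (n - k % n)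

/-- Lifted column position of the vertex with index `m` and type `t`. -/
def colJ (m t : ℤ) : ℤ := if (m + t) % 2 = 0 then 2 * m + 1 else 2 * m + 2

/-- The vertex in layer `i` (for `i ≤ p`) with index `m` and type `t`. -/
def vtx (n p : ℕ) (i : ℕ) (m t : ℤ) : Fin (p + 1) × ZMod (2 * n) :=
  (⟨min i p, by omega⟩, ((colJ m t : ℤ) : ZMod (2 * n)))

/-- The potential used for the lower bound. -/
def pot (n p : ℕ) (m0 : ℤ) (u : Fin (p + 1) × ZMod (2 * n)) : ℤ :=
  2 * ((u.1 : ℕ) : ℤ) + ((u.2.val : ℤ) % 4 / 2) + cyc n (((u.2.val : ℤ) - 1) / 2 - m0)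

lemma cyc_add_mul (n : ℕ) (k c : ℤ) : cyc n (k + n * c) = cyc n k := by
  simp [cyc]

lemma cyc_succ (n : ℕ) (hn : 0 < n) (k : ℤ) : |cyc n (k + 1) - cyc n k| ≤ 1 := by
  have h0 := Int.emod_nonneg k (b := (n : ℤ)) (by omega)
  have h1 := Int.emod_lt_of_pos k (b := (n : ℤ)) (by omega)
  have h2 : (k + 1) % (n : ℤ) = (k % n + 1) % n := by simp
  unfold cyc
  rw [h2]
  by_cases h : k % (n : ℤ) + 1 = n
  · rw [h, Int.emod_self, abs_le]; omega
  · rw [Int.emod_eq_of_lt (a := k % (n : ℤ) + 1) (by omega) (by omega), abs_le]; omega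

lemma val_cast (q : ℕ) (hq : 0 < q) (a : ℤ) :
    ∃ w : ℤ, (((a : ZMod (2 * (2 * q))).val : ℕ) : ℤ) = a + 4 * (q * w) := by
  have : NeZero (2 * (2 * q)) := ⟨by omega⟩
  refine ⟨-(a / ((2 * (2 * q) : ℕ) : ℤ)), ?_⟩
  rw [ZMod.val_intCast, Int.emod_def]
  push_cast
  ring

lemma pot_cast (q p : ℕ) (hq : 0 < q) (m0 : ℤ) (i : Fin (p + 1)) (a : ℤ) :
    pot (2 * q) p m0 (i, (a : ZMod (2 * (2 * q)))) =
      2 * ((i : ℕ) : ℤ) + (a % 4 / 2) + cyc (2 * q) ((a - 1) / 2 - m0) := by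
  obtain ⟨w, hw⟩ := val_cast q hq a
  unfold pot
  simp only [hw]
  have h1 : (a + 4 * (q * w)) % 4 = a % 4 := by omega
  have h2 : (a + 4 * (q * w) - 1) / 2 - m0 = ((a - 1) / 2 - m0) + ((2 * q : ℕ) : ℤ) * w := by
    have : ((2 * q : ℕ) : ℤ) * w = 2 * (q * w) := by push_cast; ring
    rw [this]; omega
  rw [h1, h2, cyc_add_mul]

lemma pot_rel (q p : ℕ) (hq : 0 < q) (m0 : ℤ) (u v : Fin (p + 1) × ZMod (2 * (2 * q)))
    (h : ATRel (2 * q) p u v) : |pot (2 * q) p m0 v - pot (2 * q) p m0 u| ≤ 1 := by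
  have : NeZero (2 * (2 * q)) := ⟨by omega⟩
  obtain ⟨i, x⟩ := u
  obtain ⟨j, y⟩ := v
  have hx : x = (((x.val : ℕ) : ℤ) : ZMod (2 * (2 * q))) := by simp
  obtain ⟨a, ha⟩ : ∃ a : ℕ, a = x.val := ⟨_, rfl⟩
  simp only [ATRel] at h
  rw [← ha] at h hx
  subst hx
  rcases h with ⟨hij, hy⟩ | ⟨hij, ⟨h4, hy⟩ | ⟨h4, hy⟩⟩
  · have hy' : y = (((a : ℤ) + 1 : ℤ) : ZMod (2 * (2 * q))) := by rw [hy]; push_cast; rfl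
    subst hij
    rw [hy', pot_cast q p hq, pot_cast q p hq]
    have hc := cyc_succ (2 * q) (by omega) (((a : ℤ) - 1) / 2 - m0)
    rcases Nat.even_or_odd' a with ⟨b, hb | hb⟩
    · have e : ((a : ℤ) + 1 - 1) / 2 - m0 = (((a : ℤ) - 1) / 2 - m0) + 1 := by omega
      rw [e]
      rw [abs_le] at hc ⊢
      omega
    · have e : ((a : ℤ) + 1 - 1) / 2 - m0 = (((a : ℤ) - 1) / 2 - m0) := by omega
      rw [e, abs_le]
      omega
  · have hy' : y = (((a : ℤ) - 1 : ℤ) : ZMod (2 * (2 * q))) := by rw [hy]; push_cast; rfl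
    rw [hy', pot_cast q p hq, pot_cast q p hq]
    have e : ((a : ℤ) - 1 - 1) / 2 - m0 = (((a : ℤ) - 1) / 2 - m0) := by omega
    rw [e, abs_le]
    omega
  · have hy' : y = (((a : ℤ) + 1 : ℤ) : ZMod (2 * (2 * q))) := by rw [hy]; push_cast; rfl
    rw [hy', pot_cast q p hq, pot_cast q p hq]
    have e : ((a : ℤ) + 1 - 1) / 2 - m0 = (((a : ℤ) - 1) / 2 - m0) := by omega
    rw [e, abs_le]
    omega

lemma pot_walk (q p : ℕ) (hq : 0 < q) (m0 : ℤ) (u v : Fin (p + 1) × ZMod (2 * (2 * q)))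
    (w : (AT (2 * q) p).Walk u v) :
    pot (2 * q) p m0 v - pot (2 * q) p m0 u ≤ w.length := by
  induction w with
  | nil => simp
  | cons h w ih =>
    rw [AT, SimpleGraph.fromRel_adj] at h
    rw [SimpleGraph.Walk.length_cons]
    push_cast
    rcases h.2 with h | h
    · have := pot_rel q p hq m0 _ _ h
      rw [abs_le] at this
      omega
    · have := pot_rel q p hq m0 _ _ h
      rw [abs_le] at this
      omega

lemma pot_vtx (q p : ℕ) (hq : 0 < q) (m0 m t : ℤ) (ht : t = 0 ∨ t = 1) (i : ℕ) (hi : i ≤ p) :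
    pot (2 * q) p m0 (vtx (2 * q) p i m t) = 2 * (i : ℤ) + t + cyc (2 * q) (m - m0) := by
  unfold vtx
  rw [pot_cast q p hq]
  have h1 : (colJ m t - 1) / 2 = m := by unfold colJ; split <;> omega
  have h2 : colJ m t % 4 / 2 = t := by unfold colJ; split <;> omega
  rw [h1, h2]
  simp [hi]

lemma one_ne (q : ℕ) (hq : 0 < q) (x : ZMod (2 * (2 * q))) : x ≠ x + 1 := by
  have : Fact (1 < 2 * (2 * q)) := ⟨by omega⟩
  intro h
  exact one_ne_zero (left_eq_add.mp h)

lemma val_mod (q : ℕ) (hq : 0 < q) (a : ℤ) (r : ℕ) (h : a % 4 = r) :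
    (a : ZMod (2 * (2 * q))).val % 4 = r := by
  obtain ⟨w, hw⟩ := val_cast q hq a
  omega

lemma adj_hor (q p : ℕ) (hq : 0 < q) (i : ℕ) (m t m' t' : ℤ) (h : colJ m' t' = colJ m t + 1) :
    (AT (2 * q) p).Adj (vtx (2 * q) p i m t) (vtx (2 * q) p i m' t') := by
  rw [AT, SimpleGraph.fromRel_adj]
  have e : (vtx (2 * q) p i m' t').2 = (vtx (2 * q) p i m t).2 + 1 := by
    simp [vtx, h]
  refine ⟨fun h' => ?_, Or.inl (Or.inl ⟨rfl, e⟩)⟩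
  rw [← h'] at e
  exact one_ne q hq _ e

lemma adj_type (q p : ℕ) (hq : 0 < q) (i : ℕ) (m : ℤ) :
    (AT (2 * q) p).Adj (vtx (2 * q) p i m 0) (vtx (2 * q) p i m 1) := by
  rcases Int.even_or_odd' m with ⟨b, hb | hb⟩
  · apply adj_hor q p hq
    unfold colJ
    split <;> split <;> omega
  · symm
    apply adj_hor q p hq
    unfold colJ
    split <;> split <;> omega

lemma adj_right (q p : ℕ) (hq : 0 < q) (i : ℕ) (m t : ℤ) (h : (m + t) % 2 = 1) :
    (AT (2 * q) p).Adj (vtx (2 * q) p i m t) (vtx (2 * q) p i (m + 1) t) := by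
  apply adj_hor q p hq
  unfold colJ
  split <;> split <;> omega

lemma adj_up (q p : ℕ) (hq : 0 < q) (i : ℕ) (hi : i < p) (m : ℤ) :
    (AT (2 * q) p).Adj (vtx (2 * q) p i m 1) (vtx (2 * q) p (i + 1) m 0) := by
  rw [AT, SimpleGraph.fromRel_adj]
  have e : ((vtx (2 * q) p i m 1).1 : ℕ) + 1 = (vtx (2 * q) p (i + 1) m 0).1 := by
    simp only [vtx]; omega
  refine ⟨fun h' => ?_, Or.inl (Or.inr ⟨e, ?_⟩)⟩
  · rw [h'] at e; omega
  rcases Int.even_or_odd' m with ⟨b, hb | hb⟩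
  · left
    refine ⟨val_mod q hq _ 2 ?_, ?_⟩
    · unfold colJ; split <;> omega
    · have : colJ m 0 = colJ m 1 - 1 := by unfold colJ; split <;> split <;> omega
      simp [vtx, this]
  · right
    refine ⟨val_mod q hq _ 3 ?_, ?_⟩
    · unfold colJ; split <;> omega
    · have : colJ m 0 = colJ m 1 + 1 := by unfold colJ; split <;> split <;> omega
      simp [vtx, this]

/-- Type of the `t`-th state of a shortest climb. -/
def stT (t : ℕ) : ℤ := ((t : ℤ) + 1) % 2

lemma adj_next (q p : ℕ) (hq : 0 < q) (t : ℕ) (ht : (t + 2) / 2 ≤ p) (m : ℤ) :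
    (AT (2 * q) p).Adj (vtx (2 * q) p ((t + 1) / 2) m (stT t))
      (vtx (2 * q) p ((t + 1 + 1) / 2) m (stT (t + 1))) := by
  rcases Nat.even_or_odd' t with ⟨b, hb | hb⟩
  · have e1 : stT t = 1 := by unfold stT; omega
    have e2 : stT (t + 1) = 0 := by unfold stT; omega
    have e3 : (t + 1 + 1) / 2 = (t + 1) / 2 + 1 := by omega
    rw [e1, e2, e3]
    exact adj_up q p hq _ (by omega) m
  · have e1 : stT t = 0 := by unfold stT; omega
    have e2 : stT (t + 1) = 1 := by unfold stT; omega
    have e3 : (t + 1 + 1) / 2 = (t + 1) / 2 := by omega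
    rw [e1, e2, e3]
    exact adj_type q p hq _ m

lemma reach (q p : ℕ) (hq : 0 < q) (m0 ε : ℤ) (b : ℕ)
    (hstep : ∀ t s : ℕ, s + 1 = t + b → (AT (2 * q) p).Adj
      (vtx (2 * q) p ((t + 1) / 2) (m0 + ε * s) (stT t))
      (vtx (2 * q) p ((t + 1) / 2) (m0 + ε * (s + 1 : ℕ)) (stT t))) (hb : b ≤ 1)
    (t : ℕ) (ht : (t + 1) / 2 ≤ p) (s : ℕ) (hs : s ≤ t + b) :
    ∃ w : (AT (2 * q) p).Walk (vtx (2 * q) p 0 m0 1)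
      (vtx (2 * q) p ((t + 1) / 2) (m0 + ε * s) (stT t)), w.length = t + s := by
  induction t generalizing s with
  | zero =>
    have e0 : vtx (2 * q) p 0 m0 1 =
      vtx (2 * q) p ((0 + 1) / 2) (m0 + ε * (0 : ℕ)) (stT 0) := by simp [stT]
    obtain rfl | rfl : s = 0 ∨ s = 1 := by omega
    · rw [← e0]
      exact ⟨SimpleGraph.Walk.nil, rfl⟩
    · have := hstep 0 0 (by omega)
      rw [← e0] at this
      exact ⟨this.toWalk, by simp⟩
  | succ t ih =>
    have key : ∀ s : ℕ, s ≤ t + b → ∃ w : (AT (2 * q) p).Walk (vtx (2 * q) p 0 m0 1)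
      (vtx (2 * q) p ((t + 1 + 1) / 2) (m0 + ε * s) (stT (t + 1))), w.length = t + 1 + s := by
      intro s hs
      obtain ⟨w, hw⟩ := ih (by omega) s hs
      refine ⟨w.concat (adj_next q p hq t ht _), ?_⟩
      rw [SimpleGraph.Walk.length_concat]
      omega
    by_cases h : s ≤ t + b
    · exact key s h
    · obtain ⟨s, rfl⟩ : ∃ s', s = s' + 1 := ⟨s - 1, by omega⟩
      obtain ⟨w, hw⟩ := key s (by omega)
      refine ⟨w.concat (hstep (t + 1) s (by omega)), ?_⟩
      rw [SimpleGraph.Walk.length_concat]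
      omega

lemma reach_right (q p : ℕ) (hq : 0 < q) (hp : 1 ≤ p) (m0 : ℤ) (s : ℕ)
    (hs : s ≤ 2 * p) (hs' : s = 2 * p → m0 % 2 = 0) :
    ∃ w : (AT (2 * q) p).Walk (vtx (2 * q) p 0 m0 1) (vtx (2 * q) p p (m0 + s) 0),
      w.length = 2 * p - 1 + s := by
  have h := reach q p hq m0 1 (if m0 % 2 = 0 then 1 else 0) (by
    intro t s hts
    have := adj_right q p hq ((t + 1) / 2) (m0 + 1 * s) (stT t) (by
      unfold stT
      split at hts <;> omega)
    convert this using 2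
    push_cast; ring) (by split <;> omega) (2 * p - 1) (by omega) s (by split <;> omega)
  have e1 : (2 * p - 1 + 1) / 2 = p := by omega
  have e2 : stT (2 * p - 1) = 0 := by unfold stT; omega
  rw [e1, e2, one_mul] at h
  exact h

lemma reach_left (q p : ℕ) (hq : 0 < q) (hp : 1 ≤ p) (m0 : ℤ) (s : ℕ)
    (hs : s ≤ 2 * p) (hs' : s = 2 * p → m0 % 2 = 1) :
    ∃ w : (AT (2 * q) p).Walk (vtx (2 * q) p 0 m0 1) (vtx (2 * q) p p (m0 - s) 0),
      w.length = 2 * p - 1 + s := by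
  have h := reach q p hq m0 (-1) (if m0 % 2 = 1 then 1 else 0) (by
    intro t s hts
    have := adj_right q p hq ((t + 1) / 2) (m0 - s - 1) (stT t) (by
      unfold stT
      split at hts <;> omega)
    convert this.symm using 2 <;> push_cast <;> ring)
    (by split <;> omega) (2 * p - 1) (by omega) s (by split <;> omega)
  have e1 : (2 * p - 1 + 1) / 2 = p := by omega
  have e2 : stT (2 * p - 1) = 0 := by unfold stT; omega
  have e3 : m0 + -1 * (s : ℤ) = m0 - s := by ring
  rw [e1, e2, e3] at h
  exact h

lemma vtx_period (q p i : ℕ) (m t c : ℤ) :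
    vtx (2 * q) p i (m + 2 * q * c) t = vtx (2 * q) p i m t := by
  unfold vtx
  have : colJ (m + 2 * q * c) t = colJ m t + ((2 * (2 * q) : ℕ) : ℤ) * c := by
    have e : ((2 * (2 * q) : ℕ) : ℤ) * c = 4 * (q * c) := by push_cast; ring
    have e' : m + 2 * q * c = m + 2 * (q * c) := by ring
    rw [e, e']
    unfold colJ
    split <;> split <;> omega
  rw [this, Int.cast_add, Int.cast_mul, Int.cast_natCast, ZMod.natCast_self]
  simp

lemma dist_vtx (q p : ℕ) (hq : 0 < q) (hp : 1 ≤ p) (hle : q ≤ 2 * p) (m0 : ℤ) (k : ℕ)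
    (hk : k < 2 * q) :
    (AT (2 * q) p).dist (vtx (2 * q) p 0 m0 1) (vtx (2 * q) p p (m0 + k) 0) =
      2 * p - 1 + min k (2 * q - k) := by
  have per : vtx (2 * q) p p (m0 - ((2 * q - k : ℕ) : ℤ)) 0 = vtx (2 * q) p p (m0 + k) 0 := by
    rw [← vtx_period q p p _ 0 1]
    congr 1
    push_cast [hk.le]
    ring
  have up : ∃ w : (AT (2 * q) p).Walk (vtx (2 * q) p 0 m0 1) (vtx (2 * q) p p (m0 + k) 0),
      w.length = 2 * p - 1 + min k (2 * q - k) := by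
    by_cases h : k < q ∨ (k = q ∧ m0 % 2 = 0)
    · have e : min k (2 * q - k) = k := by omega
      rw [e]
      exact reach_right q p hq hp m0 k (by omega) (by omega)
    · have e : min k (2 * q - k) = 2 * q - k := by omega
      rw [e, ← per]
      exact reach_left q p hq hp m0 (2 * q - k) (by omega) (by omega)
  obtain ⟨w, hw⟩ := up
  apply le_antisymm
  · rw [← hw]; exact SimpleGraph.dist_le w
  · obtain ⟨w', hw'⟩ := w.reachable.exists_walk_length_eq_dist
    have := pot_walk q p hq m0 _ _ w'
    rw [hw', pot_vtx q p hq m0 _ 0 (Or.inl rfl) p le_rfl,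
      pot_vtx q p hq m0 _ 1 (Or.inr rfl) 0 (by omega)] at this
    have e1 : cyc (2 * q) (m0 - m0) = 0 := by simp [cyc]
    have e2 : cyc (2 * q) (m0 + k - m0) = min (k : ℤ) (2 * q - k) := by
      have : m0 + k - m0 = (k : ℤ) := by ring
      rw [this, cyc, Int.emod_eq_of_lt (by omega) (by omega)]
      push_cast
      rfl
    rw [e1, e2] at this
    omega

lemma bij (q p : ℕ) (hq : 0 < q) (m0 : ℤ) :
    Set.BijOn (fun k : ℕ => vtx (2 * q) p p (m0 + k) 0) (↑(Finset.range (2 * q)))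
      (Vset (2 * q) p 0 p) := by
  have : NeZero (2 * (2 * q)) := ⟨by omega⟩
  refine ⟨?_, ?_, ?_⟩
  · intro k _
    refine ⟨by simp [vtx], ?_⟩
    obtain ⟨w, hw⟩ := val_cast q hq (colJ (m0 + k) 0)
    have h2 : colJ (m0 + k) 0 % 4 / 2 = 0 := by unfold colJ; split <;> omega
    simp only [vtx]
    omega
  · intro k hk l hl h
    simp only [Finset.coe_range, Set.mem_Iio] at hk hl
    have h' := congrArg (pot (2 * q) p (m0 + k)) h
    simp only at h'
    rw [pot_vtx q p hq _ _ 0 (Or.inl rfl) p le_rfl,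
      pot_vtx q p hq _ _ 0 (Or.inl rfl) p le_rfl] at h'
    have e1 : cyc (2 * q) (m0 + k - (m0 + k)) = 0 := by simp [cyc]
    have e2 : m0 + l - (m0 + k) = (l : ℤ) - k := by ring
    rw [e1, e2] at h'
    have h3 : cyc (2 * q) ((l : ℤ) - k) = 0 := by omega
    unfold cyc at h3
    have h4 := Int.emod_lt_of_pos ((l : ℤ) - k) (b := ((2 * q : ℕ) : ℤ)) (by omega)
    have h5 : ((l : ℤ) - k) % ((2 * q : ℕ) : ℤ) = 0 := by omega
    have h6 := Int.eq_zero_of_abs_lt_dvd (Int.dvd_of_emod_eq_zero h5) (by rw [abs_lt]; omega)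
    omega
  · rintro ⟨i, x⟩ ⟨hi, hx⟩
    simp only at hi hx
    have hpos : (0 : ℤ) < ((2 * q : ℕ) : ℤ) := by omega
    set m : ℤ := ((x.val : ℤ) - 1) / 2 with hm
    have h0 := Int.emod_nonneg (m - m0) hpos.ne'
    have h1 := Int.emod_lt_of_pos (m - m0) hpos
    refine ⟨((m - m0) % ((2 * q : ℕ) : ℤ)).toNat, ?_, ?_⟩
    · simp only [Finset.coe_range, Set.mem_Iio]; omega
    · simp only
      rw [Int.toNat_of_nonneg h0, ← vtx_period q p p _ 0 ((m - m0) / ((2 * q : ℕ) : ℤ))]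
      have e : m0 + (m - m0) % ((2 * q : ℕ) : ℤ) + 2 * q * ((m - m0) / ((2 * q : ℕ) : ℤ)) = m := by
        have := Int.emod_add_mul_ediv (m - m0) ((2 * q : ℕ) : ℤ)
        push_cast at this ⊢
        linarith
      rw [e]
      have e3 : colJ m 0 = (x.val : ℤ) := by unfold colJ; split <;> omega
      unfold vtx
      rw [e3]
      ext
      · simp [hi]
      · simp

lemma sum_min (q : ℕ) : ∑ k ∈ Finset.range (2 * q), ((min k (2 * q - k) : ℕ) : ℚ) = (q : ℚ) ^ 2 := by
  have h1 : ∑ k ∈ Finset.range (2 * q), ((min k (2 * q - k) : ℕ) : ℚ) =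
      ∑ k ∈ Finset.range q, (k : ℚ) + ∑ k ∈ Finset.range q, ((q : ℚ) - k) := by
    rw [two_mul, Finset.sum_range_add]
    congr 1
    · apply Finset.sum_congr rfl
      intro k hk
      rw [Finset.mem_range] at hk
      congr 1
      omega
    · apply Finset.sum_congr rfl
      intro k hk
      rw [Finset.mem_range] at hk
      rw [← Nat.cast_sub hk.le]
      congr 1
      omega
  rw [h1, ← Finset.sum_add_distrib]
  simp
  ring

theorem stmt10 (n p : ℕ) (hn : 2 ≤ n) (hne : Even n) (hp : 1 ≤ p) (hle : n ≤ 4 * p)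
    (v : Fin (p + 1) × ZMod (2 * n)) (hv : v ∈ Vset n p 1 0) :
    ∑ᶠ y ∈ Vset n p 0 p, ((AT n p).dist v y : ℚ) =
      (n : ℚ) ^ 2 / 4 + 2 * (n : ℚ) * (p : ℚ) - (n : ℚ) := by
  obtain ⟨q, rfl⟩ := even_iff_exists_two_mul.mp hne
  have hq : 0 < q := by omega
  have : NeZero (2 * (2 * q)) := ⟨by omega⟩
  obtain ⟨i, x⟩ := v
  obtain ⟨hi, hx⟩ := hv
  simp only at hi hx
  obtain ⟨m0, hm⟩ : ∃ m : ℤ, m = ((x.val : ℤ) - 1) / 2 := ⟨_, rfl⟩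
  have hvv : (i, x) = vtx (2 * q) p 0 m0 1 := by
    have e3 : colJ m0 1 = (x.val : ℤ) := by unfold colJ; split <;> omega
    unfold vtx
    rw [e3]
    ext
    · simp [hi]
    · simp
  rw [hvv, ← finsum_mem_eq_of_bijOn (f := fun k : ℕ =>
      ((2 * p - 1 + min k (2 * q - k) : ℕ) : ℚ)) _ (bij q p hq m0), finsum_mem_coe_finset]
  · have : ∀ k : ℕ, ((2 * p - 1 + min k (2 * q - k) : ℕ) : ℚ) =
        (2 * (p : ℚ) - 1) + ((min k (2 * q - k) : ℕ) : ℚ) := by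
      intro k
      rw [Nat.cast_add, Nat.cast_sub (by omega)]
      push_cast
      ring
    simp only [this]
    rw [Finset.sum_add_distrib, sum_min]
    simp
    ring
  · intro k hk
    simp only [Finset.coe_range, Set.mem_Iio] at hk
    rw [dist_vtx q p hq hp (by omega) m0 k hk]
end

section
/- Let n be an integer divisible by 4 and p ≥ 1 an integer with n > 4p. For every vertex v ∈ V^1_0 of AT(n,p), d(v, V^0_p) = n²/2 + 4p² − 4p. -/
open SimpleGraph

/-- Number of type-1-to-type-0 crossings on the straight lateral path from `a` to `J`. -/
def crossK (a J : ℤ) : ℤ := if a ≤ J then J / 4 - a / 4 else a / 4 - (J - 2) / 4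

/-- The distance function on the universal cover. -/
def coverDist (a i J : ℤ) : ℤ := max |J - a| (2 * i + |J - a| - 2 * crossK a J)

/-- One step on the universal cover. -/
def CoverStep (i J i' J' : ℤ) : Prop :=
  (i = i' ∧ (J' = J + 1 ∨ J' = J - 1)) ∨
  (i' = i + 1 ∧ ((J % 4 = 2 ∧ J' = J - 1) ∨ (J % 4 = 3 ∧ J' = J + 1))) ∨
  (i = i' + 1 ∧ ((J' % 4 = 2 ∧ J = J' - 1) ∨ (J' % 4 = 3 ∧ J = J' + 1)))

theorem coverDist_step (a i J i' J' : ℤ) (ha : a % 4 = 2 ∨ a % 4 = 3)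
    (h : CoverStep i J i' J') : coverDist a i J ≤ coverDist a i' J' + 1 := by
  unfold CoverStep at h
  unfold coverDist crossK
  simp only [abs_eq_max_neg]
  split_ifs <;> omega

theorem coverDist_descent (a i J : ℤ) (ha : a % 4 = 2 ∨ a % 4 = 3) (hi : 0 ≤ i)
    (h : 0 < coverDist a i J) : ∃ i' J', 0 ≤ i' ∧ i' ≤ i ∧ CoverStep i J i' J' ∧
      coverDist a i' J' = coverDist a i J - 1 := by
  by_cases h1 : J = a
  · subst h1
    have hi0 : 0 < i := by
      unfold coverDist crossK at h
      simp at h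
      exact h
    rcases ha with ha | ha
    · refine ⟨i, J - 1, hi, le_refl _, Or.inl ⟨rfl, Or.inr rfl⟩, ?_⟩
      unfold coverDist crossK
      simp only [abs_eq_max_neg]
      split_ifs <;> omega
    · refine ⟨i, J + 1, hi, le_refl _, Or.inl ⟨rfl, Or.inl rfl⟩, ?_⟩
      unfold coverDist crossK
      simp only [abs_eq_max_neg]
      split_ifs <;> omega
  rcases lt_or_gt_of_ne h1 with h2 | h2
  · by_cases h3 : 0 < i ∧ J % 4 = 1
    · refine ⟨i - 1, J + 1, by omega, by omega, Or.inr (Or.inr ⟨by omega, by omega⟩), ?_⟩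
      unfold coverDist crossK
      simp only [abs_eq_max_neg]
      split_ifs <;> omega
    · refine ⟨i, J + 1, hi, le_refl _, Or.inl ⟨rfl, Or.inl rfl⟩, ?_⟩
      unfold coverDist crossK
      simp only [abs_eq_max_neg]
      split_ifs <;> omega
  · by_cases h3 : 0 < i ∧ J % 4 = 0
    · refine ⟨i - 1, J - 1, by omega, by omega, Or.inr (Or.inr ⟨by omega, by omega⟩), ?_⟩
      unfold coverDist crossK
      simp only [abs_eq_max_neg]
      split_ifs <;> omega
    · refine ⟨i, J - 1, hi, le_refl _, Or.inl ⟨rfl, Or.inr rfl⟩, ?_⟩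
      unfold coverDist crossK
      simp only [abs_eq_max_neg]
      split_ifs <;> omega

theorem coverDist_eq_zero (a i J : ℤ) (ha : a % 4 = 2 ∨ a % 4 = 3) (hi : 0 ≤ i)
    (h : coverDist a i J = 0) : i = 0 ∧ J = a := by
  have h0 : |J - a| ≤ 0 := h ▸ le_max_left _ _
  have h1 : J = a := by
    have := abs_nonpos_iff.1 h0
    omega
  subst h1
  unfold coverDist crossK at h
  simp at h
  omega

theorem coverDist_nonneg (a i J : ℤ) : 0 ≤ coverDist a i J :=
  le_trans (abs_nonneg _) (le_max_left _ _)

theorem val_mod_four (n : ℕ) (hn4 : 4 ∣ n) (hn : 0 < n) (J : ℤ) :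
    (((J : ZMod (2 * n)).val % 4 : ℕ) : ℤ) = J % 4 := by
  have : NeZero (2 * n) := ⟨by omega⟩
  rw [Int.natCast_mod, ZMod.val_intCast]
  apply Int.emod_emod_of_dvd
  push_cast
  exact Dvd.dvd.mul_left (by exact_mod_cast hn4) 2

theorem exists_lift (n p : ℕ) (hn4 : 4 ∣ n) (hn : 0 < n)
    (u w : Fin (p + 1) × ZMod (2 * n)) (h : (AT n p).Adj u w) (J' : ℤ)
    (hJ : (J' : ZMod (2 * n)) = w.2) :
    ∃ J : ℤ, (J : ZMod (2 * n)) = u.2 ∧ CoverStep (u.1 : ℕ) J (w.1 : ℕ) J' := by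
  have hm := val_mod_four n hn4 hn
  unfold AT at h
  rw [SimpleGraph.fromRel_adj] at h
  obtain ⟨-, h | h⟩ := h
  · rcases h with ⟨h1, h2⟩ | ⟨h1, ⟨h2, h3⟩ | ⟨h2, h3⟩⟩
    · exact ⟨J' - 1, by push_cast; rw [hJ, h2]; ring, Or.inl ⟨by rw [h1], by omega⟩⟩
    · have e : ((J' + 1 : ℤ) : ZMod (2 * n)) = u.2 := by push_cast; rw [hJ, h3]; ring
      have := hm (J' + 1)
      rw [e] at this
      exact ⟨J' + 1, e, Or.inr (Or.inl ⟨by omega, by omega⟩)⟩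
    · have e : ((J' - 1 : ℤ) : ZMod (2 * n)) = u.2 := by push_cast; rw [hJ, h3]; ring
      have := hm (J' - 1)
      rw [e] at this
      exact ⟨J' - 1, e, Or.inr (Or.inl ⟨by omega, by omega⟩)⟩
  · have hw := hm J'
    rw [hJ] at hw
    rcases h with ⟨h1, h2⟩ | ⟨h1, ⟨h2, h3⟩ | ⟨h2, h3⟩⟩
    · exact ⟨J' + 1, by push_cast; rw [hJ, h2], Or.inl ⟨by rw [h1], by omega⟩⟩
    · exact ⟨J' - 1, by push_cast; rw [hJ, h3], Or.inr (Or.inr ⟨by omega, by omega⟩)⟩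
    · exact ⟨J' + 1, by push_cast; rw [hJ, h3], Or.inr (Or.inr ⟨by omega, by omega⟩)⟩

theorem adj_of_step (n p : ℕ) (hn4 : 4 ∣ n) (hn : 0 < n)
    (i i' : Fin (p + 1)) (J J' : ℤ) (h : CoverStep (i : ℕ) J (i' : ℕ) J') :
    (AT n p).Adj (i, (J : ZMod (2 * n))) (i', (J' : ZMod (2 * n))) := by
  have hm := val_mod_four n hn4 hn
  have h1 := hm J
  have h2 := hm J'
  unfold AT
  rw [SimpleGraph.fromRel_adj]
  constructor
  · intro e
    have e2 : (J : ZMod (2 * n)) = (J' : ZMod (2 * n)) := congrArg Prod.snd e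
    rw [e2] at h1
    unfold CoverStep at h
    omega
  · unfold CoverStep at h
    rcases h with ⟨h3, rfl | rfl⟩ | ⟨h3, ⟨h4, rfl⟩ | ⟨h4, rfl⟩⟩ | ⟨h3, ⟨h4, rfl⟩ | ⟨h4, rfl⟩⟩
    · exact Or.inl (Or.inl ⟨Fin.ext (by exact_mod_cast h3), by push_cast; ring⟩)
    · exact Or.inr (Or.inl ⟨Fin.ext (by exact_mod_cast h3.symm), by push_cast; ring⟩)
    · exact Or.inl (Or.inr ⟨by dsimp only; omega, Or.inl ⟨by dsimp only; omega, by push_cast; ring⟩⟩)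
    · exact Or.inl (Or.inr ⟨by dsimp only; omega, Or.inr ⟨by dsimp only; omega, by push_cast; ring⟩⟩)
    · exact Or.inr (Or.inr ⟨by dsimp only; omega, Or.inl ⟨by dsimp only; omega, by push_cast; ring⟩⟩)
    · exact Or.inr (Or.inr ⟨by dsimp only; omega, Or.inr ⟨by dsimp only; omega, by push_cast; ring⟩⟩)

theorem walk_lower (n p : ℕ) (hn4 : 4 ∣ n) (hn : 0 < n) (a : ℤ) (ha : a % 4 = 2 ∨ a % 4 = 3)
    (u v : Fin (p + 1) × ZMod (2 * n)) (w : (AT n p).Walk u v)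
    (hv1 : (v.1 : ℕ) = 0) (hv2 : (a : ZMod (2 * n)) = v.2) :
    ∃ J : ℤ, (J : ZMod (2 * n)) = u.2 ∧ coverDist a (u.1 : ℕ) J ≤ w.length := by
  induction w with
  | nil => exact ⟨a, hv2, by simp [coverDist, crossK, hv1]⟩
  | cons h w ih =>
    obtain ⟨J', hJ', hl⟩ := ih hv1 hv2
    obtain ⟨J, hJ, hs⟩ := exists_lift n p hn4 hn _ _ h J' hJ'
    refine ⟨J, hJ, ?_⟩
    have := coverDist_step a _ _ _ _ ha hs
    rw [SimpleGraph.Walk.length_cons]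
    push_cast
    omega

theorem walk_upper (n p : ℕ) (hn4 : 4 ∣ n) (hn : 0 < n) (a : ℤ) (ha : a % 4 = 2 ∨ a % 4 = 3)
    (v : Fin (p + 1) × ZMod (2 * n))
    (hv1 : (v.1 : ℕ) = 0) (hv2 : (a : ZMod (2 * n)) = v.2) (N : ℕ) :
    ∀ (i : Fin (p + 1)) (J : ℤ), coverDist a (i : ℕ) J = N →
      ∃ w : (AT n p).Walk (i, (J : ZMod (2 * n))) v, w.length = N := by
  induction N with
  | zero =>
    intro i J h
    obtain ⟨h1, rfl⟩ := coverDist_eq_zero a ((i : ℕ) : ℤ) J ha (by omega) (by exact_mod_cast h)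
    have e : (i, (J : ZMod (2 * n))) = v :=
      Prod.ext (Fin.ext (by rw [hv1]; exact_mod_cast h1)) hv2
    rw [e]
    exact ⟨SimpleGraph.Walk.nil, rfl⟩
  | succ N ih =>
    intro i J h
    obtain ⟨i', J', h1, h2, h3, h4⟩ := coverDist_descent a (i : ℕ) J ha (by omega) (by omega)
    lift i' to ℕ using h1
    have hlt : i' < p + 1 := by have := i.2; omega
    obtain ⟨w, hw⟩ := ih ⟨i', hlt⟩ J' (by rw [h4, h]; push_cast; ring)
    exact ⟨SimpleGraph.Walk.cons (adj_of_step n p hn4 hn i ⟨i', hlt⟩ J J' h3) w, by simp [hw]⟩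

theorem dist_eq (n p : ℕ) (hn4 : 4 ∣ n) (hgt : 4 * p < n) (a : ℤ)
    (ha : a % 4 = 2 ∨ a % 4 = 3) (v : Fin (p + 1) × ZMod (2 * n))
    (hv1 : (v.1 : ℕ) = 0) (hv2 : (a : ZMod (2 * n)) = v.2)
    (J : ℤ) (hJ : J % 4 = 0 ∨ J % 4 = 1) (hJn : |J - a| ≤ n) :
    ((AT n p).dist v (Fin.last p, (J : ZMod (2 * n))) : ℤ) = coverDist a p J := by
  have hn : 0 < n := by omega
  obtain ⟨N, hN⟩ := Int.eq_ofNat_of_zero_le (coverDist_nonneg a p J)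
  obtain ⟨w, hw⟩ := walk_upper n p hn4 hn a ha v hv1 hv2 N (Fin.last p) J (by simpa using hN)
  rw [SimpleGraph.dist_comm]
  apply le_antisymm
  · rw [hN, ← hw]
    exact_mod_cast SimpleGraph.dist_le w
  · obtain ⟨w', hw'⟩ := (SimpleGraph.Walk.reachable w).exists_walk_length_eq_dist
    obtain ⟨J', hJ', hl⟩ := walk_lower n p hn4 hn a ha _ v w' hv1 hv2
    rw [hw'] at hl
    refine le_trans ?_ hl
    simp only [Fin.val_last] at hJ' ⊢
    rw [ZMod.intCast_eq_intCast_iff_dvd_sub] at hJ'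
    obtain ⟨t, ht⟩ := hJ'
    push_cast at ht
    by_cases h0 : t = 0
    · have : J' = J := by rw [h0] at ht; linarith
      rw [this]
    · have hD : (n : ℤ) ≤ |J' - a| := by
        have h3 : 2 * (n : ℤ) ≤ |J - J'| := by
          rw [ht, abs_mul, abs_of_nonneg (by positivity : (0 : ℤ) ≤ 2 * n)]
          have := Int.one_le_abs h0
          nlinarith
        simp only [abs_eq_max_neg] at *
        omega
      refine le_trans ?_ (le_max_left _ _)
      refine le_trans ?_ hD
      clear hN hl hD ht hw hw' w w'
      unfold coverDist crossK
      simp only [abs_eq_max_neg] at *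
      split_ifs <;> omega

/-- Lifts of the target vertices. -/
def tgt (q : ℤ) (x : ℕ × Fin 4) : ℤ :=
  if x.2 = 0 then 4 * (q + x.1 + 1) else if x.2 = 1 then 4 * (q + x.1 + 1) + 1
  else if x.2 = 2 then 4 * (q - x.1) else 4 * (q - x.1) + 1

theorem sum_aux (p s : ℕ) (h : p ≤ s) :
    ∑ m ∈ Finset.range s, (16 * (m : ℤ) + 8 + 8 * max 0 ((p : ℤ) - m - 1)) =
      8 * (s : ℤ) ^ 2 + 4 * (p : ℤ) ^ 2 - 4 * p := by
  induction s, h using Nat.le_induction with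
  | base =>
    have key : ∀ k ≤ p, ∑ m ∈ Finset.range k, (16 * (m : ℤ) + 8 + 8 * max 0 ((p : ℤ) - m - 1))
        = 8 * (k : ℤ) ^ 2 + 8 * p * k - 4 * k * (k + 1) := by
      intro k
      induction k with
      | zero => simp
      | succ k ih =>
        intro hk
        rw [Finset.sum_range_succ, ih (by omega), max_eq_right (by omega)]
        push_cast
        ring
    rw [key p le_rfl]
    ring
  | succ s hs ih =>
    rw [Finset.sum_range_succ, ih, max_eq_left (by omega)]
    push_cast
    ring

theorem stmt11 (n p : ℕ) (hn4 : 4 ∣ n) (hp : 1 ≤ p) (hgt : 4 * p < n)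
    (v : Fin (p + 1) × ZMod (2 * n)) (hv : v ∈ Vset n p 1 0) :
    ∑ᶠ y ∈ Vset n p 0 p, ((AT n p).dist v y : ℚ) =
      (n : ℚ) ^ 2 / 2 + 4 * (p : ℚ) ^ 2 - 4 * (p : ℚ) := by
  obtain ⟨s, rfl⟩ := hn4
  obtain ⟨hv1, hv2⟩ := hv
  have hs : p < s := by omega
  have : NeZero (2 * (4 * s)) := ⟨by omega⟩
  set a : ℤ := (v.2.val : ℤ) with ha_def
  have ha : a % 4 = 2 ∨ a % 4 = 3 := by omega
  have hav : (a : ZMod (2 * (4 * s))) = v.2 := by simp [ha_def]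
  have halt : a < 8 * s := by have := ZMod.val_lt v.2; omega
  have ha0 : 0 ≤ a := by omega
  clear_value a
  have hmod := val_mod_four (4 * s) ⟨s, rfl⟩ (by omega)
  let f : ℕ × Fin 4 → Fin (p + 1) × ZMod (2 * (4 * s)) :=
    fun x => (Fin.last p, ((tgt (a / 4) x : ℤ) : ZMod (2 * (4 * s))))
  let S : Finset (ℕ × Fin 4) := Finset.range s ×ˢ Finset.univ
  have hinj : Set.InjOn f (S : Set (ℕ × Fin 4)) := by
    rintro ⟨m, c⟩ h ⟨m', c'⟩ h' he
    have he2 := congrArg Prod.snd he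
    simp only [f] at he2
    rw [ZMod.intCast_eq_intCast_iff_dvd_sub] at he2
    simp [S] at h h'
    push_cast at he2
    have hz := Int.eq_zero_of_abs_lt_dvd he2 (by
      clear he he2
      fin_cases c <;> fin_cases c' <;> simp [tgt] <;> rw [abs_lt] <;> constructor <;> omega)
    clear he he2
    fin_cases c <;> fin_cases c' <;> simp [tgt] at hz ⊢ <;> omega
  have himg : Vset (4 * s) p 0 p = f '' (S : Set (ℕ × Fin 4)) := by
    ext ⟨i, b⟩
    constructor
    · rintro ⟨h1, h2⟩
      have hb := ZMod.val_lt b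
      dsimp only at h1 h2
      have hbv : (((b.val : ℕ) : ℤ) : ZMod (2 * (4 * s))) = b := by simp
      suffices hh : ∃ x ∈ S, ∃ t : ℤ, tgt (a / 4) x = b.val + 8 * s * t by
        obtain ⟨x, hx, t, ht⟩ := hh
        refine ⟨x, hx, Prod.ext (Fin.ext (by simp [f, h1])) ?_⟩
        have hz : ((8 * s : ℤ) : ZMod (2 * (4 * s))) = 0 := by
          have := ZMod.natCast_self (2 * (4 * s))
          push_cast at this ⊢
          rw [← this]; ring
        simp only [f]
        rw [ht, Int.cast_add, Int.cast_mul, hz, hbv]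
        ring
      generalize b.val = x at *
      have main : ∃ t e : ℤ, 1 - s ≤ e ∧ e ≤ s ∧ (x : ℤ) / 4 + 2 * (s * t) = a / 4 + e := by
        rcases lt_or_ge ((x : ℤ) / 4 - a / 4) (1 - s) with h | h
        · exact ⟨1, x / 4 - a / 4 + 2 * s, by omega, by omega, by ring⟩
        · rcases lt_or_ge (s : ℤ) ((x : ℤ) / 4 - a / 4) with h' | h'
          · exact ⟨-1, x / 4 - a / 4 - 2 * s, by omega, by omega, by ring⟩
          · exact ⟨0, x / 4 - a / 4, by omega, by omega, by ring⟩
      obtain ⟨t, e, he1, he2, he3⟩ := main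
      have hst : (8 * s * t : ℤ) = 8 * (s * t) := by ring
      rcases lt_or_ge 0 e with h | h
      · rcases (by omega : x % 4 = 0 ∨ x % 4 = 1) with hx | hx
        · refine ⟨((e - 1).toNat, 0), by simp [S]; omega, t, ?_⟩
          rw [hst]; simp [tgt]; omega
        · refine ⟨((e - 1).toNat, 1), by simp [S]; omega, t, ?_⟩
          rw [hst]; simp [tgt]; omega
      · rcases (by omega : x % 4 = 0 ∨ x % 4 = 1) with hx | hx
        · refine ⟨((-e).toNat, 2), by simp [S]; omega, t, ?_⟩
          rw [hst]; simp [tgt]; omega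
        · refine ⟨((-e).toNat, 3), by simp [S]; omega, t, ?_⟩
          rw [hst]; simp [tgt]; omega
    · rintro ⟨⟨m, c⟩, hx, he⟩
      rw [← he]
      refine ⟨by simp [f], ?_⟩
      have := hmod (tgt (a / 4) (m, c))
      simp only [f]
      have h4 : tgt (a / 4) (m, c) % 4 = 0 ∨ tgt (a / 4) (m, c) % 4 = 1 := by
        clear this he hx
        fin_cases c <;> simp [tgt] <;> omega
      omega
  rw [himg, finsum_mem_image hinj, finsum_mem_coe_finset]
  have hd : ∀ x ∈ S, (((AT (4 * s) p).dist v (f x) : ℕ) : ℚ) =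
      ((coverDist a p (tgt (a / 4) x) : ℤ) : ℚ) := by
    rintro ⟨m, c⟩ hx
    simp [S] at hx
    rw [← dist_eq (4 * s) p ⟨s, rfl⟩ hgt a ha v hv1 hav (tgt (a / 4) (m, c))
      (by fin_cases c <;> simp [tgt] <;> omega)
      (by
        push_cast
        rw [abs_le]
        fin_cases c <;> simp [tgt] <;> omega)]
    simp [f]
  rw [Finset.sum_congr rfl hd, ← Int.cast_sum, Finset.sum_product]
  have hrow : ∀ m ∈ Finset.range s, ∑ c : Fin 4, coverDist a p (tgt (a / 4) (m, c)) =
      16 * (m : ℤ) + 8 + 8 * max 0 ((p : ℤ) - m - 1) := by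
    intro m _
    have e0 : coverDist a p (tgt (a / 4) (m, 0)) =
        4 * (m + 1) - a % 4 + 2 * max 0 ((p : ℤ) - m - 1) := by
      simp [tgt]
      unfold coverDist crossK
      simp only [abs_eq_max_neg]
      split_ifs <;> omega
    have e1 : coverDist a p (tgt (a / 4) (m, 1)) =
        4 * (m + 1) + 1 - a % 4 + 2 * max 0 ((p : ℤ) - m - 1) := by
      simp [tgt]
      unfold coverDist crossK
      simp only [abs_eq_max_neg]
      split_ifs <;> omega
    have e2 : coverDist a p (tgt (a / 4) (m, 2)) =
        4 * m + a % 4 + 2 * max 0 ((p : ℤ) - m - 1) := by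
      simp [tgt]
      unfold coverDist crossK
      simp only [abs_eq_max_neg]
      split_ifs <;> omega
    have e3 : coverDist a p (tgt (a / 4) (m, 3)) =
        4 * m + a % 4 - 1 + 2 * max 0 ((p : ℤ) - m - 1) := by
      simp [tgt]
      unfold coverDist crossK
      simp only [abs_eq_max_neg]
      split_ifs <;> omega
    rw [Fin.sum_univ_four, e0, e1, e2, e3]
    ring
  rw [Finset.sum_congr rfl hrow, sum_aux p s hs.le]
  push_cast
  ring
end

section
/- Let n be an integer with n ≡ 2 (mod 4) and p ≥ 1 an integer with n > 4p. For every vertex v ∈ V^1_0 of AT(n,p), d(v, V^0_p) = n²/2 + 4p² − 4p + 1. -/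
open SimpleGraph

namespace ATProof

/-- Vertex in layer `i` at signed offset `t` from position `s` in direction `σ`. -/
def pos (n p : ℕ) (s σ : ℤ) (i : ℕ) (t : ℤ) : Fin (p + 1) × ZMod (2 * n) :=
  (Fin.ofNat (p + 1) i, ((s + σ * t : ℤ) : ZMod (2 * n)))

/-- Signed offset of a vertex. -/
def off (n p : ℕ) (s σ : ℤ) (x : Fin (p + 1) × ZMod (2 * n)) : ℤ :=
  ZMod.valMinAbs ((σ : ZMod (2 * n)) * (x.2 - (s : ZMod (2 * n))))

/-- The horizontal part of the hexagonal potential. -/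
def phi (t : ℤ) : ℤ :=
  if 1 ≤ t then 2 * (t / 4) + t % 2 else 2 * ((1 - t) / 4) + (1 - t) % 2 - 1

/-- Enumeration of the offsets of the target vertices. -/
def tau (c : ℕ) : ℤ :=
  if c % 4 = 0 then -((c : ℤ) + 1) else if c % 4 = 1 then (c : ℤ) + 1
  else if c % 4 = 2 then -(c : ℤ) else (c : ℤ)

/-- Admissible base point and direction. -/
def Good (s σ : ℤ) : Prop := (s % 4 = 2 ∧ σ = 1) ∨ (s % 4 = 3 ∧ σ = -1)

lemma val_mod (n : ℕ) (hn4 : n % 4 = 2) (a : ℤ) :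
    ((((a : ZMod (2 * n)).val % 4 : ℕ)) : ℤ) = a % 4 := by
  have : NeZero (2 * n) := ⟨by omega⟩
  push_cast
  rw [ZMod.val_intCast, Int.emod_emod_of_dvd]
  push_cast
  omega

lemma pos_fst (n p : ℕ) (s σ : ℤ) (i : ℕ) (hi : i ≤ p) (t : ℤ) :
    ((pos n p s σ i t).1 : ℕ) = i := by
  simp [pos, Fin.ofNat, Nat.mod_eq_of_lt (Nat.lt_succ_of_le hi)]

lemma pos_off (n p : ℕ) (s σ : ℤ) (hg : Good s σ) (hn4 : n % 4 = 2)
    (x : Fin (p + 1) × ZMod (2 * n)) :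
    x = pos n p s σ x.1 (off n p s σ x) := by
  have : NeZero (2 * n) := ⟨by omega⟩
  ext1
  · simp [pos]
  · simp only [pos, off]
    push_cast
    try rw [ZMod.coe_valMinAbs]
    rcases hg with ⟨_, rfl⟩ | ⟨_, rfl⟩ <;> push_cast <;> ring

lemma off_mem (n p : ℕ) (s σ : ℤ) (hn4 : n % 4 = 2)
    (x : Fin (p + 1) × ZMod (2 * n)) :
    -(n : ℤ) < off n p s σ x ∧ off n p s σ x ≤ n := by
  have : NeZero (2 * n) := ⟨by omega⟩
  have h := ZMod.valMinAbs_mem_Ioc ((σ : ZMod (2 * n)) * (x.2 - (s : ZMod (2 * n))))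
  rw [Set.mem_Ioc] at h
  push_cast at h
  unfold off
  omega

lemma off_pos (n p : ℕ) (s σ : ℤ) (hg : Good s σ) (hn4 : n % 4 = 2) (i : ℕ) (t : ℤ)
    (h1 : -(n : ℤ) < t) (h2 : t ≤ n) : off n p s σ (pos n p s σ i t) = t := by
  have : NeZero (2 * n) := ⟨by omega⟩
  unfold off
  rw [ZMod.valMinAbs_spec]
  refine ⟨?_, ?_⟩
  · simp only [pos]
    rcases hg with ⟨_, rfl⟩ | ⟨_, rfl⟩ <;> push_cast <;> ring
  · rw [Set.mem_Ioc]; push_cast; omega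

lemma wrap (n : ℕ) (hn4 : n % 4 = 2) (a b e : ℤ) (he : e = 1 ∨ e = -1)
    (ha : -(n : ℤ) < a ∧ a ≤ n) (hb : -(n : ℤ) < b ∧ b ≤ n)
    (h : (b : ZMod (2 * n)) = (a : ZMod (2 * n)) + e) :
    b = a + e ∨ b = a + e + 2 * n ∨ b = a + e - 2 * n := by
  have h' : ((b : ℤ) : ZMod (2 * n)) = ((a + e : ℤ) : ZMod (2 * n)) := by
    rw [h]; push_cast; rfl
  rw [ZMod.intCast_eq_intCast_iff_dvd_sub] at h'
  obtain ⟨k, hk⟩ := h'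
  push_cast at hk
  have hn : (0 : ℤ) < n := by omega
  have k1 : k ≤ 1 := by
    by_contra hc
    have : (2 * (n : ℤ)) * 2 ≤ 2 * n * k := by
      apply mul_le_mul_of_nonneg_left <;> omega
    omega
  have k2 : -1 ≤ k := by
    by_contra hc
    have : (2 * (n : ℤ)) * k ≤ 2 * n * (-2) := by
      apply mul_le_mul_of_nonneg_left <;> omega
    omega
  have : k = -1 ∨ k = 0 ∨ k = 1 := by omega
  rcases this with rfl | rfl | rfl <;> omega

lemma off_cast (n p : ℕ) (s σ : ℤ) (hn4 : n % 4 = 2)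
    (x : Fin (p + 1) × ZMod (2 * n)) :
    ((off n p s σ x : ℤ) : ZMod (2 * n)) = (σ : ZMod (2 * n)) * (x.2 - (s : ZMod (2 * n))) := by
  have : NeZero (2 * n) := ⟨by omega⟩
  unfold off
  rw [ZMod.coe_valMinAbs]

lemma val_off (n p : ℕ) (s σ : ℤ) (hg : Good s σ) (hn4 : n % 4 = 2)
    (x : Fin (p + 1) × ZMod (2 * n)) :
    ((x.2.val % 4 : ℕ) : ℤ) = (s + σ * off n p s σ x) % 4 := by
  conv_lhs => rw [pos_off n p s σ hg hn4 x]
  simp only [pos]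
  exact val_mod n hn4 _

/-- The relation, in terms of offsets. -/
lemma rel_off (n p : ℕ) (s σ : ℤ) (hg : Good s σ) (hn4 : n % 4 = 2)
    (x y : Fin (p + 1) × ZMod (2 * n)) (h : ATRel n p x y) :
    ∃ e : ℤ, (e = 1 ∨ e = -1) ∧
      (off n p s σ y = off n p s σ x + e ∨ off n p s σ y = off n p s σ x + e + 2 * n ∨
        off n p s σ y = off n p s σ x + e - 2 * n) ∧
      ((x.1 : ℕ) = y.1 ∨ ((x.1 : ℕ) + 1 = y.1 ∧
        ((e = -1 ∧ off n p s σ x % 4 = 0) ∨ (e = 1 ∧ off n p s σ x % 4 = 1)))) := by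
  have hx := off_mem n p s σ hn4 x
  have hy := off_mem n p s σ hn4 y
  have cx := off_cast n p s σ hn4 x
  have cy := off_cast n p s σ hn4 y
  have hv := val_off n p s σ hg hn4 x
  have key : ∀ e : ℤ, (e = 1 ∨ e = -1) → y.2 = x.2 + ((σ * e : ℤ) : ZMod (2 * n)) →
      (off n p s σ y = off n p s σ x + e ∨ off n p s σ y = off n p s σ x + e + 2 * n ∨
        off n p s σ y = off n p s σ x + e - 2 * n) := by
    intro e he hye
    refine wrap n hn4 _ _ e he hx hy ?_
    rw [cx, cy, hye]
    rcases hg with ⟨_, rfl⟩ | ⟨_, rfl⟩ <;> push_cast <;> ring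
  rcases h with ⟨h1, h2⟩ | ⟨h1, ⟨h2, h3⟩ | ⟨h2, h3⟩⟩
  · have h1' : (x.1 : ℕ) = y.1 := by rw [h1]
    rcases hg with ⟨_, rfl⟩ | ⟨_, rfl⟩
    · exact ⟨1, Or.inl rfl, key 1 (Or.inl rfl) (by rw [h2]; push_cast; ring), Or.inl h1'⟩
    · exact ⟨-1, Or.inr rfl, key (-1) (Or.inr rfl) (by rw [h2]; push_cast; ring), Or.inl h1'⟩
  · rcases hg with ⟨_, rfl⟩ | ⟨_, rfl⟩
    · exact ⟨-1, Or.inr rfl, key (-1) (Or.inr rfl) (by rw [h3]; push_cast; ring),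
        Or.inr ⟨h1, by omega⟩⟩
    · exact ⟨1, Or.inl rfl, key 1 (Or.inl rfl) (by rw [h3]; push_cast; ring),
        Or.inr ⟨h1, by omega⟩⟩
  · rcases hg with ⟨_, rfl⟩ | ⟨_, rfl⟩
    · exact ⟨1, Or.inl rfl, key 1 (Or.inl rfl) (by rw [h3]; push_cast; ring),
        Or.inr ⟨h1, by omega⟩⟩
    · exact ⟨-1, Or.inr rfl, key (-1) (Or.inr rfl) (by rw [h3]; push_cast; ring),
        Or.inr ⟨h1, by omega⟩⟩

lemma lip_abs (n p : ℕ) (s σ : ℤ) (hg : Good s σ) (hn4 : n % 4 = 2)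
    (x y : Fin (p + 1) × ZMod (2 * n)) (h : ATRel n p x y) :
    |(|off n p s σ x| - |off n p s σ y|)| ≤ 1 := by
  have hx := off_mem n p s σ hn4 x
  have hy := off_mem n p s σ hn4 y
  obtain ⟨e, he, h1, h2⟩ := rel_off n p s σ hg hn4 x y h
  clear h2
  generalize off n p s σ x = a at *
  generalize off n p s σ y = b at *
  rw [abs_le]
  rcases abs_cases a with h3 | h3 <;> rcases abs_cases b with h4 | h4 <;> omega

lemma lip_phi (n p : ℕ) (s σ : ℤ) (hg : Good s σ) (hn4 : n % 4 = 2)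
    (x y : Fin (p + 1) × ZMod (2 * n)) (h : ATRel n p x y) :
    |((2 * (x.1 : ℕ) + phi (off n p s σ x)) - (2 * (y.1 : ℕ) + phi (off n p s σ y)) : ℤ)| ≤ 1 := by
  have hx := off_mem n p s σ hn4 x
  have hy := off_mem n p s σ hn4 y
  obtain ⟨e, he, h1, h2⟩ := rel_off n p s σ hg hn4 x y h
  generalize off n p s σ x = a at *
  generalize off n p s σ y = b at *
  generalize (x.1 : ℕ) = i at *
  generalize (y.1 : ℕ) = j at *
  rw [abs_le]
  unfold phi
  rcases he with rfl | rfl <;> rcases h1 with h1 | h1 | h1 <;> rcases h2 with h2 | h2 <;>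
    split_ifs <;> omega

lemma lower {V : Type*} (G : SimpleGraph V) (f : V → ℤ)
    (hf : ∀ x y, G.Adj x y → |f x - f y| ≤ 1) {u v : V} (w : G.Walk u v) :
    f v - f u ≤ w.length := by
  induction w with
  | nil => simp
  | cons h w ih =>
    have := abs_le.1 (hf _ _ h)
    rw [Walk.length_cons]
    push_cast
    omega

lemma adj_lip (n p : ℕ) (f : Fin (p + 1) × ZMod (2 * n) → ℤ)
    (hf : ∀ x y, ATRel n p x y → |f x - f y| ≤ 1) :
    ∀ x y, (AT n p).Adj x y → |f x - f y| ≤ 1 := by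
  intro x y h
  rw [AT, SimpleGraph.fromRel_adj] at h
  rcases h.2 with h | h
  · exact hf _ _ h
  · rw [abs_sub_comm]; exact hf _ _ h

/-- There is a walk of length `L` from `v` to `x`. -/
def Rch (n p : ℕ) (v : Fin (p + 1) × ZMod (2 * n)) (L : ℕ)
    (x : Fin (p + 1) × ZMod (2 * n)) : Prop :=
  ∃ w : (AT n p).Walk v x, w.length = L

lemma Rch.step {n p : ℕ} {v x y : Fin (p + 1) × ZMod (2 * n)} {L : ℕ}
    (h : Rch n p v L x) (ha : (AT n p).Adj x y) : Rch n p v (L + 1) y := by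
  obtain ⟨w, hw⟩ := h
  exact ⟨w.concat ha, by rw [Walk.length_concat, hw]⟩

lemma Rch.cast {n p : ℕ} {s σ : ℤ} {v : Fin (p + 1) × ZMod (2 * n)} {L i : ℕ} {t : ℤ}
    (h : Rch n p v L (pos n p s σ i t)) {L' : ℕ} {t' : ℤ} (hL : L = L') (ht : t = t') :
    Rch n p v L' (pos n p s σ i t') := by
  subst hL; subst ht; exact h

lemma one_ne (n : ℕ) (hn4 : n % 4 = 2) : (1 : ZMod (2 * n)) ≠ 0 := by
  have : Fact (1 < 2 * n) := ⟨by omega⟩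
  exact one_ne_zero

lemma adj_of_rel (n p : ℕ) (hn4 : n % 4 = 2) (x y : Fin (p + 1) × ZMod (2 * n))
    (h : ATRel n p x y) : (AT n p).Adj x y := by
  rw [AT, SimpleGraph.fromRel_adj]
  refine ⟨?_, Or.inl h⟩
  rintro rfl
  have := one_ne n hn4
  rcases h with ⟨_, h⟩ | ⟨h, _⟩
  · exact this (by simpa using h)
  · omega

lemma adj_row (n p : ℕ) (s σ : ℤ) (hg : Good s σ) (hn4 : n % 4 = 2) (i : ℕ) (t : ℤ) :
    (AT n p).Adj (pos n p s σ i t) (pos n p s σ i (t + 1)) := by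
  rcases hg with ⟨_, rfl⟩ | ⟨_, rfl⟩
  · apply adj_of_rel n p hn4
    left
    refine ⟨rfl, ?_⟩
    simp only [pos]; push_cast; ring
  · apply SimpleGraph.Adj.symm
    apply adj_of_rel n p hn4
    left
    refine ⟨rfl, ?_⟩
    simp only [pos]; push_cast; ring

lemma adj_row' (n p : ℕ) (s σ : ℤ) (hg : Good s σ) (hn4 : n % 4 = 2) (i : ℕ) (t : ℤ) :
    (AT n p).Adj (pos n p s σ i t) (pos n p s σ i (t - 1)) := by
  have := (adj_row n p s σ hg hn4 i (t - 1)).symm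
  rwa [sub_add_cancel] at this

lemma val_pos (n p : ℕ) (s σ : ℤ) (hn4 : n % 4 = 2) (i : ℕ) (t : ℤ) :
    (((pos n p s σ i t).2.val % 4 : ℕ) : ℤ) = (s + σ * t) % 4 := val_mod n hn4 _

lemma adj_left (n p : ℕ) (s σ : ℤ) (hg : Good s σ) (hn4 : n % 4 = 2) (i : ℕ) (hi : i + 1 ≤ p)
    (t : ℤ) (ht : t % 4 = 0) :
    (AT n p).Adj (pos n p s σ i t) (pos n p s σ (i + 1) (t - 1)) := by
  apply adj_of_rel n p hn4
  right
  rw [pos_fst _ _ _ _ _ (by omega), pos_fst _ _ _ _ _ hi]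
  refine ⟨rfl, ?_⟩
  have hv := val_pos n p s σ hn4 i t
  rcases hg with ⟨_, rfl⟩ | ⟨_, rfl⟩
  · left
    refine ⟨by omega, ?_⟩
    simp only [pos]; push_cast; ring
  · right
    refine ⟨by omega, ?_⟩
    simp only [pos]; push_cast; ring

lemma adj_right (n p : ℕ) (s σ : ℤ) (hg : Good s σ) (hn4 : n % 4 = 2) (i : ℕ) (hi : i + 1 ≤ p)
    (t : ℤ) (ht : t % 4 = 1) :
    (AT n p).Adj (pos n p s σ i t) (pos n p s σ (i + 1) (t + 1)) := by
  apply adj_of_rel n p hn4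
  right
  rw [pos_fst _ _ _ _ _ (by omega), pos_fst _ _ _ _ _ hi]
  refine ⟨rfl, ?_⟩
  have hv := val_pos n p s σ hn4 i t
  rcases hg with ⟨_, rfl⟩ | ⟨_, rfl⟩
  · right
    refine ⟨by omega, ?_⟩
    simp only [pos]; push_cast; ring
  · left
    refine ⟨by omega, ?_⟩
    simp only [pos]; push_cast; ring

lemma reach_left (n p : ℕ) (s σ : ℤ) (hg : Good s σ) (hn4 : n % 4 = 2) (i : ℕ) :
    ∀ k : ℕ, i ≤ p → Rch n p (pos n p s σ 0 0) (4 * k + 2 * (i - k)) (pos n p s σ i (-(4 * k))) := by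
  induction i with
  | zero =>
    intro k _
    induction k with
    | zero => exact ⟨Walk.nil, by simp⟩
    | succ k ih =>
      have h := (((ih.step (adj_row' n p s σ hg hn4 _ _)).step
        (adj_row' n p s σ hg hn4 _ _)).step (adj_row' n p s σ hg hn4 _ _)).step
        (adj_row' n p s σ hg hn4 _ _)
      exact h.cast (by omega) (by push_cast; try ring)
  | succ i ih =>
    intro k hi
    cases k with
    | zero =>
      have h := ((ih 0 (by omega)).step (adj_left n p s σ hg hn4 _ hi _ (by simp))).step
        (adj_row n p s σ hg hn4 _ _)
      exact h.cast (by omega) (by push_cast; try ring)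
    | succ k =>
      have h := ((((ih k (by omega)).step (adj_left n p s σ hg hn4 _ hi _ (by omega))).step
        (adj_row' n p s σ hg hn4 _ _)).step (adj_row' n p s σ hg hn4 _ _)).step
        (adj_row' n p s σ hg hn4 _ _)
      exact h.cast (by omega) (by push_cast; try ring)

lemma reach_right (n p : ℕ) (s σ : ℤ) (hg : Good s σ) (hn4 : n % 4 = 2) (i : ℕ) :
    ∀ k : ℕ, i ≤ p →
      Rch n p (pos n p s σ 0 0) (4 * k + 2 * (i - k) + 1) (pos n p s σ i (4 * k + 1)) := by
  induction i with
  | zero =>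
    intro k _
    induction k with
    | zero =>
      have h0 : Rch n p (pos n p s σ 0 0) 0 (pos n p s σ 0 0) := ⟨Walk.nil, rfl⟩
      have h := h0.step (adj_row n p s σ hg hn4 _ _)
      exact h.cast (by omega) (by simp)
    | succ k ih =>
      have h := (((ih.step (adj_row n p s σ hg hn4 _ _)).step
        (adj_row n p s σ hg hn4 _ _)).step (adj_row n p s σ hg hn4 _ _)).step
        (adj_row n p s σ hg hn4 _ _)
      exact h.cast (by omega) (by push_cast; try ring)
  | succ i ih =>
    intro k hi
    cases k with
    | zero =>
      have h := ((ih 0 (by omega)).step (adj_right n p s σ hg hn4 _ hi _ (by simp))).step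
        (adj_row' n p s σ hg hn4 _ _)
      exact h.cast (by omega) (by push_cast; try ring)
    | succ k =>
      have h := ((((ih k (by omega)).step (adj_right n p s σ hg hn4 _ hi _ (by omega))).step
        (adj_row n p s σ hg hn4 _ _)).step (adj_row n p s σ hg hn4 _ _)).step
        (adj_row n p s σ hg hn4 _ _)
      exact h.cast (by omega) (by push_cast; try ring)

/-- Distance of the `c`-th target. -/
def E (p c : ℕ) : ℕ := (tau c).natAbs + 2 * (p - 1 - c / 4)

lemma reach_tau (n p : ℕ) (s σ : ℤ) (hg : Good s σ) (hn4 : n % 4 = 2) (hp : 1 ≤ p) (c : ℕ) :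
    Rch n p (pos n p s σ 0 0) (E p c) (pos n p s σ p (tau c)) := by
  obtain ⟨q, rfl⟩ : ∃ q, p = q + 1 := ⟨p - 1, by omega⟩
  have hl := (reach_left n (q + 1) s σ hg hn4 q (c / 4) (by omega)).step
    (adj_left n (q + 1) s σ hg hn4 q le_rfl _ (by omega))
  have hr := (reach_right n (q + 1) s σ hg hn4 q (c / 4) (by omega)).step
    (adj_right n (q + 1) s σ hg hn4 q le_rfl _ (by omega))
  have hl' := hl.step (adj_row' n (q + 1) s σ hg hn4 _ _)
  have hr' := hr.step (adj_row n (q + 1) s σ hg hn4 _ _)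
  have hc : c % 4 = 0 ∨ c % 4 = 1 ∨ c % 4 = 2 ∨ c % 4 = 3 := by omega
  unfold E tau
  rcases hc with hc | hc | hc | hc
  · exact hl.cast (by split_ifs <;> omega) (by split_ifs <;> omega)
  · exact hr.cast (by split_ifs <;> omega) (by split_ifs <;> omega)
  · exact hl'.cast (by split_ifs <;> omega) (by split_ifs <;> omega)
  · exact hr'.cast (by split_ifs <;> omega) (by split_ifs <;> omega)

lemma tau_mem (n : ℕ) (hn4 : n % 4 = 2) (c : ℕ) (hc : c < n) :
    -(n : ℤ) < tau c ∧ tau c ≤ n := by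
  unfold tau; split_ifs <;> omega

lemma dist_tau (n p : ℕ) (s σ : ℤ) (hg : Good s σ) (hn4 : n % 4 = 2) (hp : 1 ≤ p)
    (c : ℕ) (hc : c < n) :
    (AT n p).dist (pos n p s σ 0 0) (pos n p s σ p (tau c)) = E p c := by
  obtain ⟨w, hw⟩ := reach_tau n p s σ hg hn4 hp c
  apply le_antisymm
  · rw [← hw]; exact SimpleGraph.dist_le w
  · obtain ⟨w', hw'⟩ := (Walk.reachable w).exists_walk_length_eq_dist
    rw [← hw']
    have h1 := lower (AT n p) _ (adj_lip n p _ (lip_abs n p s σ hg hn4)) w'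
    have h2 := lower (AT n p) _ (adj_lip n p _ (lip_phi n p s σ hg hn4)) w'
    have hm := tau_mem n hn4 c hc
    simp only [off_pos n p s σ hg hn4 p (tau c) hm.1 hm.2,
      off_pos n p s σ hg hn4 0 0 (by omega) (by omega), pos_fst n p s σ p le_rfl,
      pos_fst n p s σ 0 (Nat.zero_le _)] at h1 h2
    generalize w'.length = L at *
    clear hw hw' w w'
    unfold E
    have h0 : phi 0 = 0 := by decide
    rw [h0] at h2
    rw [abs_zero] at h1
    rw [Int.abs_eq_natAbs] at h1
    unfold phi at h2
    unfold tau at *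
    split_ifs at * <;> omega

lemma sum_E1 (m : ℕ) : ∑ c ∈ Finset.range (4 * m + 2), (tau c).natAbs = 8 * m ^ 2 + 8 * m + 3 := by
  induction m with
  | zero => decide
  | succ m ih =>
    rw [show 4 * (m + 1) + 2 = 4 * m + 2 + 1 + 1 + 1 + 1 by ring, Finset.sum_range_succ,
      Finset.sum_range_succ, Finset.sum_range_succ, Finset.sum_range_succ, ih]
    have e1 : (tau (4 * m + 2)).natAbs = 4 * m + 2 := by unfold tau; split_ifs <;> omega
    have e2 : (tau (4 * m + 2 + 1)).natAbs = 4 * m + 3 := by unfold tau; split_ifs <;> omega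
    have e3 : (tau (4 * m + 2 + 1 + 1)).natAbs = 4 * m + 5 := by unfold tau; split_ifs <;> omega
    have e4 : (tau (4 * m + 2 + 1 + 1 + 1)).natAbs = 4 * m + 6 := by
      unfold tau; split_ifs <;> omega
    rw [e1, e2, e3, e4]; ring

lemma sum_quad (g : ℕ → ℕ) (m : ℕ) :
    ∑ c ∈ Finset.range (4 * m), g (c / 4) = 4 * ∑ k ∈ Finset.range m, g k := by
  induction m with
  | zero => simp
  | succ m ih =>
    rw [show 4 * (m + 1) = 4 * m + 1 + 1 + 1 + 1 by ring, Finset.sum_range_succ,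
      Finset.sum_range_succ, Finset.sum_range_succ, Finset.sum_range_succ, ih,
      Finset.sum_range_succ g]
    rw [show (4 * m) / 4 = m by omega, show (4 * m + 1) / 4 = m by omega,
      show (4 * m + 1 + 1) / 4 = m by omega, show (4 * m + 1 + 1 + 1) / 4 = m by omega]
    ring

lemma sum_E2 (q m : ℕ) (h : q + 1 ≤ m) :
    ∑ c ∈ Finset.range (4 * m + 2), 2 * (q - c / 4) = 4 * ((q + 1) * q) := by
  rw [Finset.sum_range_succ, Finset.sum_range_succ, sum_quad (fun k => 2 * (q - k))]
  have h3 : ∑ k ∈ Finset.range m, 2 * (q - k) = (q + 1) * q := by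
    induction m, h using Nat.le_induction with
    | base =>
      rw [← Finset.mul_sum]
      have := Finset.sum_range_reflect (fun k => k) (q + 1)
      simp only [Nat.add_sub_cancel] at this
      rw [this, mul_comm, Finset.sum_range_id_mul_two]
      simp
    | succ m hm ih => rw [Finset.sum_range_succ, ih]; omega
  rw [h3, show q - 4 * m / 4 = 0 by omega, show q - (4 * m + 1) / 4 = 0 by omega]
  simp

lemma bij (n p : ℕ) (s σ : ℤ) (hg : Good s σ) (hn4 : n % 4 = 2) :
    Set.BijOn (fun c => pos n p s σ p (tau c)) (Finset.range n : Set ℕ) (Vset n p 0 p) := by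
  refine ⟨?_, ?_, ?_⟩
  · intro c hc
    refine ⟨pos_fst n p s σ p le_rfl _, ?_⟩
    have hv := val_pos n p s σ hn4 p (tau c)
    have ht : tau c % 4 = 2 ∨ tau c % 4 = 3 := by unfold tau; split_ifs <;> omega
    rcases hg with ⟨_, rfl⟩ | ⟨_, rfl⟩ <;> dsimp only <;> omega
  · intro c hc c' hc' h
    have hc1 : c < n := by simpa using hc
    have hc2 : c' < n := by simpa using hc'
    have h' := congrArg (off n p s σ) h
    have m1 := tau_mem n hn4 c hc1
    have m2 := tau_mem n hn4 c' hc2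
    simp only [off_pos n p s σ hg hn4 p _ m1.1 m1.2, off_pos n p s σ hg hn4 p _ m2.1 m2.2] at h'
    unfold tau at h'
    split_ifs at h' <;> omega
  · rintro x ⟨hx1, hx2⟩
    have hv := val_off n p s σ hg hn4 x
    have hm := off_mem n p s σ hn4 x
    have hp := pos_off n p s σ hg hn4 x
    rw [hx1] at hp
    have ht : off n p s σ x % 4 = 2 ∨ off n p s σ x % 4 = 3 := by
      rcases hg with ⟨_, rfl⟩ | ⟨_, rfl⟩ <;> omega
    have : ∃ c : ℕ, c < n ∧ tau c = off n p s σ x := by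
      generalize off n p s σ x = t at *
      rcases ht with ht | ht <;> rcases le_or_gt 0 t with h0 | h0
      · refine ⟨(t - 1).toNat, by omega, ?_⟩
        unfold tau; split_ifs <;> omega
      · refine ⟨(-t).toNat, by omega, ?_⟩
        unfold tau; split_ifs <;> omega
      · refine ⟨t.toNat, by omega, ?_⟩
        unfold tau; split_ifs <;> omega
      · refine ⟨(-t - 1).toNat, by omega, ?_⟩
        unfold tau; split_ifs <;> omega
    obtain ⟨c, hc, hct⟩ := this
    refine ⟨c, by simpa using hc, ?_⟩
    dsimp only
    rw [hct]; exact hp.symm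

end ATProof

open ATProof in
theorem stmt12 (n p : ℕ) (hn4 : n % 4 = 2) (hp : 1 ≤ p) (hgt : 4 * p < n)
    (v : Fin (p + 1) × ZMod (2 * n)) (hv : v ∈ Vset n p 1 0) :
    ∑ᶠ y ∈ Vset n p 0 p, ((AT n p).dist v y : ℚ) =
      (n : ℚ) ^ 2 / 2 + 4 * (p : ℚ) ^ 2 - 4 * (p : ℚ) + 1 := by
  have : NeZero (2 * n) := ⟨by omega⟩
  obtain ⟨hv1, hv2⟩ := hv
  obtain ⟨s, σ, hg, hvs⟩ : ∃ s σ : ℤ, Good s σ ∧ v = pos n p s σ 0 0 := by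
    have hc : v.2.val % 4 = 2 ∨ v.2.val % 4 = 3 := by omega
    have hz : ∀ σ : ℤ, v = pos n p (v.2.val : ℤ) σ 0 0 := by
      intro σ
      ext1
      · apply Fin.ext
        rw [pos_fst _ _ _ _ _ (Nat.zero_le _)]; exact hv1
      · simp [pos]
    rcases hc with hc | hc
    · exact ⟨v.2.val, 1, Or.inl ⟨by omega, rfl⟩, hz _⟩
    · exact ⟨v.2.val, -1, Or.inr ⟨by omega, rfl⟩, hz _⟩
  rw [← finsum_mem_eq_of_bijOn (f := fun c => ((E p c : ℕ) : ℚ)) _ (bij n p s σ hg hn4)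
    (by
      intro c hc
      rw [hvs, dist_tau n p s σ hg hn4 hp c (by simpa using hc)]),
    finsum_mem_coe_finset]
  obtain ⟨m, rfl⟩ : ∃ m, n = 4 * m + 2 := ⟨n / 4, by omega⟩
  obtain ⟨q, rfl⟩ : ∃ q, p = q + 1 := ⟨p - 1, by omega⟩
  rw [← Nat.cast_sum]
  unfold E
  rw [Finset.sum_add_distrib, sum_E1]
  simp only [Nat.add_sub_cancel]
  rw [sum_E2 q m (by omega)]
  push_cast
  ring
end

section
/- Let n ≥ 2 be an even integer and p ≥ 1 an integer with n > 4p + 4. Then the Graovac–Pisanski index of AT(n,p) satisfies Ŵ(AT(n,p)) = (p+1)·(n³p + n³ + (4np³)/3 + 4np² + (8np)/3). -/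
open SimpleGraph

/-- The Graovac–Pisanski index of a graph `G`:
`Ŵ(G) = (|V(G)| / (2 |Aut(G)|)) * Σ_u Σ_α d(u, α(u))`. -/
noncomputable def GPindex {V : Type*} (G : SimpleGraph V) : ℚ :=
  ((Nat.card V : ℚ) / (2 * (Nat.card (G ≃g G) : ℚ))) *
    ∑ᶠ u : V, ∑ᶠ α : G ≃g G, (G.dist u (α u) : ℚ)

namespace ATP

def up (j : ℤ) : ℤ := if 2 ≤ j % 4 then 1 else -1
def sg (j : ℤ) : ℤ := if j % 2 = 0 then -1 else 1

lemma val_mod (n : ℕ) (hn : 2 ≤ n) (hne : Even n) (j : ℤ) :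
    (((j : ZMod (2 * n)).val % 4 : ℕ) : ℤ) = j % 4 := by
  have : NeZero (2 * n) := ⟨by omega⟩
  obtain ⟨k, rfl⟩ := hne
  push_cast
  rw [ZMod.val_intCast]
  exact Int.emod_emod_of_dvd _ ⟨k, by push_cast; ring⟩

lemma cast_mod (n : ℕ) (hn : 2 ≤ n) (hne : Even n) (a b : ℤ)
    (h : (a : ZMod (2 * n)) = (b : ZMod (2 * n))) : a % 4 = b % 4 := by
  rw [← val_mod n hn hne, ← val_mod n hn hne, h]

lemma cast_ne (n : ℕ) (a b : ℤ) (h1 : (a - b).natAbs < 2 * n) (h2 : a ≠ b) :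
    (a : ZMod (2 * n)) ≠ (b : ZMod (2 * n)) := by
  intro h
  rw [ZMod.intCast_eq_intCast_iff_dvd_sub] at h
  have := Int.natAbs_dvd_natAbs.2 h
  have := Nat.le_of_dvd (by omega) this
  rw [Int.natAbs_natCast] at this
  omega

lemma lift (n : ℕ) (y : ZMod (2 * n)) : ∃ j : ℤ, (j : ZMod (2 * n)) = y :=
  ZMod.intCast_surjective y

lemma adj_iff (n p : ℕ) (hn : 2 ≤ n) (hne : Even n) (i : Fin (p + 1)) (j : ℤ)
    (w : Fin (p + 1) × ZMod (2 * n)) :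
    (AT n p).Adj (i, (j : ZMod (2 * n))) w ↔
      (w.1 = i ∧ w.2 = ((j + 1 : ℤ) : ZMod (2 * n))) ∨
      (w.1 = i ∧ w.2 = ((j - 1 : ℤ) : ZMod (2 * n))) ∨
      ((w.1 : ℤ) = i + up j ∧ w.2 = ((j + sg j : ℤ) : ZMod (2 * n))) := by
  obtain ⟨i', y⟩ := w
  obtain ⟨j', rfl⟩ := lift n y
  have v1 := val_mod n hn hne j
  have v2 := val_mod n hn hne j'
  simp only [AT, SimpleGraph.fromRel_adj, ATRel, ne_eq, Prod.mk.injEq, not_and]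
  have e1 : ((j' : ZMod (2 * n)) = (j : ZMod (2 * n)) + 1) ↔
      (j' : ZMod (2 * n)) = ((j + 1 : ℤ) : ZMod (2 * n)) := by push_cast; rfl
  have e2 : ((j' : ZMod (2 * n)) = (j : ZMod (2 * n)) - 1) ↔
      (j' : ZMod (2 * n)) = ((j - 1 : ℤ) : ZMod (2 * n)) := by push_cast; rfl
  have e3 : ((j : ZMod (2 * n)) = (j' : ZMod (2 * n)) + 1) ↔
      (j' : ZMod (2 * n)) = ((j - 1 : ℤ) : ZMod (2 * n)) := by
    push_cast; rw [eq_sub_iff_add_eq]; exact eq_comm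
  have e4 : ((j : ZMod (2 * n)) = (j' : ZMod (2 * n)) - 1) ↔
      (j' : ZMod (2 * n)) = ((j + 1 : ℤ) : ZMod (2 * n)) := by
    push_cast; rw [eq_sub_iff_add_eq]; exact eq_comm
  rw [e1, e2, e3, e4]
  have m1 : (j' : ZMod (2 * n)) = ((j + 1 : ℤ) : ZMod (2 * n)) → j' % 4 = (j + 1) % 4 :=
    cast_mod n hn hne _ _
  have m2 : (j' : ZMod (2 * n)) = ((j - 1 : ℤ) : ZMod (2 * n)) → j' % 4 = (j - 1) % 4 :=
    cast_mod n hn hne _ _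
  have m0 : (j : ZMod (2 * n)) = (j' : ZMod (2 * n)) → j % 4 = j' % 4 :=
    cast_mod n hn hne _ _
  simp only [Fin.ext_iff]
  have hsg : ((j' : ZMod (2 * n)) = ((j + sg j : ℤ) : ZMod (2 * n))) =
      (if j % 2 = 0 then (j' : ZMod (2 * n)) = ((j - 1 : ℤ) : ZMod (2 * n)) else (j' : ZMod (2 * n)) = ((j + 1 : ℤ) : ZMod (2 * n))) := by
    unfold sg; split_ifs <;> rfl
  rw [hsg]
  generalize ((j' : ZMod (2 * n)) = ((j - 1 : ℤ) : ZMod (2 * n))) = P2 at *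
  generalize ((j' : ZMod (2 * n)) = ((j + 1 : ℤ) : ZMod (2 * n))) = P1 at *
  generalize ((j : ZMod (2 * n)) = (j' : ZMod (2 * n))) = P0 at *
  generalize (j : ZMod (2 * n)).val % 4 = x at *
  generalize (j' : ZMod (2 * n)).val % 4 = x' at *
  clear e1 e2 e3 e4 hsg
  unfold up
  by_cases c0 : P0 <;> by_cases c1 : P1 <;> by_cases c2 : P2 <;>
    simp only [c0, c1, c2, forall_const, false_imp_iff, imp_false, and_true, and_false,
      true_and, false_and, or_false, false_or, not_true, not_false_eq_true] at * <;>
    split_ifs <;> simp <;> omega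

/-- Distance in the universal cover (with layer difference `m`). -/
def D (m j j' : ℤ) : ℕ :=
  ((j' + 1) / 2 - (j + 1) / 2).natAbs + (m + (j' + 2) / 4 - (j + 2) / 4).natAbs +
    (j' / 4 - j / 4 - m).natAbs

lemma D_zero (m j j' : ℤ) (h : D m j j' = 0) : m = 0 ∧ j = j' := by
  unfold D at h; omega

lemma D_ge (m j j' : ℤ) : (j' - j).natAbs ≤ D m j j' := by
  unfold D; omega

lemma up_cases (j : ℤ) : (j % 4 = 0 ∧ up j = -1 ∧ sg j = -1) ∨ (j % 4 = 1 ∧ up j = -1 ∧ sg j = 1) ∨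
    (j % 4 = 2 ∧ up j = 1 ∧ sg j = -1) ∨ (j % 4 = 3 ∧ up j = 1 ∧ sg j = 1) := by
  unfold up sg; split_ifs <;> omega

/-- Effect of the three kinds of moves on the three cut coordinates. -/
lemma coords (j : ℤ) : ∃ q : ℤ, 
    (j % 4 = 0 ∧ j = 4 * q ∧ (j + 1) / 2 = 2 * q ∧ (j + 2) / 4 = q ∧ j / 4 = q) ∨
    (j % 4 = 1 ∧ j = 4 * q + 1 ∧ (j + 1) / 2 = 2 * q + 1 ∧ (j + 2) / 4 = q ∧ j / 4 = q) ∨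
    (j % 4 = 2 ∧ j = 4 * q + 2 ∧ (j + 1) / 2 = 2 * q + 1 ∧ (j + 2) / 4 = q + 1 ∧ j / 4 = q) ∨
    (j % 4 = 3 ∧ j = 4 * q + 3 ∧ (j + 1) / 2 = 2 * q + 2 ∧ (j + 2) / 4 = q + 1 ∧ j / 4 = q) := by
  refine ⟨j / 4, ?_⟩
  omega

lemma D_of (m j j' a b c a' b' c' : ℤ) (h1 : (j + 1) / 2 = a) (h2 : (j + 2) / 4 = b)
    (h3 : j / 4 = c) (h1' : (j' + 1) / 2 = a') (h2' : (j' + 2) / 4 = b')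
    (h3' : j' / 4 = c') :
    D m j j' = (a' - a).natAbs + (m + b' - b).natAbs + (c' - c - m).natAbs := by
  subst h1 h2 h3 h1' h2' h3'; rfl

lemma D_step (m j j' : ℤ) (h : D m j j' ≠ 0) :
    D m (j + 1) j' + 1 = D m j j' ∨ D m (j - 1) j' + 1 = D m j j' ∨
    (0 < m * up j ∧ D (m - up j) (j + sg j) j' + 1 = D m j j') := by
  obtain ⟨A, hA⟩ : ∃ A, (j' + 1) / 2 = A := ⟨_, rfl⟩
  obtain ⟨B, hB⟩ : ∃ B, (j' + 2) / 4 = B := ⟨_, rfl⟩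
  obtain ⟨C, hC⟩ : ∃ C, j' / 4 = C := ⟨_, rfl⟩
  have r1 : 2 * C ≤ A ∧ A ≤ 2 * C + 2 := by omega
  have r2 : C ≤ B ∧ B ≤ C + 1 := by omega
  have r3 : 2 * B ≤ A + 1 ∧ A ≤ 2 * B + 1 := by omega
  obtain ⟨q, ⟨e, rfl, -⟩ | ⟨e, rfl, -⟩ | ⟨e, rfl, -⟩ | ⟨e, rfl, -⟩⟩ := coords j
  · rw [D_of m (4 * q) j' (2 * q) q q A B C (by omega) (by omega) (by omega) hA hB hC] at h ⊢
    rw [D_of m (4 * q + 1) j' (2 * q + 1) q q A B C (by omega) (by omega) (by omega) hA hB hC]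
    rw [D_of m (4 * q - 1) j' (2 * q) q (q - 1) A B C (by omega) (by omega) (by omega) hA hB hC]
    obtain ⟨e1, e2⟩ : up (4 * q) = -1 ∧ sg (4 * q) = -1 := by
      have := up_cases (4 * q); omega
    rw [e1, e2]
    rw [D_of _ (4 * q + -1) j' (2 * q) q (q - 1) A B C (by omega) (by omega) (by omega) hA hB hC]
    by_cases c1 : 2 * q < A
    · left; omega
    · by_cases c2 : C < q + m
      · right; left; omega
      · right; right; omega
  · rw [D_of m (4 * q + 1) j' (2 * q + 1) q q A B C (by omega) (by omega) (by omega) hA hB hC] at h ⊢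
    rw [D_of m (4 * q + 1 + 1) j' (2 * q + 1) (q + 1) q A B C (by omega) (by omega) (by omega) hA hB hC]
    rw [D_of m (4 * q + 1 - 1) j' (2 * q) q q A B C (by omega) (by omega) (by omega) hA hB hC]
    obtain ⟨e1, e2⟩ : up (4 * q + 1) = -1 ∧ sg (4 * q + 1) = 1 := by
      have := up_cases (4 * q + 1); omega
    rw [e1, e2]
    rw [D_of _ (4 * q + 1 + 1) j' (2 * q + 1) (q + 1) q A B C (by omega) (by omega) (by omega) hA hB hC]
    by_cases c1 : A < 2 * q + 1
    · right; left; omega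
    · by_cases c2 : q < m + B
      · left; omega
      · right; right; omega
  · rw [D_of m (4 * q + 2) j' (2 * q + 1) (q + 1) q A B C (by omega) (by omega) (by omega) hA hB hC] at h ⊢
    rw [D_of m (4 * q + 2 + 1) j' (2 * q + 2) (q + 1) q A B C (by omega) (by omega) (by omega) hA hB hC]
    rw [D_of m (4 * q + 2 - 1) j' (2 * q + 1) q q A B C (by omega) (by omega) (by omega) hA hB hC]
    obtain ⟨e1, e2⟩ : up (4 * q + 2) = 1 ∧ sg (4 * q + 2) = -1 := by
      have := up_cases (4 * q + 2); omega
    rw [e1, e2]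
    rw [D_of _ (4 * q + 2 + -1) j' (2 * q + 1) q q A B C (by omega) (by omega) (by omega) hA hB hC]
    by_cases c1 : 2 * q + 1 < A
    · left; omega
    · by_cases c2 : m + B < q + 1
      · right; left; omega
      · right; right; omega
  · rw [D_of m (4 * q + 3) j' (2 * q + 2) (q + 1) q A B C (by omega) (by omega) (by omega) hA hB hC] at h ⊢
    rw [D_of m (4 * q + 3 + 1) j' (2 * q + 2) (q + 1) (q + 1) A B C
      (by omega) (by omega) (by omega) hA hB hC]
    rw [D_of m (4 * q + 3 - 1) j' (2 * q + 1) (q + 1) q A B C (by omega) (by omega) (by omega) hA hB hC]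
    obtain ⟨e1, e2⟩ : up (4 * q + 3) = 1 ∧ sg (4 * q + 3) = 1 := by
      have := up_cases (4 * q + 3); omega
    rw [e1, e2]
    rw [D_of _ (4 * q + 3 + 1) j' (2 * q + 2) (q + 1) (q + 1) A B C
      (by omega) (by omega) (by omega) hA hB hC]
    by_cases c1 : A < 2 * q + 2
    · right; left; omega
    · by_cases c2 : q + m < C
      · left; omega
      · right; right; omega

lemma D_lip (m j j' : ℤ) :
    D m j j' ≤ D m (j + 1) j' + 1 ∧ D m j j' ≤ D m (j - 1) j' + 1 ∧
    D m j j' ≤ D (m - up j) (j + sg j) j' + 1 := by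
  refine ⟨?_, ?_, ?_⟩
  · unfold D; omega
  · unfold D; omega
  · obtain ⟨A, hA⟩ : ∃ A, (j' + 1) / 2 = A := ⟨_, rfl⟩
    obtain ⟨B, hB⟩ : ∃ B, (j' + 2) / 4 = B := ⟨_, rfl⟩
    obtain ⟨C, hC⟩ : ∃ C, j' / 4 = C := ⟨_, rfl⟩
    obtain ⟨q, hq⟩ := coords j
    have hu := up_cases j
    rcases hq with ⟨e, rfl, -⟩ | ⟨e, rfl, -⟩ | ⟨e, rfl, -⟩ | ⟨e, rfl, -⟩
    · rw [show up (4 * q) = -1 by omega, show sg (4 * q) = -1 by omega,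
        D_of m _ j' (2 * q) q q A B C (by omega) (by omega) (by omega) hA hB hC,
        D_of _ (_ + -1) j' (2 * q) q (q - 1) A B C (by omega) (by omega) (by omega) hA hB hC]
      omega
    · rw [show up (4 * q + 1) = -1 by omega, show sg (4 * q + 1) = 1 by omega,
        D_of m _ j' (2 * q + 1) q q A B C (by omega) (by omega) (by omega) hA hB hC,
        D_of _ (_ + 1) j' (2 * q + 1) (q + 1) q A B C (by omega) (by omega) (by omega) hA hB hC]
      omega
    · rw [show up (4 * q + 2) = 1 by omega, show sg (4 * q + 2) = -1 by omega,
        D_of m _ j' (2 * q + 1) (q + 1) q A B C (by omega) (by omega) (by omega) hA hB hC,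
        D_of _ (_ + -1) j' (2 * q + 1) q q A B C (by omega) (by omega) (by omega) hA hB hC]
      omega
    · rw [show up (4 * q + 3) = 1 by omega, show sg (4 * q + 3) = 1 by omega,
        D_of m _ j' (2 * q + 2) (q + 1) q A B C (by omega) (by omega) (by omega) hA hB hC,
        D_of _ (_ + 1) j' (2 * q + 2) (q + 1) (q + 1) A B C
          (by omega) (by omega) (by omega) hA hB hC]
      omega

lemma walk_le (n p : ℕ) (hn : 2 ≤ n) (hne : Even n) (i' : Fin (p + 1)) (j' : ℤ) :
    ∀ (N : ℕ) (i : Fin (p + 1)) (j : ℤ), D ((i' : ℤ) - i) j j' = N →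
      ∃ w : (AT n p).Walk (i, (j : ZMod (2 * n))) (i', (j' : ZMod (2 * n))), w.length = N := by
  intro N
  induction N with
  | zero =>
    intro i j h
    obtain ⟨h1, rfl⟩ := D_zero _ _ _ h
    have : i = i' := Fin.ext (by omega)
    subst this
    exact ⟨SimpleGraph.Walk.nil, rfl⟩
  | succ N ih =>
    intro i j h
    rcases D_step _ _ _ (by rw [h]; omega : D ((i' : ℤ) - i) j j' ≠ 0) with h1 | h1 | ⟨h0, h1⟩
    · obtain ⟨w, hw⟩ := ih i (j + 1) (by omega)
      exact ⟨SimpleGraph.Walk.cons ((adj_iff n p hn hne _ _ _).2 (Or.inl ⟨rfl, rfl⟩)) w,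
        by simp [hw]⟩
    · obtain ⟨w, hw⟩ := ih i (j - 1) (by omega)
      exact ⟨SimpleGraph.Walk.cons ((adj_iff n p hn hne _ _ _).2 (Or.inr (Or.inl ⟨rfl, rfl⟩))) w,
        by simp [hw]⟩
    · have hb : 0 ≤ (i : ℤ) + up j ∧ (i : ℤ) + up j < p + 1 := by
        have := i'.2
        have := i.2
        unfold up at *; split_ifs at * <;> omega
      obtain ⟨k, hk⟩ := Int.eq_ofNat_of_zero_le hb.1
      have hk' : k < p + 1 := by omega
      obtain ⟨w, hw⟩ := ih ⟨k, hk'⟩ (j + sg j) (by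
        have : (i' : ℤ) - ((⟨k, hk'⟩ : Fin (p + 1)) : ℕ) = (i' : ℤ) - i - up j := by
          simp only; omega
        rw [this]; omega)
      exact ⟨SimpleGraph.Walk.cons ((adj_iff n p hn hne _ _ _).2
        (Or.inr (Or.inr ⟨by simp only; omega, rfl⟩))) w, by simp [hw]⟩

lemma walk_ge (n p : ℕ) (hn : 2 ≤ n) (hne : Even n) (u v : Fin (p + 1) × ZMod (2 * n))
    (w : (AT n p).Walk u v) : ∀ j : ℤ, u.2 = (j : ZMod (2 * n)) →
      ∃ j' : ℤ, v.2 = (j' : ZMod (2 * n)) ∧ D ((v.1 : ℤ) - u.1) j j' ≤ w.length := by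
  induction w with
  | nil => intro j h; exact ⟨j, h, by simp [D]⟩
  | @cons u w v h q ih =>
    intro j hj
    obtain ⟨i, y⟩ := u
    simp only at hj
    subst hj
    rcases (adj_iff n p hn hne _ _ _).1 h with ⟨h1, h2⟩ | ⟨h1, h2⟩ | ⟨h1, h2⟩
    all_goals
      obtain ⟨j', e1, e2⟩ := ih _ h2
      refine ⟨j', e1, ?_⟩
      have L := D_lip ((v.1 : ℤ) - i) j j'
      simp only [SimpleGraph.Walk.length_cons]
    · rw [h1] at e2; omega
    · rw [h1] at e2; omega
    · rw [h1, ← sub_sub] at e2; omega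

lemma conn (n p : ℕ) (hn : 2 ≤ n) (hne : Even n) : (AT n p).Connected := by
  have : Nonempty (Fin (p + 1) × ZMod (2 * n)) := ⟨(0, 0)⟩
  refine SimpleGraph.Connected.mk ?_
  rintro ⟨i, y⟩ ⟨i', y'⟩
  obtain ⟨j, rfl⟩ := lift n y
  obtain ⟨j', rfl⟩ := lift n y'
  obtain ⟨w, -⟩ := walk_le n p hn hne i' j' _ i j rfl
  exact ⟨w⟩

lemma dist_eq (n p : ℕ) (hn : 2 ≤ n) (hne : Even n) (i i' : Fin (p + 1)) (y : ℤ)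
    (hy : y.natAbs ≤ n) (hD : D ((i' : ℤ) - i) 0 y ≤ n) :
    (AT n p).dist (i, ((0 : ℤ) : ZMod (2 * n))) (i', (y : ZMod (2 * n))) =
      D ((i' : ℤ) - i) 0 y := by
  apply le_antisymm
  · obtain ⟨w, hw⟩ := walk_le n p hn hne i' y _ i 0 rfl
    rw [← hw]; exact SimpleGraph.dist_le w
  · obtain ⟨w, hw⟩ := (conn n p hn hne).exists_walk_length_eq_dist
      (i, ((0 : ℤ) : ZMod (2 * n))) (i', (y : ZMod (2 * n)))
    rw [← hw]
    obtain ⟨j', h1, h2⟩ := walk_ge n p hn hne _ _ w 0 rfl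
    simp only at h1 h2
    by_cases h : y = j'
    · subst h; exact h2
    · have : ¬ (y - j').natAbs < 2 * n := fun hh => cast_ne n _ _ hh h h1
      have := D_ge ((i' : ℤ) - i) 0 j'
      omega

/-- Excess of the distance over the horizontal distance. -/
def ex (m y : ℤ) : ℤ :=
  if 2 ≤ y % 4 then max 0 (((2 * m + 1).natAbs : ℤ) - ((2 * (y / 4) + 1).natAbs : ℤ)) else 0

lemma D_ex (m y : ℤ) (h : 2 ≤ y % 4) : (D m 0 y : ℤ) = (y.natAbs : ℤ) + ex m y := by
  unfold ex D; rw [if_pos h]; omega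

lemma D_same (y : ℤ) : (D 0 0 y : ℤ) = (y.natAbs : ℤ) := by
  unfold D; omega

lemma sum_abs (n : ℕ) : ∑ y ∈ Finset.Ico (-(n : ℤ)) n, (y.natAbs : ℤ) = (n : ℤ) ^ 2 := by
  induction n with
  | zero => simp
  | succ n ih =>
    have : Finset.Ico (-((n + 1 : ℕ) : ℤ)) ((n + 1 : ℕ) : ℤ) =
        insert (-(n : ℤ) - 1) (insert (n : ℤ) (Finset.Ico (-(n : ℤ)) n)) := by
      ext x; simp only [Finset.mem_Ico, Finset.mem_insert]; push_cast; omega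
    rw [this, Finset.sum_insert (by simp), Finset.sum_insert (by simp), ih]
    have e1 : ((-(n : ℤ) - 1).natAbs : ℤ) = n + 1 := by omega
    rw [e1, Int.natAbs_natCast]; push_cast; ring

lemma sum_ex_aux (h : ℤ) (k : ℕ) : ∑ y ∈ Finset.Ico (-(4 * k : ℤ)) (4 * k),
    (if 2 ≤ y % 4 then 2 * h + 1 - ((2 * (y / 4) + 1).natAbs : ℤ) else 0) =
      4 * (2 * h * k - k * (k - 1)) := by
  induction k with
  | zero => simp
  | succ k ih =>
    have : Finset.Ico (-(4 * (k + 1 : ℕ) : ℤ)) (4 * ((k + 1 : ℕ) : ℤ)) =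
        insert (-(4 * k : ℤ) - 4) (insert (-(4 * k : ℤ) - 3) (insert (-(4 * k : ℤ) - 2)
        (insert (-(4 * k : ℤ) - 1) (insert (4 * k : ℤ) (insert (4 * k + 1 : ℤ)
        (insert (4 * k + 2 : ℤ) (insert (4 * k + 3 : ℤ)
          (Finset.Ico (-(4 * k : ℤ)) (4 * k))))))))) := by
      ext x; simp only [Finset.mem_Ico, Finset.mem_insert]; push_cast; omega
    rw [this]
    repeat rw [Finset.sum_insert (by simp only [Finset.mem_Ico, Finset.mem_insert]; omega)]
    rw [ih, if_neg (by omega), if_neg (by omega), if_pos (by omega), if_pos (by omega),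
      if_neg (by omega), if_neg (by omega), if_pos (by omega), if_pos (by omega)]
    have e1 : ((2 * ((-(4 * k : ℤ) - 2) / 4) + 1).natAbs : ℤ) = 2 * k + 1 := by omega
    have e2 : ((2 * ((-(4 * k : ℤ) - 1) / 4) + 1).natAbs : ℤ) = 2 * k + 1 := by omega
    have e3 : ((2 * (((4 * k : ℤ) + 2) / 4) + 1).natAbs : ℤ) = 2 * k + 1 := by omega
    have e4 : ((2 * (((4 * k : ℤ) + 3) / 4) + 1).natAbs : ℤ) = 2 * k + 1 := by omega
    rw [e1, e2, e3, e4]; push_cast; ring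

lemma sum_ex (n p : ℕ) (m : ℤ) (hm : m.natAbs ≤ p) (hgt : 4 * p + 4 < n) :
    ∑ y ∈ Finset.Ico (-(n : ℤ)) n, ex m y = 4 * m * (m + 1) := by
  obtain ⟨h, hh⟩ : ∃ h : ℕ, (2 * m + 1).natAbs = 2 * h + 1 := ⟨(2 * m + 1).natAbs / 2, by omega⟩
  have hsub : Finset.Ico (-(4 * h : ℤ)) (4 * h) ⊆ Finset.Ico (-(n : ℤ)) n := by
    intro x; simp only [Finset.mem_Ico]; omega
  rw [← Finset.sum_subset hsub]
  · have : ∀ y ∈ Finset.Ico (-(4 * h : ℤ)) (4 * h), ex m y =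
        (if 2 ≤ y % 4 then 2 * (h : ℤ) + 1 - ((2 * (y / 4) + 1).natAbs : ℤ) else 0) := by
      intro y hy
      rw [Finset.mem_Ico] at hy
      unfold ex; rw [hh]; split_ifs <;> omega
    rw [Finset.sum_congr rfl this, sum_ex_aux]
    have : (h : ℤ) = m ∨ (h : ℤ) = - m - 1 := by omega
    rcases this with e | e <;> rw [e] <;> ring
  · intro y h1 h2
    rw [Finset.mem_Ico] at h1 h2
    unfold ex; rw [hh]; split_ifs <;> omega

end ATP

namespace ATP

/-- The layer map of the automorphism with index `x`. -/
def flipL (p : ℕ) (x : ℤ) (i : Fin (p + 1)) : Fin (p + 1) := if 2 ≤ x % 4 then i.rev else i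

/-- The position map, on integer lifts. -/
def pos (x j : ℤ) : ℤ := if x % 2 = 0 then x + j else x - j

/-- The underlying vertex map of the automorphism with index `x`. -/
def Afun (n p : ℕ) (x : ℤ) (v : Fin (p + 1) × ZMod (2 * n)) : Fin (p + 1) × ZMod (2 * n) :=
  (flipL p x v.1, if x % 2 = 0 then (x : ZMod (2 * n)) + v.2 else (x : ZMod (2 * n)) - v.2)

lemma Afun_cast (n p : ℕ) (x : ℤ) (i : Fin (p + 1)) (j : ℤ) :
    Afun n p x (i, (j : ZMod (2 * n))) = (flipL p x i, ((pos x j : ℤ) : ZMod (2 * n))) := by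
  unfold Afun pos; split_ifs <;> simp

lemma flipL_val (p : ℕ) (x : ℤ) (i : Fin (p + 1)) :
    ((flipL p x i : ℕ) : ℤ) = if 2 ≤ x % 4 then (p : ℤ) - i else i := by
  unfold flipL; split_ifs
  · rw [Fin.val_rev]; have := i.2; omega
  · rfl

lemma flipL_flipL (p : ℕ) (x y : ℤ) (h : 2 ≤ x % 4 ↔ 2 ≤ y % 4) (i : Fin (p + 1)) :
    flipL p x (flipL p y i) = i := by
  unfold flipL; split_ifs <;> first | simp | (exfalso; omega)

lemma Afun_adj (n p : ℕ) (hn : 2 ≤ n) (hne : Even n) (x : ℤ) (u v : Fin (p + 1) × ZMod (2 * n))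
    (h : (AT n p).Adj u v) : (AT n p).Adj (Afun n p x u) (Afun n p x v) := by
  obtain ⟨i, y⟩ := u
  obtain ⟨j, rfl⟩ := lift n y
  obtain ⟨i', y'⟩ := v
  rw [adj_iff n p hn hne] at h
  simp only at h
  rw [Afun_cast, adj_iff n p hn hne]
  rcases h with ⟨rfl, rfl⟩ | ⟨rfl, rfl⟩ | ⟨h1, rfl⟩
  · rw [Afun_cast]
    by_cases hx : x % 2 = 0
    · left; exact ⟨rfl, by unfold pos; rw [if_pos hx, if_pos hx, add_assoc]⟩
    · right; left; exact ⟨rfl, by unfold pos; rw [if_neg hx, if_neg hx, sub_sub]⟩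
  · rw [Afun_cast]
    by_cases hx : x % 2 = 0
    · right; left; exact ⟨rfl, by unfold pos; rw [if_pos hx, if_pos hx, add_sub_assoc]⟩
    · left; exact ⟨rfl, by unfold pos; rw [if_neg hx, if_neg hx, sub_sub_eq_add_sub, add_sub_right_comm]⟩
  · right; right
    rw [Afun_cast]
    refine ⟨?_, ?_⟩
    · simp only [flipL_val]
      unfold up pos at *
      split_ifs at * <;> omega
    · have : pos x (j + sg j) = pos x j + sg (pos x j) := by
        unfold pos sg; split_ifs <;> omega
      rw [this]

/-- Index of the inverse automorphism. -/
def invIdx (x : ℤ) : ℤ := if x % 2 = 0 then -x else x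

lemma Afun_inv (n p : ℕ) (x : ℤ) (v : Fin (p + 1) × ZMod (2 * n)) :
    Afun n p (invIdx x) (Afun n p x v) = v := by
  obtain ⟨i, y⟩ := v
  obtain ⟨j, rfl⟩ := lift n y
  rw [Afun_cast, Afun_cast, flipL_flipL _ _ _ (by unfold invIdx; split_ifs <;> omega)]
  have : pos (invIdx x) (pos x j) = j := by
    unfold invIdx pos; split_ifs <;> omega
  rw [this]

lemma invIdx_invIdx (x : ℤ) : invIdx (invIdx x) = x := by
  unfold invIdx; split_ifs <;> omega

/-- The automorphism with index `x`. -/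
def A (n p : ℕ) (hn : 2 ≤ n) (hne : Even n) (x : ℤ) : AT n p ≃g AT n p where
  toFun := Afun n p x
  invFun := Afun n p (invIdx x)
  left_inv := Afun_inv n p x
  right_inv v := by
    have := Afun_inv n p (invIdx x) v
    rwa [invIdx_invIdx] at this
  map_rel_iff' := by
    intro u v
    refine ⟨fun h => ?_, Afun_adj n p hn hne x u v⟩
    have := Afun_adj n p hn hne (invIdx x) _ _ h
    simpa [Afun_inv] using this

lemma A_apply (n p : ℕ) (hn : 2 ≤ n) (hne : Even n) (x : ℤ) (i : Fin (p + 1)) (j : ℤ) :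
    A n p hn hne x (i, (j : ZMod (2 * n))) = (flipL p x i, ((pos x j : ℤ) : ZMod (2 * n))) :=
  Afun_cast n p x i j

lemma pos_zero (x : ℤ) : pos x 0 = x := by unfold pos; split_ifs <;> simp

/-- The vertex `v` has three distinct neighbours. -/
def P3 {V : Type*} (G : SimpleGraph V) (v : V) : Prop :=
  ∃ a b c, G.Adj v a ∧ G.Adj v b ∧ G.Adj v c ∧ a ≠ b ∧ a ≠ c ∧ b ≠ c

lemma P3_map {V : Type*} (G : SimpleGraph V) (α : G ≃g G) (v : V) (h : P3 G v) : P3 G (α v) := by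
  obtain ⟨a, b, c, h1, h2, h3, h4, h5, h6⟩ := h
  exact ⟨α a, α b, α c, α.map_rel_iff.2 h1, α.map_rel_iff.2 h2, α.map_rel_iff.2 h3,
    α.injective.ne h4, α.injective.ne h5, α.injective.ne h6⟩

lemma P3_iff {V : Type*} (G : SimpleGraph V) (α : G ≃g G) (v : V) : P3 G (α v) ↔ P3 G v := by
  refine ⟨fun h => ?_, P3_map G α v⟩
  have := P3_map G α.symm _ h
  rwa [RelIso.symm_apply_apply] at this

lemma up_ne (j : ℤ) : up j ≠ 0 := by unfold up; split_ifs <;> simp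

lemma P3_AT (n p : ℕ) (hn : 2 ≤ n) (hne : Even n) (i : Fin (p + 1)) (j : ℤ) :
    P3 (AT n p) (i, (j : ZMod (2 * n))) ↔ 0 ≤ (i : ℤ) + up j ∧ (i : ℤ) + up j ≤ p := by
  constructor
  · rintro ⟨a, b, c, h1, h2, h3, h4, h5, h6⟩
    have key : ∀ w : Fin (p + 1) × ZMod (2 * n), (w.1 : ℤ) = i + up j →
        0 ≤ (i : ℤ) + up j ∧ (i : ℤ) + up j ≤ p := by
      intro w hw
      have := w.1.2
      omega
    rw [adj_iff n p hn hne] at h1 h2 h3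
    rcases h1 with h1 | h1 | h1
    · rcases h2 with h2 | h2 | h2
      · exact absurd (Prod.ext (h1.1.trans h2.1.symm) (h1.2.trans h2.2.symm)) h4
      · rcases h3 with h3 | h3 | h3
        · exact absurd (Prod.ext (h1.1.trans h3.1.symm) (h1.2.trans h3.2.symm)) h5
        · exact absurd (Prod.ext (h2.1.trans h3.1.symm) (h2.2.trans h3.2.symm)) h6
        · exact key _ h3.1
      · exact key _ h2.1
    · rcases h2 with h2 | h2 | h2
      · rcases h3 with h3 | h3 | h3
        · exact absurd (Prod.ext (h2.1.trans h3.1.symm) (h2.2.trans h3.2.symm)) h6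
        · exact absurd (Prod.ext (h1.1.trans h3.1.symm) (h1.2.trans h3.2.symm)) h5
        · exact key _ h3.1
      · exact absurd (Prod.ext (h1.1.trans h2.1.symm) (h1.2.trans h2.2.symm)) h4
      · exact key _ h2.1
    · exact key _ h1.1
  · rintro ⟨h1, h2⟩
    obtain ⟨k, hk⟩ := Int.eq_ofNat_of_zero_le h1
    have hk' : k < p + 1 := by omega
    have hu := up_ne j
    have hki : (⟨k, hk'⟩ : Fin (p + 1)) ≠ i := by
      intro h; rw [← h] at hk; simp only at hk; omega
    refine ⟨(i, ((j + 1 : ℤ) : ZMod (2 * n))), (i, ((j - 1 : ℤ) : ZMod (2 * n))),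
      (⟨k, hk'⟩, ((j + sg j : ℤ) : ZMod (2 * n))), ?_, ?_, ?_, ?_, ?_, ?_⟩
    · rw [adj_iff n p hn hne]; exact Or.inl ⟨rfl, rfl⟩
    · rw [adj_iff n p hn hne]; exact Or.inr (Or.inl ⟨rfl, rfl⟩)
    · rw [adj_iff n p hn hne]; exact Or.inr (Or.inr ⟨hk.symm, rfl⟩)
    · intro h
      exact cast_ne n _ _ (by omega) (by omega) (Prod.ext_iff.1 h).2
    · intro h; exact hki (Prod.ext_iff.1 h).1.symm
    · intro h; exact hki (Prod.ext_iff.1 h).1.symm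

section rigid

variable (n p : ℕ) (hn : 5 ≤ n) (hne : Even n) (hp : 1 ≤ p) (α : AT n p ≃g AT n p)

/-- `α` fixes the vertex `(i, j)`. -/
def Fx (n p : ℕ) (α : AT n p ≃g AT n p) (i : Fin (p + 1)) (j : ℤ) : Prop :=
  α (i, (j : ZMod (2 * n))) = (i, (j : ZMod (2 * n)))

include hn hne

/-- Images of neighbours of a fixed vertex. -/
lemma img (i : Fin (p + 1)) (j : ℤ) (h : Fx n p α i j) (w : Fin (p + 1) × ZMod (2 * n))
    (hw : (AT n p).Adj (i, (j : ZMod (2 * n))) w) :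
    α w = (i, ((j + 1 : ℤ) : ZMod (2 * n))) ∨ α w = (i, ((j - 1 : ℤ) : ZMod (2 * n))) ∨
      (((α w).1 : ℤ) = i + up j ∧ (α w).2 = ((j + sg j : ℤ) : ZMod (2 * n))) := by
  have h2 := α.map_rel_iff.2 hw
  rw [h, adj_iff n p (by omega) hne] at h2
  rcases h2 with h2 | h2 | h2
  · left; exact Prod.ext h2.1 h2.2
  · right; left; exact Prod.ext h2.1 h2.2
  · right; right; exact h2

lemma fx_right (i : Fin (p + 1)) (j : ℤ) (h : Fx n p α i j) (h1 : Fx n p α i (j - 1))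
    (h2 : ∀ w : Fin (p + 1) × ZMod (2 * n), (w.1 : ℤ) = i + up j →
      w.2 = ((j + sg j : ℤ) : ZMod (2 * n)) → α (i, ((j + 1 : ℤ) : ZMod (2 * n))) ≠ w) :
    Fx n p α i (j + 1) := by
  have hw : (AT n p).Adj (i, (j : ZMod (2 * n))) (i, ((j + 1 : ℤ) : ZMod (2 * n))) := by
    rw [adj_iff n p (by omega) hne]; exact Or.inl ⟨rfl, rfl⟩
  rcases img n p hn hne α i j h _ hw with h3 | h3 | h3
  · exact h3
  · have := α.injective (h3.trans h1.symm)
    exact absurd (Prod.ext_iff.1 this).2 (cast_ne n _ _ (by omega) (by omega))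
  · exact absurd rfl (h2 _ h3.1 h3.2)

lemma fx_left (i : Fin (p + 1)) (j : ℤ) (h : Fx n p α i j) (h1 : Fx n p α i (j + 1))
    (h2 : ∀ w : Fin (p + 1) × ZMod (2 * n), (w.1 : ℤ) = i + up j →
      w.2 = ((j + sg j : ℤ) : ZMod (2 * n)) → α (i, ((j - 1 : ℤ) : ZMod (2 * n))) ≠ w) :
    Fx n p α i (j - 1) := by
  have hw : (AT n p).Adj (i, (j : ZMod (2 * n))) (i, ((j - 1 : ℤ) : ZMod (2 * n))) := by
    rw [adj_iff n p (by omega) hne]; exact Or.inr (Or.inl ⟨rfl, rfl⟩)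
  rcases img n p hn hne α i j h _ hw with h3 | h3 | h3
  · have := α.injective (h3.trans h1.symm)
    exact absurd (Prod.ext_iff.1 this).2 (cast_ne n _ _ (by omega) (by omega))
  · exact h3
  · exact absurd rfl (h2 _ h3.1 h3.2)

lemma fx_vert (i i' : Fin (p + 1)) (j : ℤ) (h : Fx n p α i j) (h1 : Fx n p α i (j + 1))
    (h2 : Fx n p α i (j - 1)) (hi : (i' : ℤ) = i + up j) : Fx n p α i' (j + sg j) := by
  have hw : (AT n p).Adj (i, (j : ZMod (2 * n))) (i', ((j + sg j : ℤ) : ZMod (2 * n))) := by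
    rw [adj_iff n p (by omega) hne]; exact Or.inr (Or.inr ⟨hi, rfl⟩)
  have hu := up_ne j
  rcases img n p hn hne α i j h _ hw with h3 | h3 | h3
  · have := α.injective (h3.trans h1.symm)
    have := (Prod.ext_iff.1 this).1
    simp only at this
    rw [this] at hi; omega
  · have := α.injective (h3.trans h2.symm)
    have := (Prod.ext_iff.1 this).1
    simp only at this
    rw [this] at hi; omega
  · refine Prod.ext (Fin.ext ?_) h3.2
    have := h3.1
    simp only
    omega

include hp

lemma fx_bottom (h0 : Fx n p α 0 0) : ∀ k : ℕ,
    Fx n p α 0 (4 * k - 1) ∧ Fx n p α 0 (4 * k) ∧ Fx n p α 0 (4 * k + 1) ∧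
    Fx n p α 0 (4 * k + 2) := by
  have hn2 : 2 ≤ n := by omega
  -- from two consecutive fixed vertices to the next two
  have base : ∀ k : ℤ, Fx n p α 0 (4 * k) → Fx n p α 0 (4 * k - 1) →
      Fx n p α 0 (4 * k + 1) ∧ Fx n p α 0 (4 * k + 2) := by
    intro k ha hb
    have u0 : up (4 * k) = -1 := by have := up_cases (4 * k); omega
    have u1 : up (4 * k + 1) = -1 := by have := up_cases (4 * k + 1); omega
    have hc : Fx n p α 0 (4 * k + 1) := by
      refine fx_right n p hn hne α 0 _ ha hb ?_
      intro w hw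
      rw [u0] at hw; simp at hw
    refine ⟨hc, ?_⟩
    have := fx_right n p hn hne α 0 (4 * k + 1) hc (by rwa [add_sub_cancel_right]) (by
      intro w hw
      rw [u1] at hw; simp at hw)
    rwa [add_assoc] at this
  have hm1 : Fx n p α 0 (-1) := by
    have u0 : up 0 = -1 := by have := up_cases 0; omega
    have hw : (AT n p).Adj (0, ((0 : ℤ) : ZMod (2 * n))) (0, ((-1 : ℤ) : ZMod (2 * n))) := by
      rw [adj_iff n p hn2 hne]; exact Or.inr (Or.inl ⟨rfl, by norm_num⟩)
    have hP : P3 (AT n p) (0, ((-1 : ℤ) : ZMod (2 * n))) := by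
      rw [P3_AT n p hn2 hne]
      have : up (-1) = 1 := by have := up_cases (-1); omega
      rw [this]; simp; omega
    rcases img n p hn hne α 0 0 h0 _ hw with h3 | h3 | h3
    · exfalso
      rw [← P3_iff _ α, h3, P3_AT n p hn2 hne] at hP
      have : up (0 + 1) = -1 := by have := up_cases (0 + 1); omega
      rw [this] at hP; simp at hP
    · rw [zero_sub] at h3; exact h3
    · have := h3.1
      rw [u0] at this; simp at this
  intro k
  induction k with
  | zero => exact ⟨by simpa using hm1, by simpa using h0, by simpa using (base 0 (by simpa using h0) (by simpa using hm1)).1, by simpa using (base 0 (by simpa using h0) (by simpa using hm1)).2⟩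
  | succ k ih =>
    obtain ⟨f0, f1, f2, f3⟩ := ih
    have u2 : up (4 * k + 2) = 1 ∧ sg (4 * k + 2) = -1 := by
      have := up_cases (4 * k + 2); omega
    have u3 : up (4 * k + 3) = 1 ∧ sg (4 * k + 3) = 1 := by
      have := up_cases (4 * k + 3); omega
    have u4 : up (4 * k + 4) = -1 := by have := up_cases (4 * k + 4); omega
    have f4 : Fx n p α 0 (4 * k + 3) := by
      have := fx_right n p hn hne α 0 (4 * k + 2) f3
        (by rwa [show (4 * k + 2 - 1 : ℤ) = 4 * k + 1 by ring]) (by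
        intro w h1 h2 h3
        rw [u2.1] at h1; rw [u2.2] at h2
        rw [show (4 * k + 2 + 1 : ℤ) = 4 * k + 3 by ring] at h3
        rw [show (4 * k + 2 + -1 : ℤ) = 4 * k + 1 by ring] at h2
        have hw : w = (w.1, ((4 * k + 1 : ℤ) : ZMod (2 * n))) := Prod.ext rfl h2
        -- common neighbour
        have a1 : (AT n p).Adj (α (0, ((4 * k + 3 : ℤ) : ZMod (2 * n))))
            (w.1, ((4 * k : ℤ) : ZMod (2 * n))) := by
          rw [h3, hw, adj_iff n p hn2 hne]
          exact Or.inr (Or.inl ⟨rfl, by rw [add_sub_cancel_right]⟩)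
        have a2 : (AT n p).Adj (α (0, ((4 * k - 1 : ℤ) : ZMod (2 * n))))
            (w.1, ((4 * k : ℤ) : ZMod (2 * n))) := by
          rw [f0, adj_iff n p hn2 hne]
          have : up (4 * k - 1) = 1 ∧ sg (4 * k - 1) = 1 := by
            have := up_cases (4 * k - 1); omega
          right; right
          rw [this.1, this.2]
          exact ⟨by simpa using h1, by rw [sub_add_cancel]⟩
        obtain ⟨c, hc⟩ := α.surjective (w.1, ((4 * k : ℤ) : ZMod (2 * n)))
        rw [← hc] at a1 a2
        have a1 := α.map_rel_iff.1 a1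
        have a2 := α.map_rel_iff.1 a2
        rw [adj_iff n p hn2 hne] at a1 a2
        have sgc : ∀ j : ℤ, sg j = 1 ∨ sg j = -1 := by intro j; have := up_cases j; omega
        have b1 : c.2 = ((4 * k + 4 : ℤ) : ZMod (2 * n)) ∨
            c.2 = ((4 * k + 2 : ℤ) : ZMod (2 * n)) := by
          rcases a1 with a1 | a1 | a1
          · left; rw [a1.2]; congr 1
          · right; rw [a1.2]; congr 1; ring
          · left; rw [a1.2, u3.2]; congr 1
        have b2 : c.2 = ((4 * k : ℤ) : ZMod (2 * n)) ∨
            c.2 = ((4 * k - 2 : ℤ) : ZMod (2 * n)) := by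
          rcases a2 with a2 | a2 | a2
          · left; rw [a2.2]; congr 1; ring
          · right; rw [a2.2]; congr 1; ring
          · rcases sgc (4 * k - 1) with e | e <;> rw [e] at a2
            · left; rw [a2.2]; congr 1; ring
            · right; rw [a2.2]; congr 1; ring
        rcases b1 with b1 | b1 <;> rcases b2 with b2 | b2 <;>
          exact cast_ne n _ _ (by omega) (by omega) (b1.symm.trans b2))
      rwa [show (4 * k + 2 + 1 : ℤ) = 4 * k + 3 by ring] at this
    have f5 : Fx n p α 0 (4 * k + 4) := by
      have := fx_right n p hn hne α 0 (4 * k + 3) f4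
        (by rwa [show (4 * k + 3 - 1 : ℤ) = 4 * k + 2 by ring]) (by
        intro w h1 h2 h3
        rw [show (4 * k + 3 + 1 : ℤ) = 4 * k + 4 by ring] at h3
        rw [u3.1] at h1; rw [u3.2] at h2
        rw [show (4 * k + 3 + 1 : ℤ) = 4 * k + 4 by ring] at h2
        have hw : w = (w.1, ((4 * k + 4 : ℤ) : ZMod (2 * n))) := Prod.ext rfl h2
        have hP : P3 (AT n p) w := by
          rw [hw, P3_AT n p hn2 hne, u4, h1]; simp
        rw [← h3, P3_iff, P3_AT n p hn2 hne, u4] at hP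
        simp at hP)
      rwa [show (4 * k + 3 + 1 : ℤ) = 4 * k + 4 by ring] at this
    have f6 := base (k + 1) (by rwa [show (4 * (k + 1) : ℤ) = 4 * k + 4 by ring])
      (by rwa [show (4 * (k + 1) - 1 : ℤ) = 4 * k + 3 by ring])
    refine ⟨?_, ?_, ?_, ?_⟩
    · rwa [show (4 * ((k + 1 : ℕ) : ℤ) - 1 : ℤ) = 4 * k + 3 by push_cast; ring]
    · rwa [show (4 * ((k + 1 : ℕ) : ℤ) : ℤ) = 4 * k + 4 by push_cast; ring]
    · push_cast; exact f6.1
    · push_cast; exact f6.2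

lemma fx_bottom_all (h0 : Fx n p α 0 0) (j : ℤ) : Fx n p α 0 j := by
  have h := fx_bottom n p hn hne hp α h0
  have hnat : ∀ m : ℕ, Fx n p α 0 m := by
    intro m
    have h1 := h (m / 4)
    have h2 := h (m / 4 + 1)
    have : (m : ℤ) = 4 * ((m / 4 : ℕ) : ℤ) ∨ (m : ℤ) = 4 * ((m / 4 : ℕ) : ℤ) + 1 ∨
      (m : ℤ) = 4 * ((m / 4 : ℕ) : ℤ) + 2 ∨ (m : ℤ) = 4 * ((m / 4 + 1 : ℕ) : ℤ) - 1 := by omega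
    rcases this with e | e | e | e <;> rw [e]
    · exact h1.2.1
    · exact h1.2.2.1
    · exact h1.2.2.2
    · exact h2.1
  have hz : NeZero (2 * n) := ⟨by omega⟩
  have := hnat (j : ZMod (2 * n)).val
  unfold Fx at *
  rwa [Int.cast_natCast, ZMod.natCast_zmod_val] at this

lemma fx_all (h0 : Fx n p α 0 0) : ∀ (k : ℕ) (hk : k < p + 1) (j : ℤ), Fx n p α ⟨k, hk⟩ j := by
  intro k
  induction k with
  | zero => intro hk j; exact fx_bottom_all n p hn hne hp α h0 j
  | succ k ih =>
    intro hk
    have ih := ih (by omega)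
    have low : ∀ j : ℤ, j % 4 < 2 → Fx n p α ⟨k + 1, hk⟩ j := by
      intro j hj
      have hu := up_cases j
      have hu' := up_cases (j + sg j)
      have := fx_vert n p hn hne α ⟨k, by omega⟩ ⟨k + 1, hk⟩ (j + sg j) (ih _) (ih _) (ih _)
        (by simp only; push_cast; omega)
      rwa [show j + sg j + sg (j + sg j) = j by omega] at this
    intro j
    by_cases hj : j % 4 < 2
    · exact low j hj
    · have excl : ∀ j' : ℤ, up j' = -1 → ∀ j'' : ℤ, ∀ w : Fin (p + 1) × ZMod (2 * n),
          (w.1 : ℤ) = ((⟨k + 1, hk⟩ : Fin (p + 1)) : ℕ) + up j' → 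
          α (⟨k + 1, hk⟩, (j'' : ZMod (2 * n))) ≠ w := by
        intro j' hu j'' w hw h3
        obtain ⟨i, y⟩ := w
        obtain ⟨l, rfl⟩ := lift n y
        have hk0 : k < p + 1 := by omega
        have hi : i = ⟨k, hk0⟩ := by
          apply Fin.ext; simp only at hw ⊢; push_cast at hw; omega
        rw [hi] at h3
        have := α.injective (h3.trans (ih l).symm)
        have := (Prod.ext_iff.1 this).1
        simp at this
      by_cases hj2 : j % 4 = 2
      · have hu := up_cases (j - 1)
        have := fx_right n p hn hne α ⟨k + 1, hk⟩ (j - 1) (low _ (by omega)) (low _ (by omega))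
          (fun w h1 _ => excl (j - 1) (by omega) _ w h1)
        rwa [sub_add_cancel] at this
      · have hu := up_cases (j + 1)
        have := fx_left n p hn hne α ⟨k + 1, hk⟩ (j + 1) (low _ (by omega)) (low _ (by omega))
          (fun w h1 _ => excl (j + 1) (by omega) _ w h1)
        rwa [add_sub_cancel_right] at this

lemma rigid (h0 : Fx n p α 0 0) : α = 1 := by
  ext v
  · obtain ⟨⟨k, hk⟩, y⟩ := v
    obtain ⟨j, rfl⟩ := lift n y
    have := fx_all n p hn hne hp α h0 k hk j
    unfold Fx at this
    rw [this]; rfl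
  · obtain ⟨⟨k, hk⟩, y⟩ := v
    obtain ⟨j, rfl⟩ := lift n y
    have := fx_all n p hn hne hp α h0 k hk j
    unfold Fx at this
    rw [this]; rfl

end rigid

end ATP

namespace ATP

section final

variable (n p : ℕ) (hn : 5 ≤ n) (hn2 : 2 ≤ n) (hne : Even n) (hp : 1 ≤ p)

include hn hp in
lemma A_surj (α : AT n p ≃g AT n p) : ∃ x : ZMod (2 * n), A n p hn2 hne (x.val : ℤ) = α := by
  have hz : NeZero (2 * n) := ⟨by omega⟩
  obtain ⟨i, y, hα⟩ : ∃ i y, α (0, ((0 : ℤ) : ZMod (2 * n))) = (i, y) := ⟨_, _, rfl⟩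
  refine ⟨y, ?_⟩
  have hy : (((y.val : ℕ) : ℤ) : ZMod (2 * n)) = y := by
    rw [Int.cast_natCast, ZMod.natCast_zmod_val]
  have hP : ¬ P3 (AT n p) (α (0, ((0 : ℤ) : ZMod (2 * n)))) := by
    rw [P3_iff, P3_AT n p hn2 hne]
    have : up 0 = -1 := by have := up_cases 0; omega
    rw [this]; simp
  rw [hα, ← hy, P3_AT n p hn2 hne] at hP
  have hA : A n p hn2 hne (y.val : ℤ) (0, ((0 : ℤ) : ZMod (2 * n))) = (i, y) := by
    rw [A_apply, pos_zero, hy]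
    refine Prod.ext (Fin.ext ?_) rfl
    have h1 := flipL_val p (y.val : ℤ) 0
    have hu := up_cases (y.val : ℤ)
    have hi := i.2
    simp only
    rw [← Int.natCast_inj, h1]
    split_ifs with h2
    · simp; omega
    · simp; omega
  have hF : Fx n p ((A n p hn2 hne (y.val : ℤ))⁻¹ * α) 0 0 := by
    unfold Fx
    rw [RelIso.mul_apply, hα, ← hA, RelIso.inv_apply_self]
  have := rigid n p hn hne hp _ hF
  rw [inv_mul_eq_one] at this
  exact this

lemma A_inj (x y : ZMod (2 * n)) (h : A n p hn2 hne (x.val : ℤ) = A n p hn2 hne (y.val : ℤ)) :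
    x = y := by
  have hz : NeZero (2 * n) := ⟨by omega⟩
  have h1 := congrArg (fun β : AT n p ≃g AT n p => (β (0, ((0 : ℤ) : ZMod (2 * n)))).2) h
  simp only [A_apply, pos_zero, Int.cast_natCast, ZMod.natCast_zmod_val] at h1
  exact h1

/-- The automorphism group is parametrised by `ℤ/2n`. -/
noncomputable def eqv : ZMod (2 * n) ≃ (AT n p ≃g AT n p) :=
  Equiv.ofBijective (fun x : ZMod (2 * n) => A n p hn2 hne (x.val : ℤ))
    ⟨fun x y h => A_inj n p hn2 hne x y h, fun α => A_surj n p hn hn2 hne hp α⟩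

/-- Vertices are parametrised by layer and automorphism index. -/
lemma orb_bij : Function.Bijective (fun q : Fin (p + 1) × ZMod (2 * n) =>
    A n p hn2 hne (q.2.val : ℤ) (q.1, ((0 : ℤ) : ZMod (2 * n)))) := by
  have hz : NeZero (2 * n) := ⟨by omega⟩
  rw [← Finite.injective_iff_bijective]
  rintro ⟨i, x⟩ ⟨i', x'⟩ h
  simp only [A_apply, pos_zero, Int.cast_natCast, ZMod.natCast_zmod_val, Prod.mk.injEq] at h
  obtain ⟨h1, rfl⟩ := h
  have := congrArg (flipL p (x.val : ℤ)) h1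
  rw [flipL_flipL _ _ _ Iff.rfl, flipL_flipL _ _ _ Iff.rfl] at this
  rw [this]

lemma dist_iso {V : Type*} (G : SimpleGraph V) (β : G ≃g G) (hG : G.Connected) (u v : V) :
    G.dist (β u) (β v) = G.dist u v := by
  have key : ∀ (γ : G ≃g G) (u v : V), G.dist (γ u) (γ v) ≤ G.dist u v := by
    intro γ u v
    obtain ⟨w, hw⟩ := hG.exists_walk_length_eq_dist u v
    rw [← hw, ← SimpleGraph.Walk.length_map γ.toHom w]
    exact SimpleGraph.dist_le _
  apply le_antisymm (key β u v)
  have := key β.symm (β u) (β v)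
  simpa using this

lemma layer_sum (hgt : 4 * p + 4 < n) [NeZero (2 * n)] (i : Fin (p + 1)) :
    ∑ x : ZMod (2 * n), ((AT n p).dist (i, ((0 : ℤ) : ZMod (2 * n)))
      (A n p hn2 hne (x.val : ℤ) (i, ((0 : ℤ) : ZMod (2 * n)))) : ℤ) =
      (n : ℤ) ^ 2 + 4 * ((p : ℤ) - 2 * i) * ((p : ℤ) - 2 * i + 1) := by
  have hi := i.2
  rw [← sum_abs n, ← sum_ex n p ((p : ℤ) - 2 * i) (by omega) hgt, ← Finset.sum_add_distrib]
  symm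
  refine Finset.sum_bij (fun (y : ℤ) _ => (y : ZMod (2 * n))) (fun _ _ => Finset.mem_univ _)
    ?_ ?_ ?_
  · intro a ha b hb hab
    rw [Finset.mem_Ico] at ha hb
    by_contra hne'
    exact cast_ne n a b (by omega) hne' hab
  · intro x _
    have hx := ZMod.val_lt x
    have hv : (((x.val : ℕ) : ℤ) : ZMod (2 * n)) = x := by
      rw [Int.cast_natCast, ZMod.natCast_zmod_val]
    by_cases hxn : x.val < n
    · exact ⟨x.val, by rw [Finset.mem_Ico]; omega, hv⟩
    · refine ⟨(x.val : ℤ) - (2 * n : ℕ), by rw [Finset.mem_Ico]; omega, ?_⟩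
      rw [Int.cast_sub, hv, Int.cast_natCast, ZMod.natCast_self, sub_zero]
  · intro y hy
    rw [Finset.mem_Ico] at hy
    have hv : ((((y : ZMod (2 * n)).val : ℕ) : ℤ) : ZMod (2 * n)) = (y : ZMod (2 * n)) := by
      rw [Int.cast_natCast, ZMod.natCast_zmod_val]
    have hm := cast_mod n hn2 hne _ _ hv
    rw [A_apply, pos_zero, hv]
    have hf := flipL_val p ((y : ZMod (2 * n)).val : ℤ) i
    rw [hm] at hf
    generalize flipL p ((y : ZMod (2 * n)).val : ℤ) i = i' at hf ⊢
    by_cases h4 : 2 ≤ y % 4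
    · rw [if_pos h4] at hf
      have hd : (i' : ℤ) - i = (p : ℤ) - 2 * i := by omega
      have hD := D_ex ((p : ℤ) - 2 * i) y h4
      have hDn : D ((i' : ℤ) - i) 0 y ≤ n := by
        rw [hd]; zify; rw [hD]; unfold ex; rw [if_pos h4]; omega
      rw [dist_eq n p hn2 hne i i' y (by omega) hDn, hd, hD]
    · rw [if_neg h4] at hf
      have hd : (i' : ℤ) - i = 0 := by omega
      have hD := D_same y
      have hDn : D ((i' : ℤ) - i) 0 y ≤ n := by
        rw [hd]; zify; rw [hD]; omega
      rw [dist_eq n p hn2 hne i i' y (by omega) hDn, hd, hD]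
      unfold ex; rw [if_neg h4, add_zero]

lemma sum_sq (p : ℕ) (c : ℚ) : ∀ k : ℕ, ∑ i ∈ Finset.range k,
    (c + 4 * ((p : ℚ) - 2 * i) * ((p : ℚ) - 2 * i + 1)) =
      k * c + 4 * (k * p * (p + 1) - (4 * p + 2) * (k * (k - 1) / 2) +
        4 * ((k - 1) * k * (2 * k - 1) / 6)) := by
  intro k
  induction k with
  | zero => simp
  | succ k ih => rw [Finset.sum_range_succ, ih]; push_cast; ring

end final

end ATP

theorem stmt13 (n p : ℕ) (hn : 2 ≤ n) (hne : Even n) (hp : 1 ≤ p) (hgt : 4 * p + 4 < n) :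
    GPindex (AT n p) =
      ((p : ℚ) + 1) * ((n : ℚ) ^ 3 * (p : ℚ) + (n : ℚ) ^ 3 + 4 * (n : ℚ) * (p : ℚ) ^ 3 / 3 +
        4 * (n : ℚ) * (p : ℚ) ^ 2 + 8 * (n : ℚ) * (p : ℚ) / 3) := by
  have hn5 : 5 ≤ n := by omega
  have hz : NeZero (2 * n) := ⟨by omega⟩
  let e := ATP.eqv n p hn5 hn hne hp
  let _ : Fintype (AT n p ≃g AT n p) := Fintype.ofEquiv _ e
  have hcard : Nat.card (AT n p ≃g AT n p) = 2 * n := by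
    rw [← Nat.card_congr e, Nat.card_zmod]
  have hV : Nat.card (Fin (p + 1) × ZMod (2 * n)) = (p + 1) * (2 * n) := by
    rw [Nat.card_prod, Nat.card_zmod, Nat.card_fin]
  unfold GPindex
  rw [hcard, hV, finsum_eq_sum_of_fintype]
  simp only [finsum_eq_sum_of_fintype]
  have hc := ATP.conn n p hn hne
  have hconj : ∀ (β : AT n p ≃g AT n p) (u : Fin (p + 1) × ZMod (2 * n)),
      ∑ α : AT n p ≃g AT n p, ((AT n p).dist (β u) (α (β u)) : ℚ) =
      ∑ α : AT n p ≃g AT n p, ((AT n p).dist u (α u) : ℚ) := by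
    intro β u
    rw [← Equiv.sum_comp (MulAut.conj β).toEquiv]
    refine Finset.sum_congr rfl fun α _ => ?_
    have : (MulAut.conj β).toEquiv α (β u) = β (α u) := by
      change (β * α * β⁻¹) (β u) = _
      rw [RelIso.mul_apply, RelIso.mul_apply, RelIso.inv_apply_self]
    rw [this, ATP.dist_iso _ β hc]
  have hlay : ∀ i : Fin (p + 1),
      ∑ α : AT n p ≃g AT n p, ((AT n p).dist (i, ((0 : ℤ) : ZMod (2 * n)))
        (α (i, ((0 : ℤ) : ZMod (2 * n)))) : ℚ) =
      (n : ℚ) ^ 2 + 4 * ((p : ℚ) - 2 * (i : ℕ)) * ((p : ℚ) - 2 * (i : ℕ) + 1) := by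
    intro i
    rw [← Equiv.sum_comp e]
    have := congrArg (Int.cast : ℤ → ℚ) (ATP.layer_sum n p hn hne hgt i)
    have he : ∀ x : ZMod (2 * n), e x = ATP.A n p hn hne (x.val : ℤ) := fun _ => rfl
    simp only [he]
    rw [Int.cast_sum] at this
    simp only [Int.cast_natCast] at this ⊢
    rw [this]
    push_cast
    ring
  have hsum : ∑ u : Fin (p + 1) × ZMod (2 * n), ∑ α : AT n p ≃g AT n p,
      ((AT n p).dist u (α u) : ℚ) = 2 * n * ∑ i : Fin (p + 1),
      ((n : ℚ) ^ 2 + 4 * ((p : ℚ) - 2 * (i : ℕ)) * ((p : ℚ) - 2 * (i : ℕ) + 1)) := by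
    rw [← (ATP.orb_bij n p hn hne).sum_comp]
    simp only [hconj, hlay]
    rw [Fintype.sum_prod_type, Finset.mul_sum]
    refine Finset.sum_congr rfl fun i _ => ?_
    simp only
    rw [Finset.sum_const, Finset.card_univ, ZMod.card, nsmul_eq_mul]
    push_cast; ring
  rw [hsum, Fin.sum_univ_eq_sum_range
    (fun i : ℕ => (n : ℚ) ^ 2 + 4 * ((p : ℚ) - 2 * (i : ℕ)) * ((p : ℚ) - 2 * (i : ℕ) + 1)),
    ATP.sum_sq]
  have hn0 : (n : ℚ) ≠ 0 := by exact_mod_cast (by omega : n ≠ 0)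
  push_cast
  field_simp
  ring
end

section
/- Let p ≥ 3 be an integer and let n = 4p + 4. Then the Graovac–Pisanski index of AT(n,p) satisfies Ŵ(AT(n,p)) = (p+1)·(n³p + (3n³)/4 + 2n²p + n² + (4np³)/3 − (4np)/3). -/
open SimpleGraph

/-- One step in the integer (unrolled) hexagonal lattice. -/
def HStep (i j i' j' : ℤ) : Prop :=
  (i' = i ∧ (j' = j + 1 ∨ j' = j - 1)) ∨
  (i' = i + 1 ∧ ((j % 4 = 2 ∧ j' = j - 1) ∨ (j % 4 = 3 ∧ j' = j + 1))) ∨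
  (i = i' + 1 ∧ ((j % 4 = 1 ∧ j' = j + 1) ∨ (j % 4 = 0 ∧ j' = j - 1)))

/-- The distance in the hexagonal lattice. -/
def hexd (i j i' j' : ℤ) : ℤ :=
  |i' - i + ((j' + 2) / 4 - (j + 2) / 4)| + |i' - i - (j' / 4 - j / 4)| +
    |(j' + 1) / 2 - (j + 1) / 2|

lemma hexd_lip {i j i1 j1 i2 j2 : ℤ} (h : HStep i1 j1 i2 j2) :
    hexd i j i2 j2 ≤ hexd i j i1 j1 + 1 := by
  unfold hexd
  unfold HStep at h
  simp only [abs_eq_max_neg]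
  generalize (j + 2) / 4 = a
  generalize j / 4 = b
  generalize (j + 1) / 2 = c
  have key : ((i2 + (j2 + 2) / 4 - (i1 + (j1 + 2) / 4)) = 0 ∧ (i2 - j2 / 4 - (i1 - j1 / 4)) = 0 ∧
        ((j2 + 1) / 2 - (j1 + 1) / 2 = 1 ∨ (j2 + 1) / 2 - (j1 + 1) / 2 = - 1)) ∨
      ((i2 - j2 / 4 - (i1 - j1 / 4)) = 0 ∧ ((j2 + 1) / 2 - (j1 + 1) / 2 = 0) ∧
        ((i2 + (j2 + 2) / 4 - (i1 + (j1 + 2) / 4)) = 1 ∨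
          (i2 + (j2 + 2) / 4 - (i1 + (j1 + 2) / 4)) = -1)) ∨
      ((i2 + (j2 + 2) / 4 - (i1 + (j1 + 2) / 4)) = 0 ∧ ((j2 + 1) / 2 - (j1 + 1) / 2 = 0) ∧
        ((i2 - j2 / 4 - (i1 - j1 / 4)) = 1 ∨ (i2 - j2 / 4 - (i1 - j1 / 4)) = -1)) := by
    omega
  generalize (j2 + 2) / 4 = a2 at *
  generalize j2 / 4 = b2 at *
  generalize (j2 + 1) / 2 = c2 at *
  generalize (j1 + 2) / 4 = a1 at *
  generalize j1 / 4 = b1 at *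
  generalize (j1 + 1) / 2 = c1 at *
  clear h
  omega

lemma hexd_nonneg (i j i' j' : ℤ) : 0 ≤ hexd i j i' j' := by
  unfold hexd; positivity

lemma hexd_self (i j : ℤ) : hexd i j i j = 0 := by
  simp [hexd]

lemma hexd_eq_zero {i j i' j' : ℤ} (h : hexd i j i' j' = 0) : i' = i ∧ j' = j := by
  unfold hexd at h
  simp only [abs_eq_max_neg] at h
  omega

lemma hexd_ge (i j i' j' : ℤ) : |j' - j| ≤ hexd i j i' j' := by
  unfold hexd
  simp only [abs_eq_max_neg]
  omega

/-- An auxiliary fact: moving one coordinate towards its target decreases the sum. -/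
lemma abs_step {x y z x' y' z' : ℤ}
    (h : (x' = x ∧ y' = y ∧ ((z < 0 ∧ z' = z + 1) ∨ (0 < z ∧ z' = z - 1))) ∨
      (x' = x ∧ z' = z ∧ ((y < 0 ∧ y' = y + 1) ∨ (0 < y ∧ y' = y - 1))) ∨
      (y' = y ∧ z' = z ∧ ((x < 0 ∧ x' = x + 1) ∨ (0 < x ∧ x' = x - 1)))) :
    |x'| + |y'| + |z'| + 1 = |x| + |y| + |z| := by
  simp only [abs_eq_max_neg]
  omega

set_option maxHeartbeats 1000000 in
/-- descending neighbour -/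
lemma hexd_desc (p : ℤ) {i j i' j' : ℤ} (hi : 0 ≤ i) (hip : i ≤ p) (hi' : 0 ≤ i') (hip' : i' ≤ p)
    (h : hexd i j i' j' ≠ 0) :
    ∃ i2 j2, HStep i' j' i2 j2 ∧ 0 ≤ i2 ∧ i2 ≤ p ∧ hexd i j i2 j2 + 1 = hexd i j i' j' := by
  have hne : ¬ (i' = i ∧ j' = j) := by
    rintro ⟨rfl, rfl⟩
    exact h (hexd_self _ _)
  clear h
  have hm : j' % 4 = 0 ∨ j' % 4 = 1 ∨ j' % 4 = 2 ∨ j' % 4 = 3 := by omega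
  unfold hexd HStep
  rcases hm with hm | hm | hm | hm
  · by_cases hz : (j' + 1) / 2 - (j + 1) / 2 < 0
    · exact ⟨i', j' + 1, by omega, by omega, by omega, abs_step (Or.inl ⟨by omega, by omega, by omega⟩)⟩
    by_cases hy : i' - i - (j' / 4 - j / 4) < 0
    · exact ⟨i', j' - 1, by omega, by omega, by omega, abs_step (Or.inr (Or.inl ⟨by omega, by omega, by omega⟩))⟩
    · exact ⟨i' - 1, j' - 1, by omega, by omega, by omega, abs_step (Or.inr (Or.inr ⟨by omega, by omega, by omega⟩))⟩
  · by_cases hz : 0 < (j' + 1) / 2 - (j + 1) / 2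
    · exact ⟨i', j' - 1, by omega, by omega, by omega, abs_step (Or.inl ⟨by omega, by omega, by omega⟩)⟩
    by_cases hy : i' - i + ((j' + 2) / 4 - (j + 2) / 4) < 0
    · exact ⟨i', j' + 1, by omega, by omega, by omega, abs_step (Or.inr (Or.inr ⟨by omega, by omega, by omega⟩))⟩
    · exact ⟨i' - 1, j' + 1, by omega, by omega, by omega, abs_step (Or.inr (Or.inl ⟨by omega, by omega, by omega⟩))⟩
  · by_cases hz : (j' + 1) / 2 - (j + 1) / 2 < 0
    · exact ⟨i', j' + 1, by omega, by omega, by omega, abs_step (Or.inl ⟨by omega, by omega, by omega⟩)⟩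
    by_cases hy : 0 < i' - i + ((j' + 2) / 4 - (j + 2) / 4)
    · exact ⟨i', j' - 1, by omega, by omega, by omega, abs_step (Or.inr (Or.inr ⟨by omega, by omega, by omega⟩))⟩
    · exact ⟨i' + 1, j' - 1, by omega, by omega, by omega, abs_step (Or.inr (Or.inl ⟨by omega, by omega, by omega⟩))⟩
  · by_cases hz : 0 < (j' + 1) / 2 - (j + 1) / 2
    · exact ⟨i', j' - 1, by omega, by omega, by omega, abs_step (Or.inl ⟨by omega, by omega, by omega⟩)⟩
    by_cases hy : 0 < i' - i - (j' / 4 - j / 4)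
    · exact ⟨i', j' + 1, by omega, by omega, by omega, abs_step (Or.inr (Or.inl ⟨by omega, by omega, by omega⟩))⟩
    · exact ⟨i' + 1, j' + 1, by omega, by omega, by omega, abs_step (Or.inr (Or.inr ⟨by omega, by omega, by omega⟩))⟩

lemma val_mod4 {n : ℕ} (hn0 : 0 < n) (hn : 4 ∣ n) (j : ℤ) :
    (((j : ZMod (2 * n)).val : ℕ) : ℤ) % 4 = j % 4 := by
  have : NeZero (2 * n) := ⟨by omega⟩
  rw [ZMod.val_intCast]
  apply Int.emod_emod_of_dvd
  exact_mod_cast hn.mul_left 2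

lemma exists_lift_s14 {n : ℕ} (x : ZMod (2 * n)) : ∃ j : ℤ, (j : ZMod (2 * n)) = x :=
  ZMod.intCast_surjective x

lemma adj_lift {n p : ℕ} (hn0 : 0 < n) (hn : 4 ∣ n) {i : Fin (p + 1)} {j : ℤ}
    {v : Fin (p + 1) × ZMod (2 * n)} (h : (AT n p).Adj (i, (j : ZMod (2 * n))) v) :
    ∃ j' : ℤ, v.2 = (j' : ZMod (2 * n)) ∧ HStep (i : ℕ) j (v.1 : ℕ) j' := by
  rw [AT, SimpleGraph.fromRel_adj] at h
  obtain ⟨hne, h⟩ := h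
  obtain ⟨i', x⟩ := v
  dsimp only at h hne ⊢
  have hv := val_mod4 hn0 hn j
  simp only [ATRel] at h
  rcases h with (⟨h1, h2⟩ | ⟨h1, ⟨h2, h3⟩ | ⟨h2, h3⟩⟩) | (⟨h1, h2⟩ | ⟨h1, ⟨h2, h3⟩ | ⟨h2, h3⟩⟩)
  · exact ⟨j + 1, by simp [h2], by subst h1; unfold HStep; omega⟩
  · exact ⟨j - 1, by simp [h3], by unfold HStep; omega⟩
  · exact ⟨j + 1, by simp [h3], by unfold HStep; omega⟩
  · exact ⟨j - 1, by simp [h2], by subst h1; unfold HStep; omega⟩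
  · have hx : x = ((j + 1 : ℤ) : ZMod (2 * n)) := by push_cast; rw [h3]; ring
    have hv2 := val_mod4 hn0 hn (j + 1)
    rw [← hx] at hv2
    exact ⟨j + 1, hx, by unfold HStep; omega⟩
  · have hx : x = ((j - 1 : ℤ) : ZMod (2 * n)) := by push_cast; rw [h3]; ring
    have hv2 := val_mod4 hn0 hn (j - 1)
    rw [← hx] at hv2
    exact ⟨j - 1, hx, by unfold HStep; omega⟩

lemma cast_ne {n : ℕ} (hn0 : 0 < n) (hn : 4 ∣ n) {j j' : ℤ} (h : j % 4 ≠ j' % 4) :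
    (j : ZMod (2 * n)) ≠ (j' : ZMod (2 * n)) := by
  intro he
  have h1 := val_mod4 hn0 hn j
  have h2 := val_mod4 hn0 hn j'
  rw [he] at h1
  omega

lemma adj_proj {n p : ℕ} (hn0 : 0 < n) (hn : 4 ∣ n) {i i' : Fin (p + 1)} {j j' : ℤ}
    (h : HStep (i : ℕ) j (i' : ℕ) j') :
    (AT n p).Adj (i, (j : ZMod (2 * n))) (i', (j' : ZMod (2 * n))) := by
  rw [AT, SimpleGraph.fromRel_adj]
  have hv := val_mod4 hn0 hn j
  have hv' := val_mod4 hn0 hn j'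
  have hj : j' = j + 1 ∨ j' = j - 1 := by unfold HStep at h; omega
  constructor
  · intro he
    exact cast_ne hn0 hn (show j % 4 ≠ j' % 4 by omega) (Prod.mk.inj he).2
  · unfold HStep at h
    simp only [ATRel]
    rcases h with ⟨h1, rfl | rfl⟩ | ⟨h1, ⟨h2, rfl⟩ | ⟨h2, rfl⟩⟩ | ⟨h1, ⟨h2, rfl⟩ | ⟨h2, rfl⟩⟩
    · left; left; exact ⟨Fin.ext (by omega), by push_cast; rfl⟩
    · right; left; exact ⟨Fin.ext (by omega), by push_cast; ring⟩
    · left; right; exact ⟨by omega, Or.inl ⟨by omega, by push_cast; rfl⟩⟩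
    · left; right; exact ⟨by omega, Or.inr ⟨by omega, by push_cast; rfl⟩⟩
    · right; right; exact ⟨by omega, Or.inl ⟨by omega, by push_cast; ring⟩⟩
    · right; right; exact ⟨by omega, Or.inr ⟨by omega, by push_cast; ring⟩⟩

lemma walk_lower_s14 {n p : ℕ} (hn0 : 0 < n) (hn : 4 ∣ n) (i : ℤ) (j : ℤ)
    {u v : Fin (p + 1) × ZMod (2 * n)} (W : (AT n p).Walk u v) :
    ∀ j1 : ℤ, (j1 : ZMod (2 * n)) = u.2 →
    ∃ j' : ℤ, (j' : ZMod (2 * n)) = v.2 ∧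
      hexd i j (v.1 : ℕ) j' ≤ hexd i j (u.1 : ℕ) j1 + W.length := by
  induction W with
  | nil => intro j1 h; exact ⟨j1, h, by simp⟩
  | @cons a b c hab W ih =>
    intro j1 h
    have hab' : (AT n p).Adj (a.1, (j1 : ZMod (2 * n))) b := by rw [h]; exact hab
    obtain ⟨j2, hj2, hs⟩ := adj_lift hn0 hn hab'
    obtain ⟨j3, hj3, hl⟩ := ih j2 hj2.symm
    refine ⟨j3, hj3, ?_⟩
    have := hexd_lip (i := i) (j := j) hs
    rw [SimpleGraph.Walk.length_cons]
    push_cast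
    linarith

lemma walk_upper_s14 {n p : ℕ} (hn0 : 0 < n) (hn : 4 ∣ n) (i : Fin (p + 1)) (j : ℤ) (m : ℕ) :
    ∀ (i' : Fin (p + 1)) (j' : ℤ), hexd (i : ℕ) j (i' : ℕ) j' = m →
    ∃ W : (AT n p).Walk (i', (j' : ZMod (2 * n))) (i, (j : ZMod (2 * n))), W.length = m := by
  induction m with
  | zero =>
    intro i' j' h
    obtain ⟨h1, h2⟩ := hexd_eq_zero (by simpa using h)
    have h1 : i' = i := Fin.ext (by exact_mod_cast h1)
    subst h1 h2
    exact ⟨SimpleGraph.Walk.nil, rfl⟩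
  | succ m ih =>
    intro i' j' h
    obtain ⟨i2, j2, hs, h0, hp, hd⟩ := hexd_desc (p : ℤ) (i := (i : ℕ)) (j := j) (i' := (i' : ℕ))
      (j' := j') (by omega) (by omega) (by omega) (by omega) (by omega)
    lift i2 to ℕ using h0
    obtain ⟨W, hW⟩ := ih ⟨i2, by omega⟩ j2 (by simp only; push_cast at h; linarith)
    exact ⟨SimpleGraph.Walk.cons (adj_proj hn0 hn (i' := ⟨i2, by omega⟩) hs) W, by simp [hW]⟩

lemma hexd_min (p : ℤ) {i j i' j' : ℤ} (hi : 0 ≤ i) (hip : i ≤ p) (hi' : 0 ≤ i') (hip' : i' ≤ p)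
    (h1 : -(4 * p + 4) ≤ j' - j) (h2 : j' - j ≤ 4 * p + 4) (t : ℤ) :
    hexd i j i' j' ≤ hexd i j i' (j' + (8 * p + 8) * t) := by
  rcases eq_or_ne t 0 with rfl | ht
  · simp
  refine le_trans ?_ (hexd_ge _ _ _ _)
  have h3 : hexd i j i' j' ≤ 4 * p + 4 := by
    unfold hexd
    simp only [abs_eq_max_neg]
    omega
  refine h3.trans ?_
  rcases lt_or_gt_of_ne ht with ht | ht
  · have : (8 * p + 8) * t ≤ -(8 * p + 8) := by nlinarith
    rw [abs_eq_max_neg]; omega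
  · have : (8 * p + 8) ≤ (8 * p + 8) * t := by nlinarith
    rw [abs_eq_max_neg]; omega

lemma dist_eq_s14 {n p : ℕ} (hn : n = 4 * p + 4) (i i' : Fin (p + 1)) (j j' : ℤ)
    (h1 : -(4 * p + 4) ≤ j' - j) (h2 : j' - j ≤ 4 * p + 4) :
    ((AT n p).dist (i, (j : ZMod (2 * n))) (i', (j' : ZMod (2 * n))) : ℤ) =
      hexd (i : ℕ) j (i' : ℕ) j' := by
  have hn0 : 0 < n := by omega
  have hn4 : 4 ∣ n := by omega
  obtain ⟨m, hm⟩ := Int.eq_ofNat_of_zero_le (hexd_nonneg (i : ℕ) j (i' : ℕ) j')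
  obtain ⟨W, hW⟩ := walk_upper_s14 hn0 hn4 i j m i' j' hm
  apply le_antisymm
  · rw [hm, SimpleGraph.dist_comm, ← hW]
    exact_mod_cast SimpleGraph.dist_le W
  · obtain ⟨W', hW'⟩ := (W.reachable.symm).exists_walk_length_eq_dist
    obtain ⟨j3, hj3, hl⟩ := walk_lower_s14 hn0 hn4 (i : ℕ) j W' j rfl
    rw [hexd_self, hW'] at hl
    simp only at hj3 hl
    rw [eq_comm, ZMod.intCast_eq_intCast_iff_dvd_sub] at hj3
    obtain ⟨t, ht⟩ := hj3
    have := hexd_min (p : ℤ) (i := (i : ℕ)) (j := j) (i' := (i' : ℕ))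
      (j' := j') (by omega) (by omega) (by omega) (by omega) h1 h2 t
    have e : j3 = j' + (8 * p + 8) * t := by
      rw [hn] at ht; push_cast at ht; linarith
    rw [e] at hl
    linarith

lemma sum_abs_aux (a b : ℕ) :
    2 * ∑ x ∈ Finset.range (a + b), |(x : ℤ) - a| = a * (a + 1) + b * (b - 1) := by
  induction b with
  | zero =>
    induction a with
    | zero => simp
    | succ a ih =>
      simp only [add_zero] at ih ⊢
      rw [Finset.sum_range_succ']
      have : ∀ x ∈ Finset.range a, |((x + 1 : ℕ) : ℤ) - ((a + 1 : ℕ) : ℤ)| = |(x : ℤ) - a| := by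
        intro x _
        push_cast
        congr 1
        ring
      rw [Finset.sum_congr rfl this, mul_add, ih]
      have h2 : |((0 : ℕ) : ℤ) - ((a + 1 : ℕ) : ℤ)| = a + 1 := by
        rw [abs_eq_max_neg]; omega
      rw [h2]
      push_cast
      ring
  | succ b ih =>
    rw [← add_assoc, Finset.sum_range_succ, mul_add, ih]
    have h2 : |((a + b : ℕ) : ℤ) - (a : ℤ)| = b := by
      rw [abs_eq_max_neg]; omega
    rw [h2]
    push_cast
    ring

lemma sum_abs (N : ℕ) (m : ℤ) (h1 : -N ≤ m) (h2 : m ≤ N) :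
    ∑ x ∈ Finset.range (2 * N), |(x : ℤ) - N + m| = m ^ 2 - m + N ^ 2 := by
  obtain ⟨a, ha⟩ := Int.eq_ofNat_of_zero_le (show 0 ≤ (N : ℤ) - m by omega)
  obtain ⟨b, hb⟩ := Int.eq_ofNat_of_zero_le (show 0 ≤ (N : ℤ) + m by omega)
  have hab : 2 * N = a + b := by omega
  have h := sum_abs_aux a b
  rw [← hab] at h
  have : ∀ x ∈ Finset.range (2 * N), |(x : ℤ) - N + m| = |(x : ℤ) - a| := by
    intro x _
    congr 1
    omega
  rw [Finset.sum_congr rfl this]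
  have h3 : (a : ℤ) * (a + 1) + b * (b - 1) = 2 * (m ^ 2 - m + N ^ 2) := by
    rw [← ha, ← hb]; ring
  linarith

lemma sum_abs2 (N : ℕ) (γ : ℤ) (h1 : 0 ≤ γ) (h2 : γ ≤ 2) :
    ∑ x ∈ Finset.range (2 * N), |2 * (x : ℤ) - 2 * N + γ| = 2 * N ^ 2 := by
  have h0 := sum_abs N 0 (by omega) (by omega)
  rcases Nat.eq_zero_or_pos N with rfl | hN
  · simp
  have h1' := sum_abs N 1 (by omega) (by omega)
  obtain rfl | rfl | rfl : γ = 0 ∨ γ = 1 ∨ γ = 2 := by omega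
  · have : ∀ x ∈ Finset.range (2 * N), |2 * (x : ℤ) - 2 * N + 0| = 2 * |(x : ℤ) - N + 0| := by
      intro x _
      simp only [abs_eq_max_neg]; omega
    rw [Finset.sum_congr rfl this, ← Finset.mul_sum, h0]; ring
  · have : ∀ x ∈ Finset.range (2 * N), |2 * (x : ℤ) - 2 * N + 1| =
        |(x : ℤ) - N + 0| + |(x : ℤ) - N + 1| := by
      intro x _
      simp only [abs_eq_max_neg]; omega
    rw [Finset.sum_congr rfl this, Finset.sum_add_distrib, h0, h1']; ring
  · have : ∀ x ∈ Finset.range (2 * N), |2 * (x : ℤ) - 2 * N + 2| = 2 * |(x : ℤ) - N + 1| := by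
      intro x _
      simp only [abs_eq_max_neg]; omega
    rw [Finset.sum_congr rfl this, ← Finset.mul_sum, h1']; ring

lemma sum_shift (K : ℕ) (f : ℤ → ℤ) (hf : ∀ x, f (x + K) = f x) (m : ℤ) :
    ∑ x ∈ Finset.range K, f (x + m) = ∑ x ∈ Finset.range K, f x := by
  have step : ∀ m : ℤ, ∑ x ∈ Finset.range K, f (x + (m + 1)) = ∑ x ∈ Finset.range K, f (x + m) := by
    intro m
    have h1 := Finset.sum_range_succ (fun x : ℕ => f (x + m)) K
    have h2 := Finset.sum_range_succ' (fun x : ℕ => f (x + m)) K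
    have h3 : f (K + m) = f m := by rw [add_comm, hf]
    have h4 : ∀ x ∈ Finset.range K, f (((x + 1 : ℕ) : ℤ) + m) = f (x + (m + 1)) := by
      intro x _
      congr 1
      push_cast
      ring
    rw [Finset.sum_congr rfl h4] at h2
    rw [h3] at h1
    simp only [Nat.cast_zero, zero_add] at h2
    linarith
  induction m using Int.induction_on with
  | zero => simp
  | succ m ih => rw [step, ih]
  | pred m ih =>
    have := step (-(m : ℤ) - 1)
    rw [← this, ← ih]
    simp

lemma inner_dist_sum {n p : ℕ} (hn : n = 4 * p + 4) (i i' : Fin (p + 1)) (j c : ℤ) :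
    ∑ x ∈ Finset.range (2 * (p + 1)),
      ((AT n p).dist (i, (j : ZMod (2 * n))) (i', ((4 * (x : ℤ) + c : ℤ) : ZMod (2 * n))) : ℤ) =
    4 * (p + 1) ^ 2 + 2 * (((i' : ℕ) : ℤ) - (i : ℕ)) ^ 2 +
     2 * (((j + (c - j) % 4 + 2) / 4 - (j + 2) / 4) - ((j + (c - j) % 4) / 4 - j / 4)) *
      (((i' : ℕ) : ℤ) - (i : ℕ)) := by
  obtain ⟨e, he⟩ : ∃ e, e = (c - j) % 4 := ⟨_, rfl⟩
  obtain ⟨m, hm⟩ : ∃ m : ℤ, c = j - (4 * p + 4) + e + 4 * m :=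
    ⟨(c - j) / 4 + (p + 1), by omega⟩
  rw [← he]
  have e0 : 0 ≤ e := by omega
  have e3 : e ≤ 3 := by omega
  have hs := sum_shift (2 * (p + 1)) (fun x => ((AT n p).dist (i, (j : ZMod (2 * n)))
    (i', ((4 * x + (j - (4 * p + 4) + e) : ℤ) : ZMod (2 * n))) : ℤ)) (by
      intro x
      congr 3
      rw [ZMod.intCast_eq_intCast_iff_dvd_sub]
      exact ⟨-1, by rw [hn]; push_cast; ring⟩) m
  have h1 : ∀ x ∈ Finset.range (2 * (p + 1)), ((AT n p).dist (i, (j : ZMod (2 * n)))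
      (i', ((4 * (x : ℤ) + c : ℤ) : ZMod (2 * n))) : ℤ) = ((AT n p).dist (i, (j : ZMod (2 * n)))
    (i', ((4 * ((x : ℤ) + m) + (j - (4 * p + 4) + e) : ℤ) : ZMod (2 * n))) : ℤ) := by
    intro x _
    congr 4
    rw [hm]; ring
  rw [Finset.sum_congr rfl h1, hs]
  set α := (j + e + 2) / 4 - (j + 2) / 4 with hα
  set β := (j + e) / 4 - j / 4 with hβ
  set γ := (j + e + 1) / 2 - (j + 1) / 2 with hγ
  set k : ℤ := ((i' : ℕ) : ℤ) - (i : ℕ) with hk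
  have h2 : ∀ x ∈ Finset.range (2 * (p + 1)), ((AT n p).dist (i, (j : ZMod (2 * n)))
      (i', ((4 * (x : ℤ) + (j - (4 * p + 4) + e) : ℤ) : ZMod (2 * n))) : ℤ) =
      |(x : ℤ) - (p + 1 : ℕ) + (k + α)| + |(x : ℤ) - (p + 1 : ℕ) + (β - k)| +
        |2 * (x : ℤ) - 2 * (p + 1 : ℕ) + γ| := by
    intro x hx
    rw [Finset.mem_range] at hx
    rw [dist_eq_s14 hn i i' j _ (by omega) (by omega)]
    unfold hexd
    rw [abs_sub_comm (((i' : ℕ) : ℤ) - (i : ℕ))]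
    have t1 : ((i' : ℕ) : ℤ) - (i : ℕ) + ((4 * (x : ℤ) + (j - (4 * p + 4) + e) + 2) / 4 -
      (j + 2) / 4) = (x : ℤ) - (p + 1 : ℕ) + (k + α) := by omega
    have t2 : ((4 * (x : ℤ) + (j - (4 * p + 4) + e)) / 4 - j / 4) - (((i' : ℕ) : ℤ) - (i : ℕ)) =
      (x : ℤ) - (p + 1 : ℕ) + (β - k) := by omega
    have t3 : (4 * (x : ℤ) + (j - (4 * p + 4) + e) + 1) / 2 - (j + 1) / 2 =
      2 * (x : ℤ) - 2 * (p + 1 : ℕ) + γ := by omega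
    rw [t1, t2, t3]
  rw [Finset.sum_congr rfl h2, Finset.sum_add_distrib, Finset.sum_add_distrib,
    sum_abs _ _ (by omega) (by omega), sum_abs _ _ (by omega) (by omega),
    sum_abs2 _ _ (by omega) (by omega)]
  have a01 : α = 0 ∨ α = 1 := by omega
  have b01 : β = 0 ∨ β = 1 := by omega
  clear_value α β k
  rcases a01 with rfl | rfl <;> rcases b01 with rfl | rfl <;> push_cast <;> ring

lemma sum_blocks (K : ℕ) (h : ℕ → ℤ) : ∑ t ∈ Finset.range (4 * K), h t =
    ∑ x ∈ Finset.range K, h (4 * x) + ∑ x ∈ Finset.range K, h (4 * x + 1) +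
    ∑ x ∈ Finset.range K, h (4 * x + 2) + ∑ x ∈ Finset.range K, h (4 * x + 3) := by
  induction K with
  | zero => simp
  | succ K ih =>
    rw [show 4 * (K + 1) = 4 * K + 1 + 1 + 1 + 1 by ring]
    simp only [Finset.sum_range_succ, ih]
    ring

lemma sum_zmod (M : ℕ) [NeZero M] (f : ZMod M → ℤ) :
    ∑ w : ZMod M, f w = ∑ t ∈ Finset.range M, f ((t : ℤ) : ZMod M) := by
  symm
  apply Finset.sum_bij' (fun (t : ℕ) _ => ((t : ℤ) : ZMod M)) (fun w _ => w.val)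
  · intros; simp
  · intro w _; simpa using ZMod.val_lt w
  · intro t ht; simpa using ZMod.val_natCast_of_lt (Finset.mem_range.mp ht)
  · intros; simp
  · intros; rfl

/-- The explicit automorphisms. -/
def gfun (n p : ℕ) (w : ZMod (2 * n)) (u : Fin (p + 1) × ZMod (2 * n)) :
    Fin (p + 1) × ZMod (2 * n) :=
  (if w.val % 4 / 2 = 1 then Fin.rev u.1 else u.1, if w.val % 2 = 0 then u.2 + w else w - u.2)

lemma gfun_int {n p : ℕ} (hn0 : 0 < n) (hn : 4 ∣ n) (W : ℤ) (i : Fin (p + 1)) (j : ℤ) :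
    gfun n p (W : ZMod (2 * n)) (i, (j : ZMod (2 * n))) =
    (if W % 4 / 2 = 1 then Fin.rev i else i,
      ((if W % 2 = 0 then j + W else W - j : ℤ) : ZMod (2 * n))) := by
  have hv := val_mod4 hn0 hn W
  unfold gfun
  have e1 : (W : ZMod (2 * n)).val % 4 / 2 = 1 ↔ W % 4 / 2 = 1 := by omega
  have e2 : (W : ZMod (2 * n)).val % 2 = 0 ↔ W % 2 = 0 := by omega
  simp only [e1, e2]
  split_ifs <;> push_cast <;> rfl

lemma orbit_sum {n p : ℕ} (hn : n = 4 * p + 4) [NeZero (2 * n)] (x : ZMod (2 * n)) : ∃ C : ℤ,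
    ∀ i : Fin (p + 1),
    ∑ w : ZMod (2 * n), ((AT n p).dist (i, x) (gfun n p w (i, x)) : ℤ) =
      16 * (p + 1) ^ 2 + 4 * ((p : ℤ) - 2 * (i : ℕ)) ^ 2 + C * ((p : ℤ) - 2 * (i : ℕ)) := by
  have hn0 : 0 < n := by omega
  have hn4 : 4 ∣ n := by omega
  obtain ⟨j, rfl⟩ := exists_lift_s14 x
  refine ⟨2 * (((j + (2 + j - j) % 4 + 2) / 4 - (j + 2) / 4) -
        ((j + (2 + j - j) % 4) / 4 - j / 4)) + 2 * (((j + (3 - j - j) % 4 + 2) / 4 - (j + 2) / 4) -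
        ((j + (3 - j - j) % 4) / 4 - j / 4)), fun i => ?_⟩
  rw [sum_zmod]
  have h8 : 2 * n = 4 * (2 * (p + 1)) := by omega
  conv_lhs => rw [show Finset.range (2 * n) = Finset.range (4 * (2 * (p + 1))) by rw [h8]]
  rw [sum_blocks]
  have s0 := inner_dist_sum hn i i j j
  have s1 := inner_dist_sum hn i i j (1 - j)
  have s2 := inner_dist_sum hn i (Fin.rev i) j (2 + j)
  have s3 := inner_dist_sum hn i (Fin.rev i) j (3 - j)
  have hrev : (((Fin.rev i : Fin (p + 1)) : ℕ) : ℤ) = p - (i : ℕ) := by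
    rw [Fin.val_rev]; omega
  rw [hrev] at s2 s3
  simp only [sub_self] at s0 s1
  have c0 : ∀ x ∈ Finset.range (2 * (p + 1)), ((AT n p).dist (i, (j : ZMod (2 * n)))
      (gfun n p (((4 * x : ℕ) : ℤ) : ZMod (2 * n)) (i, (j : ZMod (2 * n)))) : ℤ) =
      ((AT n p).dist (i, (j : ZMod (2 * n))) (i, ((4 * (x : ℤ) + j : ℤ) : ZMod (2 * n))) : ℤ) := by
    intro x _
    rw [gfun_int hn0 hn4, if_neg (by omega), if_pos (by omega)]
    congr 4; push_cast; ring
  have c1 : ∀ x ∈ Finset.range (2 * (p + 1)), ((AT n p).dist (i, (j : ZMod (2 * n)))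
      (gfun n p (((4 * x + 1 : ℕ) : ℤ) : ZMod (2 * n)) (i, (j : ZMod (2 * n)))) : ℤ) =
      ((AT n p).dist (i, (j : ZMod (2 * n)))
        (i, ((4 * (x : ℤ) + (1 - j) : ℤ) : ZMod (2 * n))) : ℤ) := by
    intro x _
    rw [gfun_int hn0 hn4, if_neg (by omega), if_neg (by omega)]
    congr 4; push_cast; ring
  have c2 : ∀ x ∈ Finset.range (2 * (p + 1)), ((AT n p).dist (i, (j : ZMod (2 * n)))
      (gfun n p (((4 * x + 2 : ℕ) : ℤ) : ZMod (2 * n)) (i, (j : ZMod (2 * n)))) : ℤ) =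
      ((AT n p).dist (i, (j : ZMod (2 * n)))
        (Fin.rev i, ((4 * (x : ℤ) + (2 + j) : ℤ) : ZMod (2 * n))) : ℤ) := by
    intro x _
    rw [gfun_int hn0 hn4, if_pos (by omega), if_pos (by omega)]
    congr 4; push_cast; ring
  have c3 : ∀ x ∈ Finset.range (2 * (p + 1)), ((AT n p).dist (i, (j : ZMod (2 * n)))
      (gfun n p (((4 * x + 3 : ℕ) : ℤ) : ZMod (2 * n)) (i, (j : ZMod (2 * n)))) : ℤ) =
      ((AT n p).dist (i, (j : ZMod (2 * n)))
        (Fin.rev i, ((4 * (x : ℤ) + (3 - j) : ℤ) : ZMod (2 * n))) : ℤ) := by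
    intro x _
    rw [gfun_int hn0 hn4, if_pos (by omega), if_neg (by omega)]
    congr 4; push_cast; ring
  rw [Finset.sum_congr rfl c0, Finset.sum_congr rfl c1, Finset.sum_congr rfl c2,
    Finset.sum_congr rfl c3, s0, s1, s2, s3]
  ring

lemma layer_sum (p : ℕ) (A C : ℤ) :
    3 * ∑ i : Fin (p + 1), (A + 4 * ((p : ℤ) - 2 * (i : ℕ)) ^ 2 + C * ((p : ℤ) - 2 * (i : ℕ))) =
      3 * (p + 1) * A + 4 * p * (p + 1) * (p + 2) := by
  rw [Fin.sum_univ_eq_sum_range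
    (fun i : ℕ => A + 4 * ((p : ℤ) - 2 * (i : ℕ)) ^ 2 + C * ((p : ℤ) - 2 * (i : ℕ)))]
  have gen : ∀ (m : ℕ) (P : ℤ), 3 * ∑ i ∈ Finset.range m,
      (A + 4 * (P - 2 * (i : ℕ)) ^ 2 + C * (P - 2 * (i : ℕ))) =
      3 * m * A + 4 * (3 * m * P ^ 2 - 6 * P * m * (m - 1) + 2 * (m - 1) * m * (2 * m - 1)) +
        3 * C * (m * P - m * (m - 1)) := by
    intro m P
    induction m with
    | zero => simp
    | succ m ih =>
      rw [Finset.sum_range_succ, mul_add, ih]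
      push_cast
      ring
  rw [gen]
  push_cast
  ring

lemma total_sum {n p : ℕ} (hn : n = 4 * p + 4) [NeZero (2 * n)] :
    3 * ∑ u : Fin (p + 1) × ZMod (2 * n), ∑ w : ZMod (2 * n), ((AT n p).dist u (gfun n p w u) : ℤ) =
      2 * n * (3 * (p + 1) * (16 * (p + 1) ^ 2) + 4 * p * (p + 1) * (p + 2)) := by
  rw [Fintype.sum_prod_type_right, Finset.mul_sum]
  have : ∀ x : ZMod (2 * n), 3 * ∑ i : Fin (p + 1), ∑ w : ZMod (2 * n),
      ((AT n p).dist (i, x) (gfun n p w (i, x)) : ℤ) =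
      3 * (p + 1) * (16 * (p + 1) ^ 2) + 4 * p * (p + 1) * (p + 2) := by
    intro x
    obtain ⟨C, hC⟩ := orbit_sum hn x
    simp only [hC]
    exact layer_sum p _ C
  simp only [this]
  rw [Finset.sum_const, Finset.card_univ, ZMod.card]
  simp

set_option maxHeartbeats 1000000 in
lemma gfun_adj {n p : ℕ} (hn0 : 0 < n) (hn : 4 ∣ n) (w : ZMod (2 * n))
    {u v : Fin (p + 1) × ZMod (2 * n)} (h : (AT n p).Adj u v) :
    (AT n p).Adj (gfun n p w u) (gfun n p w v) := by
  obtain ⟨W, rfl⟩ := exists_lift_s14 w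
  obtain ⟨i, x⟩ := u
  obtain ⟨j, rfl⟩ := exists_lift_s14 x
  obtain ⟨j', hj', hs⟩ := adj_lift hn0 hn h
  obtain ⟨i', x'⟩ := v
  dsimp only at hj' hs
  subst hj'
  rw [gfun_int hn0 hn, gfun_int hn0 hn]
  apply adj_proj hn0 hn
  have h1 : ((Fin.rev i : Fin (p + 1)) : ℕ) = p - (i : ℕ) := by rw [Fin.val_rev]; omega
  have h2 : ((Fin.rev i' : Fin (p + 1)) : ℕ) = p - (i' : ℕ) := by rw [Fin.val_rev]; omega
  have hm : W % 4 = 0 ∨ W % 4 = 1 ∨ W % 4 = 2 ∨ W % 4 = 3 := by omega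
  unfold HStep at *
  have b1 := i.isLt
  have b2 := i'.isLt
  clear h
  rcases hm with hm | hm | hm | hm
  · rw [if_neg (by omega), if_neg (by omega), if_pos (by omega), if_pos (by omega)]
    rcases hs with ⟨t1, t2 | t2⟩ | ⟨t1, t2 | t2⟩ | ⟨t1, t2 | t2⟩ <;> omega
  · rw [if_neg (by omega), if_neg (by omega), if_neg (by omega), if_neg (by omega)]
    rcases hs with ⟨t1, t2 | t2⟩ | ⟨t1, t2 | t2⟩ | ⟨t1, t2 | t2⟩ <;> omega
  · rw [if_pos (by omega), if_pos (by omega), if_pos (by omega), if_pos (by omega), h1, h2]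
    rcases hs with ⟨t1, t2 | t2⟩ | ⟨t1, t2 | t2⟩ | ⟨t1, t2 | t2⟩ <;> omega
  · rw [if_pos (by omega), if_pos (by omega), if_neg (by omega), if_neg (by omega), h1, h2]
    rcases hs with ⟨t1, t2 | t2⟩ | ⟨t1, t2 | t2⟩ | ⟨t1, t2 | t2⟩ <;> omega

/-- Index of the inverse automorphism. -/
def ginv (n : ℕ) (w : ZMod (2 * n)) : ZMod (2 * n) := if w.val % 2 = 0 then -w else w

lemma ginv_int {n : ℕ} (hn0 : 0 < n) (hn : 4 ∣ n) (W : ℤ) :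
    ginv n (W : ZMod (2 * n)) = ((if W % 2 = 0 then -W else W : ℤ) : ZMod (2 * n)) := by
  have hv := val_mod4 hn0 hn W
  have e2 : (W : ZMod (2 * n)).val % 2 = 0 ↔ W % 2 = 0 := by omega
  unfold ginv
  simp only [e2]
  split_ifs <;> push_cast <;> rfl

lemma ginv_ginv {n : ℕ} (hn0 : 0 < n) (hn : 4 ∣ n) (w : ZMod (2 * n)) :
    ginv n (ginv n w) = w := by
  obtain ⟨W, rfl⟩ := exists_lift_s14 w
  rw [ginv_int hn0 hn, ginv_int hn0 hn]
  congr 1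
  split_ifs <;> omega

lemma gfun_ginv {n p : ℕ} (hn0 : 0 < n) (hn : 4 ∣ n) (w : ZMod (2 * n))
    (u : Fin (p + 1) × ZMod (2 * n)) : gfun n p (ginv n w) (gfun n p w u) = u := by
  obtain ⟨W, rfl⟩ := exists_lift_s14 w
  obtain ⟨i, x⟩ := u
  obtain ⟨j, rfl⟩ := exists_lift_s14 x
  rw [ginv_int hn0 hn, gfun_int hn0 hn, gfun_int hn0 hn]
  have hm : W % 4 = 0 ∨ W % 4 = 1 ∨ W % 4 = 2 ∨ W % 4 = 3 := by omega
  ext1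
  · dsimp only
    split_ifs <;> first | rfl | exact Fin.rev_rev i | omega
  · dsimp only
    congr 1
    split_ifs <;> omega

/-- The explicit automorphism as an isomorphism. -/
def giso {n : ℕ} (p : ℕ) (hn0 : 0 < n) (hn : 4 ∣ n) (w : ZMod (2 * n)) : AT n p ≃g AT n p where
  toFun := gfun n p w
  invFun := gfun n p (ginv n w)
  left_inv := gfun_ginv hn0 hn w
  right_inv := fun u => by
    have := gfun_ginv (p := p) hn0 hn (ginv n w) u
    rwa [ginv_ginv hn0 hn] at this
  map_rel_iff' := by
    intro a b
    constructor
    · intro h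
      have := gfun_adj hn0 hn (ginv n w) h
      simpa only [Equiv.coe_fn_mk, gfun_ginv hn0 hn] using this
    · exact gfun_adj hn0 hn w

/-- At most two neighbours. -/
def Low (n p : ℕ) (v : Fin (p + 1) × ZMod (2 * n)) : Prop :=
  ∃ a b, ∀ w, (AT n p).Adj v w → w = a ∨ w = b

lemma low_iso {n p : ℕ} (α : AT n p ≃g AT n p) {v : Fin (p + 1) × ZMod (2 * n)}
    (h : Low n p v) : Low n p (α v) := by
  obtain ⟨a, b, h⟩ := h
  refine ⟨α a, α b, fun w hw => ?_⟩
  have h1 : (AT n p).Adj v (α.symm w) := by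
    rw [← α.map_adj_iff]; simpa using hw
  rcases h _ h1 with h2 | h2
  · left; rw [← h2]; simp
  · right; rw [← h2]; simp

lemma low_iff {n p : ℕ} (hn0 : 0 < n) (hn : 4 ∣ n) (i : Fin (p + 1)) (j : ℤ) :
    Low n p (i, (j : ZMod (2 * n))) ↔
      ((i : ℕ) = 0 ∧ j % 4 < 2) ∨ ((i : ℕ) = p ∧ 2 ≤ j % 4) := by
  constructor
  · rintro ⟨a, b, h⟩
    by_contra hcon
    have h1 := h _ (adj_proj hn0 hn (i' := i) (j' := j + 1) (by unfold HStep; omega))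
    have h2 := h _ (adj_proj hn0 hn (i' := i) (j' := j - 1) (by unfold HStep; omega))
    have hne : (i, ((j + 1 : ℤ) : ZMod (2 * n))) ≠ (i, ((j - 1 : ℤ) : ZMod (2 * n))) := by
      intro he
      exact cast_ne hn0 hn (show (j + 1) % 4 ≠ (j - 1) % 4 by omega) (Prod.mk.inj he).2
    obtain ⟨i', j', hi', hs⟩ : ∃ (i' : Fin (p + 1)) (j' : ℤ), i' ≠ i ∧
        HStep (i : ℕ) j (i' : ℕ) j' := by
      have hm : j % 4 = 0 ∨ j % 4 = 1 ∨ j % 4 = 2 ∨ j % 4 = 3 := by omega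
      rcases hm with hm | hm | hm | hm
      · exact ⟨⟨(i : ℕ) - 1, by omega⟩, j - 1, by rw [Ne, Fin.ext_iff]; dsimp only; omega,
          by unfold HStep; dsimp only; omega⟩
      · exact ⟨⟨(i : ℕ) - 1, by omega⟩, j + 1, by rw [Ne, Fin.ext_iff]; dsimp only; omega,
          by unfold HStep; dsimp only; omega⟩
      · exact ⟨⟨(i : ℕ) + 1, by omega⟩, j - 1, by rw [Ne, Fin.ext_iff]; dsimp only; omega,
          by unfold HStep; dsimp only; omega⟩
      · exact ⟨⟨(i : ℕ) + 1, by omega⟩, j + 1, by rw [Ne, Fin.ext_iff]; dsimp only; omega,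
          by unfold HStep; dsimp only; omega⟩
    have h3 := h _ (adj_proj hn0 hn hs)
    have n1 : (i', (j' : ZMod (2 * n))) ≠ (i, ((j + 1 : ℤ) : ZMod (2 * n))) :=
      fun he => hi' (Prod.mk.inj he).1
    have n2 : (i', (j' : ZMod (2 * n))) ≠ (i, ((j - 1 : ℤ) : ZMod (2 * n))) :=
      fun he => hi' (Prod.mk.inj he).1
    rcases h1 with h1 | h1 <;> rcases h2 with h2 | h2 <;> rcases h3 with h3 | h3 <;>
      rw [h1, h2] at hne <;> rw [h3, h1] at n1 <;> rw [h3, h2] at n2 <;>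
      first | exact hne rfl | exact n1 rfl | exact n2 rfl
  · intro h
    refine ⟨(i, ((j + 1 : ℤ) : ZMod (2 * n))), (i, ((j - 1 : ℤ) : ZMod (2 * n))), fun w hw => ?_⟩
    obtain ⟨j', hj', hs⟩ := adj_lift hn0 hn hw
    obtain ⟨i', x⟩ := w
    dsimp only at hj' hs
    subst hj'
    unfold HStep at hs
    have hi : i' = i := Fin.ext (by omega)
    subst hi
    have : j' = j + 1 ∨ j' = j - 1 := by omega
    rcases this with rfl | rfl <;> simp

/-- If an automorphism fixes `v` and all its neighbours except possibly `c`, it fixes `c`. -/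
lemma third_fixed {V : Type*} {G : SimpleGraph V} (α : G ≃g G) {v c : V} (hv : α v = v)
    (hc : G.Adj v c) (h : ∀ w, G.Adj v w → w = c ∨ α w = w) : α c = c := by
  have h1 : G.Adj v (α c) := by
    have := α.map_adj_iff.mpr hc
    rwa [hv] at this
  rcases h _ h1 with h2 | h2
  · exact h2
  · exact α.injective h2

lemma zmod_all {n : ℕ} (hn0 : 0 < n) (Q : ZMod (2 * n) → Prop)
    (h : ∀ m : ℕ, Q ((m : ℤ) : ZMod (2 * n))) (x : ZMod (2 * n)) : Q x := by
  have : NeZero (2 * n) := ⟨by omega⟩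
  have := h x.val
  simpa using this

lemma rigid0 {n p : ℕ} (hn0 : 0 < n) (hn : 4 ∣ n) (hp : 2 ≤ p) (α : AT n p ≃g AT n p)
    (h0 : α (0, ((0 : ℤ) : ZMod (2 * n))) = (0, ((0 : ℤ) : ZMod (2 * n)))) (m : ℕ) :
    α (0, ((m : ℤ) : ZMod (2 * n))) = (0, ((m : ℤ) : ZMod (2 * n))) ∧
    α (0, ((m + 1 : ℤ) : ZMod (2 * n))) = (0, ((m + 1 : ℤ) : ZMod (2 * n))) := by
  have z0 : ((0 : Fin (p + 1)) : ℕ) = 0 := rfl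
  induction m with
  | zero =>
    refine ⟨by simpa using h0, ?_⟩
    have hadj : (AT n p).Adj (0, ((0 : ℤ) : ZMod (2 * n))) (0, ((1 : ℤ) : ZMod (2 * n))) :=
      adj_proj hn0 hn (by unfold HStep; omega)
    have h1 := α.map_adj_iff.mpr hadj
    rw [h0] at h1
    have h2 : Low n p (α (0, ((1 : ℤ) : ZMod (2 * n)))) :=
      low_iso α ((low_iff hn0 hn 0 1).mpr (by omega))
    rw [show (((0 : ℕ) : ℤ) + 1) = 1 by norm_num]
    generalize α (0, ((1 : ℤ) : ZMod (2 * n))) = y at h1 h2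
    obtain ⟨j', hj', hs⟩ := adj_lift hn0 hn h1
    obtain ⟨i', x⟩ := y
    dsimp only at hj' hs
    subst hj'
    rw [low_iff hn0 hn] at h2
    unfold HStep at hs
    have e1 : i' = 0 := Fin.ext (by omega)
    have e2 : j' = 1 := by omega
    rw [e1, e2]
  | succ m ih =>
    obtain ⟨ha, hb⟩ := ih
    refine ⟨by simpa using hb, ?_⟩
    rw [show ((m + 1 : ℕ) : ℤ) + 1 = (m : ℤ) + 2 by push_cast; ring]
    have hadj : (AT n p).Adj (0, ((m + 1 : ℤ) : ZMod (2 * n))) (0, ((m + 2 : ℤ) : ZMod (2 * n))) :=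
      adj_proj hn0 hn (by unfold HStep; omega)
    have h1 := α.map_adj_iff.mpr hadj
    rw [hb] at h1
    have hinj : α (0, ((m + 2 : ℤ) : ZMod (2 * n))) ≠ (0, ((m : ℤ) : ZMod (2 * n))) := by
      rw [← ha]
      intro he
      exact cast_ne hn0 hn (show (m + 2 : ℤ) % 4 ≠ (m : ℤ) % 4 by omega)
        (Prod.mk.inj (α.injective he)).2
    have h2 : (m + 2 : ℤ) % 4 < 2 → Low n p (α (0, ((m + 2 : ℤ) : ZMod (2 * n)))) :=
      fun h => low_iso α ((low_iff hn0 hn 0 _).mpr (by omega))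
    have hadj3 : (AT n p).Adj (0, ((m + 2 : ℤ) : ZMod (2 * n))) (0, ((m + 3 : ℤ) : ZMod (2 * n))) :=
      adj_proj hn0 hn (by unfold HStep; omega)
    have h3 := α.map_adj_iff.mpr hadj3
    have h4 : (m + 3 : ℤ) % 4 < 2 → Low n p (α (0, ((m + 3 : ℤ) : ZMod (2 * n)))) :=
      fun h => low_iso α ((low_iff hn0 hn 0 _).mpr (by omega))
    generalize α (0, ((m + 2 : ℤ) : ZMod (2 * n))) = y at *
    generalize α (0, ((m + 3 : ℤ) : ZMod (2 * n))) = z at *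
    obtain ⟨j', hj', hs⟩ := adj_lift hn0 hn h1
    obtain ⟨i', x⟩ := y
    dsimp only at hj' hs
    subst hj'
    obtain ⟨j2, hj2, hs2⟩ := adj_lift hn0 hn h3
    obtain ⟨i2, x2⟩ := z
    dsimp only at hj2 hs2
    subst hj2
    rw [low_iff hn0 hn] at h2 h4
    have hcase : ((i' : ℕ) = 0 ∧ j' = m) ∨ ((i' : ℕ) = 0 ∧ j' = m + 2) := by
      unfold HStep at hs hs2
      omega
    rcases hcase with ⟨e1, e2⟩ | ⟨e1, e2⟩
    · exact absurd (by rw [show i' = 0 from Fin.ext (by omega), e2]) hinj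
    · rw [show i' = 0 from Fin.ext (by omega), e2]

lemma rigid {n p : ℕ} (hn0 : 0 < n) (hn : 4 ∣ n) (hp : 2 ≤ p) (α : AT n p ≃g AT n p)
    (h0 : α (0, ((0 : ℤ) : ZMod (2 * n))) = (0, ((0 : ℤ) : ZMod (2 * n))))
    (v : Fin (p + 1) × ZMod (2 * n)) : α v = v := by
  have key : ∀ (i : ℕ) (hi : i < p + 1) (j : ℤ),
      α (⟨i, hi⟩, (j : ZMod (2 * n))) = (⟨i, hi⟩, (j : ZMod (2 * n))) := by
    intro i
    induction i with
    | zero =>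
      intro hi j
      exact zmod_all hn0 (fun x => α (0, x) = (0, x))
        (fun m => (rigid0 hn0 hn hp α h0 m).1) _
    | succ i ih =>
      intro hi
      have hi0 : i < p + 1 := by omega
      have low : ∀ j : ℤ, j % 4 < 2 →
          α (⟨i + 1, hi⟩, (j : ZMod (2 * n))) = (⟨i + 1, hi⟩, (j : ZMod (2 * n))) := by
        intro j hj
        obtain ⟨j1, hj1⟩ : ∃ j1 : ℤ, (j % 4 = 0 ∧ j1 = j - 1) ∨ (j % 4 = 1 ∧ j1 = j + 1) := by
          by_cases h : j % 4 = 0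
          · exact ⟨j - 1, by omega⟩
          · exact ⟨j + 1, by omega⟩
        refine third_fixed α (ih hi0 j1)
          (adj_proj hn0 hn (by unfold HStep; dsimp only; omega)) (fun w hw => ?_)
        obtain ⟨j', hj', hs⟩ := adj_lift hn0 hn hw
        obtain ⟨i', x⟩ := w
        dsimp only at hj' hs
        subst hj'
        unfold HStep at hs
        by_cases hi' : (i' : ℕ) = i
        · right
          have e : i' = ⟨i, hi0⟩ := Fin.ext hi'
          rw [e]
          exact ih hi0 j'
        · left
          have e : i' = ⟨i + 1, hi⟩ := Fin.ext (by dsimp only; omega)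
          have e2 : j' = j := by omega
          rw [e, e2]
      intro j
      by_cases hj : j % 4 < 2
      · exact low j hj
      obtain ⟨j1, hj1⟩ : ∃ j1 : ℤ, (j % 4 = 2 ∧ j1 = j - 1) ∨ (j % 4 = 3 ∧ j1 = j + 1) := by
        by_cases h : j % 4 = 2
        · exact ⟨j - 1, by omega⟩
        · exact ⟨j + 1, by omega⟩
      refine third_fixed α (low j1 (by omega))
        (adj_proj hn0 hn (by unfold HStep; dsimp only; omega)) (fun w hw => ?_)
      obtain ⟨j', hj', hs⟩ := adj_lift hn0 hn hw
      obtain ⟨i', x⟩ := w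
      dsimp only at hj' hs
      subst hj'
      unfold HStep at hs
      by_cases hi' : (i' : ℕ) = i
      · right
        have e : i' = ⟨i, hi0⟩ := Fin.ext hi'
        rw [e]
        exact ih hi0 j'
      · have e : i' = ⟨i + 1, hi⟩ := Fin.ext (by dsimp only; omega)
        rw [e]
        by_cases e2 : j' = j
        · left; rw [e2]
        · right; exact low j' (by omega)
  obtain ⟨⟨i, hi⟩, x⟩ := v
  obtain ⟨j, rfl⟩ := exists_lift_s14 x
  exact key i hi j

lemma giso_bij {n p : ℕ} (hn0 : 0 < n) (hn : 4 ∣ n) (hp : 2 ≤ p) :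
    Function.Bijective (giso (n := n) p hn0 hn) := by
  have base : ∀ W : ℤ, giso p hn0 hn (W : ZMod (2 * n)) (0, ((0 : ℤ) : ZMod (2 * n))) =
      (if W % 4 / 2 = 1 then Fin.rev 0 else 0, (W : ZMod (2 * n))) := by
    intro W
    refine (gfun_int hn0 hn W 0 0).trans ?_
    split_ifs <;> simp
  constructor
  · intro w w' h
    obtain ⟨W, rfl⟩ := exists_lift_s14 w
    obtain ⟨W', rfl⟩ := exists_lift_s14 w'
    have h1 := base W
    rw [h, base W'] at h1
    exact (Prod.mk.inj h1).2.symm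
  · intro α
    have hl : Low n p (α (0, ((0 : ℤ) : ZMod (2 * n)))) :=
      low_iso α ((low_iff hn0 hn 0 0).mpr (by left; exact ⟨rfl, by norm_num⟩))
    obtain ⟨W, hW⟩ : ∃ W : ℤ, α (0, ((0 : ℤ) : ZMod (2 * n))) =
        (if W % 4 / 2 = 1 then Fin.rev 0 else 0, (W : ZMod (2 * n))) := by
      generalize α (0, ((0 : ℤ) : ZMod (2 * n))) = y at hl
      obtain ⟨i, x⟩ := y
      obtain ⟨W, rfl⟩ := exists_lift_s14 x
      refine ⟨W, ?_⟩
      rw [low_iff hn0 hn] at hl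
      rcases hl with ⟨h1, h2⟩ | ⟨h1, h2⟩
      · rw [if_neg (by omega), show i = 0 from Fin.ext h1]
      · rw [if_pos (by omega), show i = Fin.rev 0 from Fin.ext (by rw [Fin.val_rev]; simpa using h1)]
    refine ⟨(W : ZMod (2 * n)), ?_⟩
    have hfix := rigid hn0 hn hp (α.trans (giso p hn0 hn (W : ZMod (2 * n))).symm) (by
      rw [RelIso.trans_apply, hW, ← base W, RelIso.symm_apply_apply])
    apply RelIso.ext
    intro v
    have := hfix v
    rw [RelIso.trans_apply] at this
    rw [← this, RelIso.apply_symm_apply, this]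

theorem stmt14 (n p : ℕ) (hp : 3 ≤ p) (hn : n = 4 * p + 4) :
    GPindex (AT n p) =
      ((p : ℚ) + 1) * ((n : ℚ) ^ 3 * (p : ℚ) + 3 * (n : ℚ) ^ 3 / 4 +
        2 * (n : ℚ) ^ 2 * (p : ℚ) + (n : ℚ) ^ 2 + 4 * (n : ℚ) * (p : ℚ) ^ 3 / 3 -
        4 * (n : ℚ) * (p : ℚ) / 3) := by
  have hn0 : 0 < n := by omega
  have hn4 : 4 ∣ n := by omega
  have : NeZero (2 * n) := ⟨by omega⟩
  let e : ZMod (2 * n) ≃ (AT n p ≃g AT n p) := Equiv.ofBijective _ (giso_bij hn0 hn4 (by omega))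
  have hcard : Nat.card (AT n p ≃g AT n p) = 2 * n := by
    rw [← Nat.card_congr e, Nat.card_eq_fintype_card, ZMod.card]
  have hV : Nat.card (Fin (p + 1) × ZMod (2 * n)) = (p + 1) * (2 * n) := by
    rw [Nat.card_eq_fintype_card, Fintype.card_prod, ZMod.card, Fintype.card_fin]
  have hsum : ∀ u : Fin (p + 1) × ZMod (2 * n),
      ∑ᶠ α : AT n p ≃g AT n p, ((AT n p).dist u (α u) : ℚ) =
      ∑ w : ZMod (2 * n), ((AT n p).dist u (gfun n p w u) : ℚ) := by
    intro u
    rw [← finsum_comp_equiv e, finsum_eq_sum_of_fintype]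
    rfl
  unfold GPindex
  rw [hcard, hV]
  simp only [hsum]
  rw [finsum_eq_sum_of_fintype]
  have ht := total_sum (p := p) hn
  have ht' : (3 : ℚ) * ∑ u : Fin (p + 1) × ZMod (2 * n), ∑ w : ZMod (2 * n),
      ((AT n p).dist u (gfun n p w u) : ℚ) =
      2 * n * (3 * (p + 1) * (16 * (p + 1) ^ 2) + 4 * p * (p + 1) * (p + 2)) := by
    exact_mod_cast ht
  generalize ∑ u : Fin (p + 1) × ZMod (2 * n), ∑ w : ZMod (2 * n),
      ((AT n p).dist u (gfun n p w u) : ℚ) = S at ht'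
  have hS : S = 2 * n * (3 * (p + 1) * (16 * (p + 1) ^ 2) + 4 * p * (p + 1) * (p + 2)) / 3 := by
    linarith
  have hnq : (n : ℚ) ≠ 0 := by exact_mod_cast hn0.ne'
  have hnp : (n : ℚ) = 4 * p + 4 := by rw [hn]; push_cast; ring
  rw [hS]
  push_cast
  have : ((p : ℚ) + 1) * (2 * n) / (2 * (2 * n)) = (p + 1) / 2 := by field_simp
  rw [this, hnp]
  ring
end
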